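/- arXiv:2312.12626 — 6 statements merged into one kernel-verified Lean document; each statement's English description precedes it below -/
import Mathlib

section
/- For every integer n ≥ 2 there exists a constant c > 0 (depending only on n) such that for all integers H ≥ 1, the number N_n(H) of matrices in M_n(ℤ;H) that are not diagonalisable over ℂ satisfies N_n(H) ≥ c · H^((n² + n − 2)/2). -/
open Matrix Polynomial

/-- If `M` is diagonalisable and `(M - a)² v = 0` then `(M - a) v = 0`. -/
lemma diag_sq_kernel {n : ℕ} (M P : Matrix (Fin n) (Fin n) ℂ) (hP : IsUnit P.det)
    (hD : Matrix.IsDiag (P⁻¹ * M * P)) (v u : Fin n → ℂ) (a : ℂ)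
    (h1 : M *ᵥ v = a • v + u) (h2 : M *ᵥ u = a • u) : u = 0 := by
  have hPP : P * P⁻¹ = 1 := Matrix.mul_nonsing_inv P hP
  set D := P⁻¹ * M * P with hDdef
  have hDP : D * P⁻¹ = P⁻¹ * M := by
    rw [hDdef, Matrix.mul_assoc, hPP, Matrix.mul_one]
  have hdiag : ∀ (w : Fin n → ℂ) (i : Fin n), (D *ᵥ w) i = D i i * w i := by
    intro w i
    rw [Matrix.mulVec, dotProduct, Finset.sum_eq_single i]
    · intro j _ hj
      rw [hD hj.symm, zero_mul]
    · simp
  have k1 : D *ᵥ (P⁻¹ *ᵥ v) = a • (P⁻¹ *ᵥ v) + P⁻¹ *ᵥ u := by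
    rw [Matrix.mulVec_mulVec, hDP, ← Matrix.mulVec_mulVec, h1, Matrix.mulVec_add,
      Matrix.mulVec_smul]
  have k2 : D *ᵥ (P⁻¹ *ᵥ u) = a • (P⁻¹ *ᵥ u) := by
    rw [Matrix.mulVec_mulVec, hDP, ← Matrix.mulVec_mulVec, h2, Matrix.mulVec_smul]
  have k3 : P⁻¹ *ᵥ u = 0 := by
    funext i
    have q1 := congrFun k1 i
    have q2 := congrFun k2 i
    rw [hdiag] at q1 q2
    simp only [Pi.add_apply, Pi.smul_apply, smul_eq_mul] at q1 q2
    have q3 : (P⁻¹ *ᵥ u) i * (P⁻¹ *ᵥ u) i = 0 := by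
      linear_combination (P⁻¹ *ᵥ v) i * q2 - (P⁻¹ *ᵥ u) i * q1
    exact mul_self_eq_zero.1 q3
  have : P *ᵥ (P⁻¹ *ᵥ u) = u := by
    rw [Matrix.mulVec_mulVec, hPP, Matrix.one_mulVec]
  rw [← this, k3, Matrix.mulVec_zero]

lemma card_upper (n : ℕ) :
    (Finset.univ.filter (fun p : Fin n × Fin n => p.1 ≤ p.2)).card * 2 = n * (n + 1) := by
  have h : (Finset.univ.filter (fun p : Fin n × Fin n => p.1 ≤ p.2)).card
      = ∑ j : Fin n, ((j : ℕ) + 1) := by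
    rw [Finset.card_filter, Fintype.sum_prod_type_right]
    refine Finset.sum_congr rfl fun j _ => ?_
    rw [← Finset.card_filter, ← Fin.card_Iic]
    congr 1
    ext i
    simp
  rw [h, Fin.sum_univ_eq_sum_range (fun j => j + 1) n]
  have := Finset.sum_range_id_mul_two (n + 1)
  rw [Finset.sum_range_succ'] at this
  simpa [mul_comm] using this

/-- The index set of free entries: weakly upper triangular, without `(1,1)`. -/
abbrev FreeIdx (n : ℕ) (z o : Fin n) := {p : Fin n × Fin n // p.1 ≤ p.2 ∧ p ≠ (o, o)}

/-- The upper triangular matrix with the given free entries, and entry `(1,1)` equal to `(0,0)`. -/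
def mkMat {n H : ℕ} (z o : Fin n) (hz : (z, z) ≠ (o, o)) (f : FreeIdx n z o → Fin H) :
    Matrix (Fin n) (Fin n) ℤ := fun i j =>
  if h : i ≤ j ∧ (i, j) ≠ (o, o) then ((f ⟨(i, j), h⟩ : ℕ) : ℤ) + 1
  else if (i, j) = (o, o) then ((f ⟨(z, z), le_refl _, hz⟩ : ℕ) : ℤ) + 1 else 0

/-- Theorem 1.2 (lower bound): the number of matrices in `M_n(ℤ;H)` that are not
diagonalisable over `ℂ` is `≫ H^((n²+n-2)/2)`. -/
theorem non_diagonalisable_count_lower_bound (n : ℕ) (hn : 2 ≤ n) :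
    ∃ c : ℝ, 0 < c ∧ ∀ H : ℕ, 1 ≤ H →
      c * (H : ℝ) ^ (((n : ℤ) ^ 2 + (n : ℤ) - 2) / 2) ≤
        (Set.ncard {A : Matrix (Fin n) (Fin n) ℤ | (∀ i j, |A i j| ≤ (H : ℤ)) ∧
          ¬ ∃ P : Matrix (Fin n) (Fin n) ℂ, IsUnit P.det ∧
            Matrix.IsDiag (P⁻¹ * A.map (Int.cast : ℤ → ℂ) * P)} : ℝ) := by
  refine ⟨1, one_pos, fun H hH => ?_⟩
  set S := {A : Matrix (Fin n) (Fin n) ℤ | (∀ i j, |A i j| ≤ (H : ℤ)) ∧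
          ¬ ∃ P : Matrix (Fin n) (Fin n) ℂ, IsUnit P.det ∧
            Matrix.IsDiag (P⁻¹ * A.map (Int.cast : ℤ → ℂ) * P)} with hS
  let z : Fin n := ⟨0, by omega⟩
  let o : Fin n := ⟨1, by omega⟩
  have hzo : z ≠ o := by simp [z, o]
  have hz : (z, z) ≠ (o, o) := by simp [hzo]
  have hfin : S.Finite := by
    have : (Set.univ.pi fun _ : Fin n => Set.univ.pi fun _ : Fin n =>
        Set.Icc (-(H : ℤ)) H).Finite :=
      Set.Finite.pi fun _ => Set.Finite.pi fun _ => Set.finite_Icc _ _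
    refine this.subset fun A hA => ?_
    simp only [Set.mem_pi, Set.mem_univ, true_imp_iff]
    exact fun i j => abs_le.1 (hA.1 i j)
  have hinj : Function.Injective (mkMat (H := H) z o hz) := by
    intro f g hfg
    funext ⟨⟨i, j⟩, hp⟩
    have := congrFun (congrFun hfg i) j
    simp only [mkMat, dif_pos hp] at this
    ext
    exact_mod_cast add_right_cancel this
  have hsub : Set.range (mkMat (H := H) z o hz) ⊆ S := by
    rintro _ ⟨f, rfl⟩
    refine ⟨fun i j => ?_, ?_⟩
    · unfold mkMat
      split_ifs with h1 h2
      · have := (f ⟨(i, j), h1⟩).2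
        rw [abs_le]; omega
      · have := (f ⟨(z, z), le_refl _, hz⟩).2
        rw [abs_le]; omega
      · simp
    · rintro ⟨P, hP, hD⟩
      have hle : z ≤ o := by simp [z, o, Fin.le_def]
      set A := mkMat z o hz f with hA
      have e00 : A z z = A o o := by
        simp [hA, mkMat, hz, hzo]
      have e01 : A z o ≠ 0 := by
        have : A z o = ((f ⟨(z, o), hle, by simp [hzo]⟩ : ℕ) : ℤ) + 1 := by
          simp [hA, mkMat, hle, hzo]
        omega
      have e0 : ∀ i, i ≠ z → A i z = 0 := by
        intro i hi
        have : ¬ i ≤ z := by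
          simp only [Fin.le_def, z, Fin.ext_iff, ne_eq] at *; omega
        simp [hA, mkMat, this, hzo]
      have e1 : ∀ i, i ≠ z → i ≠ o → A i o = 0 := by
        intro i hi hi'
        have : ¬ i ≤ o := by
          simp only [Fin.le_def, z, o, Fin.ext_iff, ne_eq] at *; omega
        simp [hA, mkMat, this, hi']
      have key := diag_sq_kernel _ P hP hD (Pi.single o 1) (Pi.single z (A z o : ℂ)) (A z z : ℂ)
        (by
          ext i
          by_cases h : i = z
          · subst h; simp [hzo]
          · by_cases h' : i = o
            · subst h'; simp [hzo.symm, e00]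
            · simp [h, h', e1 i h h'])
        (by
          ext i
          by_cases h : i = z
          · subst h; simp
          · simp [h, e0 i h])
      have := congrFun key z
      simp at this
      exact e01 this
  have hcard : Fintype.card (FreeIdx n z o) = (n * (n + 1)) / 2 - 1 := by
    rw [Fintype.card_subtype]
    have : (Finset.univ.filter fun p : Fin n × Fin n => p.1 ≤ p.2 ∧ p ≠ (o, o))
        = (Finset.univ.filter (fun p : Fin n × Fin n => p.1 ≤ p.2)).erase (o, o) := by
      ext p; simp [and_comm]
    rw [this, Finset.card_erase_of_mem (by simp)]
    have := card_upper n
    omega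
  have hexp : (((n : ℤ) ^ 2 + (n : ℤ) - 2) / 2) = ((Fintype.card (FreeIdx n z o) : ℕ) : ℤ) := by
    rw [hcard]
    have h1 : (n : ℤ) ^ 2 + n = ((n * (n + 1) : ℕ) : ℤ) := by push_cast; ring
    have h2 : 2 * 3 ≤ n * (n + 1) := Nat.mul_le_mul hn (by omega)
    rw [h1]
    omega
  have hcount : H ^ Fintype.card (FreeIdx n z o) ≤ S.ncard := by
    calc H ^ Fintype.card (FreeIdx n z o)
        = (Set.range (mkMat (H := H) z o hz)).ncard := by
          rw [← Set.image_univ, Set.ncard_image_of_injective _ hinj, Set.ncard_univ,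
            Nat.card_eq_fintype_card, Fintype.card_fun, Fintype.card_fin]
      _ ≤ S.ncard := Set.ncard_le_ncard hsub hfin
  rw [one_mul, hexp, zpow_natCast]
  exact_mod_cast hcount
end

section
/- There exists a constant C > 0 such that for all integers H ≥ 2, the number R_5(H) of 5×5 matrices in M_5(ℤ;H) whose characteristic polynomial has a repeated complex root satisfies R_5(H) ≤ C · H^(25 − 4) · log H = C · H^21 · log H. -/
open Matrix Polynomial

theorem int_root (p : ℤ[X]) (hp : p.Monic) (hd : p.natDegree = 5)
    (h : ¬ Squarefree (p.map (Int.castRingHom ℂ))) : ∃ l : ℤ, p.IsRoot l := by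
  suffices hh : ∃ r : ℚ, (p.map (Int.castRingHom ℚ)).IsRoot r by
    obtain ⟨r, hr⟩ := hh
    have hr' : aeval r p = 0 := by
      rw [IsRoot.def, eval_map] at hr
      exact hr
    obtain ⟨l, hl, -⟩ := exists_integer_of_is_root_of_monic hp hr'
    refine ⟨l, ?_⟩
    rw [hl] at hr'
    rw [aeval_algebraMap_apply] at hr'
    have := (algebraMap ℤ ℚ).injective_int (a₁ := aeval l p) (a₂ := 0) (by simpa using hr')
    simpa [IsRoot.def] using this
  set q := p.map (Int.castRingHom ℚ) with hq
  have hq0 : q ≠ 0 := (hp.map _).ne_zero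
  have hqd : q.natDegree = 5 := by rw [hq, hp.natDegree_map, hd]
  have hns : ¬ Squarefree q := by
    intro hs
    apply h
    have := (PerfectField.separable_iff_squarefree.mpr hs).map (f := algebraMap ℚ ℂ)
    rw [hq, Polynomial.map_map] at this
    have e : (algebraMap ℚ ℂ).comp (Int.castRingHom ℚ) = Int.castRingHom ℂ := RingHom.ext_int _ _
    rw [e] at this
    exact this.squarefree
  rw [squarefree_iff_irreducible_sq_not_dvd_of_ne_zero hq0] at hns
  push Not at hns
  obtain ⟨g, hg, k, hk⟩ := hns
  have hg0 : g ≠ 0 := hg.ne_zero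
  have hk0 : k ≠ 0 := by rintro rfl; simp at hk; exact hq0 hk
  have hdeg : g.natDegree + g.natDegree + k.natDegree = 5 := by
    rw [← hqd, hk, natDegree_mul (mul_ne_zero hg0 hg0) hk0, natDegree_mul hg0 hg0]
  have hgpos : 0 < g.natDegree := hg.natDegree_pos
  have hcase : g.natDegree = 1 ∨ k.natDegree = 1 := by omega
  rcases hcase with h1 | h1
  · obtain ⟨x, hx⟩ := exists_root_of_degree_eq_one ((degree_eq_iff_natDegree_eq_of_pos one_pos).mpr h1)
    refine ⟨x, ?_⟩
    rw [IsRoot.def] at hx ⊢; rw [hk]; simp [hx]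
  · obtain ⟨x, hx⟩ := exists_root_of_degree_eq_one ((degree_eq_iff_natDegree_eq_of_pos one_pos).mpr h1)
    refine ⟨x, ?_⟩
    rw [IsRoot.def] at hx ⊢; rw [hk]; simp [hx]

theorem eig_bound (A : Matrix (Fin 5) (Fin 5) ℤ) (H : ℕ) (hA : ∀ i j, |A i j| ≤ (H : ℤ)) (l : ℤ)
    (hl : (A - scalar (Fin 5) l).det = 0) : |l| ≤ 5 * H := by
  by_contra hcon
  push Not at hcon
  have := det_ne_zero_of_sum_row_lt_diag (A := (A - scalar (Fin 5) l).map (Int.castRingHom ℝ)) ?_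
  · apply this
    rw [← RingHom.mapMatrix_apply, ← RingHom.map_det, hl]; simp
  · intro k
    have h1 : ∀ j ∈ Finset.univ.erase k, ‖((A - scalar (Fin 5) l).map (Int.castRingHom ℝ)) k j‖ ≤ (H:ℝ) := by
      intro j hj
      have hkj : k ≠ j := (Finset.ne_of_mem_erase hj).symm
      simp only [map_apply, Matrix.sub_apply, scalar_apply, diagonal_apply_ne _ hkj, sub_zero]
      simp only [eq_intCast, Real.norm_eq_abs]
      exact_mod_cast hA k j
    have h2 := Finset.sum_le_card_nsmul _ _ _ h1
    refine h2.trans_lt ?_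
    simp only [map_apply, Matrix.sub_apply, scalar_apply, diagonal_apply_eq]
    simp only [eq_intCast, Real.norm_eq_abs, Finset.card_erase_of_mem (Finset.mem_univ k),
      Finset.card_univ, Fintype.card_fin, nsmul_eq_mul, Nat.reduceSub]
    have h3 : (4 * H : ℤ) < |A k k - l| := by
      have := hA k k
      have := abs_sub_abs_le_abs_sub l (A k k)
      rw [abs_sub_comm] at this
      linarith
    exact_mod_cast h3

/-- integer vectors in a box -/
noncomputable def vbox (H : ℕ) : Finset (Fin 5 → ℤ) := Fintype.piFinset fun _ => Finset.Icc (-(H : ℤ)) H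

theorem mem_vbox {H : ℕ} {x : Fin 5 → ℤ} : x ∈ vbox H ↔ ∀ i, |x i| ≤ (H : ℤ) := by
  simp [vbox, abs_le]

theorem card_vbox (H : ℕ) : (vbox H).card = (2 * H + 1) ^ 5 := by
  simp [vbox]; omega

/-- the coordinatewise cast to the rationals -/
def qc (x : Fin 5 → ℤ) : Fin 5 → ℚ := fun i => (x i : ℚ)

/-- pairing with a fixed vector -/
def dotL (v : Fin 5 → ℚ) : (Fin 5 → ℚ) →ₗ[ℚ] ℚ where
  toFun x := x ⬝ᵥ v
  map_add' x y := add_dotProduct x y v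
  map_smul' c x := smul_dotProduct c x v

@[simp] theorem dotL_apply (v x : Fin 5 → ℚ) : dotL v x = x ⬝ᵥ v := rfl

theorem exists_hyper (H : ℕ) (hH : 1 ≤ H) (A : Matrix (Fin 5) (Fin 5) ℤ)
    (hA : ∀ i j, |A i j| ≤ (H : ℤ)) (hdet : A.det = 0) :
    ∃ S : Finset (Fin 5 → ℤ), S ⊆ vbox H ∧ (∀ i, A i ∈ S) ∧
      Submodule.span ℚ (qc '' S) ≠ ⊤ ∧
      ∀ i, qc (Pi.single i 1) ∈ Submodule.span ℚ (qc '' S) ∨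
        Submodule.span ℚ (insert (qc (Pi.single i 1)) (qc '' S)) = ⊤ := by
  classical
  let F : Finset (Finset (Fin 5 → ℤ)) := (vbox H).powerset.filter fun S : Finset (Fin 5 → ℤ) => (∀ i, A i ∈ S) ∧ Submodule.span ℚ (qc '' S) ≠ ⊤
  have hF : F.Nonempty := by
    refine ⟨Finset.univ.image fun i => A i, ?_⟩
    simp only [F, Finset.mem_filter, Finset.mem_powerset]
    refine ⟨?_, fun i => Finset.mem_image_of_mem _ (Finset.mem_univ i), ?_⟩
    · intro x hx
      obtain ⟨i, -, rfl⟩ := Finset.mem_image.mp hx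
      exact mem_vbox.mpr (hA i)
    · intro htop
      have h0 : (A.map (Int.castRingHom ℚ)).det = 0 := by
        rw [← RingHom.mapMatrix_apply, ← RingHom.map_det, hdet]; simp
      obtain ⟨v, hv, hv0⟩ := Matrix.exists_mulVec_eq_zero_iff.mpr h0
      apply hv
      have hle : Submodule.span ℚ (qc '' ((Finset.univ.image fun i => A i : Finset _) : Set (Fin 5 → ℤ)))
          ≤ LinearMap.ker (dotL v) := by
        rw [Submodule.span_le]
        rintro _ ⟨x, hx, rfl⟩
        simp only [Finset.coe_image, Finset.coe_univ, Set.image_univ, Set.mem_range] at hx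
        obtain ⟨i, rfl⟩ := hx
        have := congrFun hv0 i
        simpa [Matrix.mulVec, qc, dotProduct] using this
      rw [htop] at hle
      ext i
      have := hle (Submodule.mem_top (x := Pi.single i 1))
      simpa using this
  obtain ⟨S, hS, hmax⟩ := F.exists_max_image Finset.card hF
  simp only [F, Finset.mem_filter, Finset.mem_powerset] at hS
  refine ⟨S, hS.1, hS.2.1, hS.2.2, fun i => ?_⟩
  by_contra hcon
  push Not at hcon
  have hn : Pi.single i 1 ∉ S := fun h => hcon.1 (Submodule.subset_span ⟨_, h, rfl⟩)
  have := hmax (insert (Pi.single i 1) S) (by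
    simp only [F, Finset.mem_filter, Finset.mem_powerset]
    refine ⟨Finset.insert_subset ?_ hS.1, fun j => Finset.mem_insert_of_mem (hS.2.1 j), ?_⟩
    · rw [mem_vbox]
      intro j
      by_cases hij : j = i
      · subst hij; simp; exact_mod_cast hH
      · simp [Pi.single_eq_of_ne hij]
    · simpa [Set.image_insert_eq] using hcon.2)
  rw [Finset.card_insert_of_notMem hn] at this
  omega

theorem exists_prim (S : Finset (Fin 5 → ℤ)) (hS : Submodule.span ℚ (qc '' S) ≠ ⊤) :
    ∃ v y : Fin 5 → ℤ, y ⬝ᵥ v = 1 ∧ ∀ s ∈ S, s ⬝ᵥ v = 0 := by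
  obtain ⟨f, hf0, hf⟩ := Submodule.exists_le_ker_of_lt_top _ (lt_top_iff_ne_top.mpr hS)
  let g : Fin 5 → ℚ := fun i => f (Pi.single i 1)
  have hg : ∀ x, f x = ∑ i, x i * g i := by
    intro x
    conv_lhs => rw [pi_eq_sum_univ' x]
    simp only [map_sum, map_smul, g, smul_eq_mul]
  obtain ⟨b, hb⟩ := IsLocalization.exist_integer_multiples_of_finite (nonZeroDivisors ℤ) g
  choose u hu using hb
  have hb0 : ((b : ℤ) : ℚ) ≠ 0 := by
    have := nonZeroDivisors.ne_zero b.2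
    exact_mod_cast this
  have hu' : ∀ i, (u i : ℚ) = (b : ℤ) * g i := by
    intro i; have := hu i; simpa [Algebra.smul_def] using this
  obtain ⟨d, hd⟩ := (IsPrincipalIdealRing.principal (Ideal.span (Set.range u))).principal
  have hdm : d ∈ Ideal.span (Set.range u) := by rw [hd]; exact Submodule.mem_span_singleton_self d
  obtain ⟨y, hy⟩ := Ideal.mem_span_range_iff_exists_fun.mp hdm
  have hdv : ∀ i, ∃ w, u i = d * w := by
    intro i
    have : u i ∈ Ideal.span (Set.range u) := Ideal.subset_span ⟨i, rfl⟩
    rw [hd] at this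
    exact Ideal.mem_span_singleton.mp this
  choose v hv using hdv
  have hd0 : d ≠ 0 := by
    rintro rfl
    apply hf0
    ext i
    have := hu' i
    rw [hv i] at this
    simp [hb0] at this
    simpa [g] using this
  refine ⟨v, y, ?_, ?_⟩
  · apply mul_left_cancel₀ hd0
    rw [mul_one, dotProduct, Finset.mul_sum]
    conv_rhs => rw [← hy]
    refine Finset.sum_congr rfl fun i _ => ?_
    rw [hv i]; ring
  · intro s hs
    have h1 : f (qc s) = 0 := hf (Submodule.subset_span ⟨s, hs, rfl⟩)
    rw [hg] at h1
    have h2 : ((d * (s ⬝ᵥ v) : ℤ) : ℚ) = 0 := by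
      have : d * (s ⬝ᵥ v) = ∑ i, s i * u i := by
        rw [dotProduct, Finset.mul_sum]
        refine Finset.sum_congr rfl fun i _ => ?_
        rw [hv i]; ring
      rw [this]
      push_cast
      simp only [hu']
      rw [← mul_zero ((b : ℤ) : ℚ), ← h1, Finset.mul_sum]
      refine Finset.sum_congr rfl fun i _ => ?_
      simp only [qc]; ring
    have h3 : d * (s ⬝ᵥ v) = 0 := by exact_mod_cast h2
    exact (mul_eq_zero.mp h3).resolve_left hd0

/-- every value is attained by a small vector -/
theorem small_rep (H : ℕ) (S : Finset (Fin 5 → ℤ)) (hSH : S ⊆ vbox H)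
    (v y : Fin 5 → ℤ) (hv : ∀ s ∈ S, s ⬝ᵥ v = 0) (j : Fin 5) (hj : v j ≠ 0)
    (htop : Submodule.span ℚ (insert (qc (Pi.single j 1)) (qc '' S)) = ⊤)
    (hy : |y ⬝ᵥ v| ≤ |v j| * H) :
    ∃ z, z ∈ vbox (6 * H) ∧ z ⬝ᵥ v = y ⬝ᵥ v := by
  classical
  obtain ⟨κ, a, ha, hspan, hli⟩ := exists_linearIndependent' ℚ (fun s : S => qc s)
  have : Finite κ := hli.finite
  have : Fintype κ := Fintype.ofFinite κ
  have hcard : Fintype.card κ ≤ 5 := by simpa using hli.fintype_card_le_finrank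
  have hr : Set.range (fun s : S => qc s) = qc '' S := by
    ext x; simp
  have hmem : qc y ∈ Submodule.span ℚ (insert (qc (Pi.single j 1)) (qc '' S)) := by
    rw [htop]; trivial
  rw [Submodule.mem_span_insert, ← hr, ← hspan] at hmem
  obtain ⟨t, p, hp, hyp⟩ := hmem
  obtain ⟨c, hc⟩ := (Submodule.mem_span_range_iff_exists_fun _).mp hp
  have hco : ∀ i, (y i : ℚ) = t * (Pi.single j 1 : Fin 5 → ℤ) i + ∑ k, c k * ((a k : Fin 5 → ℤ) i) := by
    intro i
    have := congrFun hyp i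
    rw [← hc] at this
    simpa [qc] using this
  have hvk : ∀ k, ∑ i, ((a k : Fin 5 → ℤ) i : ℚ) * v i = 0 := by
    intro k
    have := hv _ (a k).2
    rw [dotProduct] at this
    exact_mod_cast this
  have ht : ((y ⬝ᵥ v : ℤ) : ℚ) = t * v j := by
    rw [dotProduct]
    push_cast
    simp only [hco, add_mul, Finset.sum_add_distrib, Finset.sum_mul]
    rw [Finset.sum_comm]
    have : ∀ k, ∑ i, c k * ((a k : Fin 5 → ℤ) i : ℚ) * v i = 0 := by
      intro k
      simp only [mul_assoc]
      rw [← Finset.mul_sum, hvk, mul_zero]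
    simp only [this, Finset.sum_const_zero, add_zero]
    simp [Pi.single_apply]
  have htH : |t| ≤ H := by
    have h1 : ((|y ⬝ᵥ v| : ℤ) : ℚ) ≤ ((|v j| * H : ℤ) : ℚ) := by exact_mod_cast hy
    rw [Int.cast_abs, ht, abs_mul] at h1
    push_cast at h1
    have h2 : (0 : ℚ) < |(v j : ℚ)| := by positivity
    rw [mul_comm] at h1
    exact le_of_mul_le_mul_left h1 h2
  refine ⟨y - ∑ k, ⌊c k⌋ • (a k : Fin 5 → ℤ), ?_, ?_⟩
  · rw [mem_vbox]
    intro i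
    have h1 : (((y - ∑ k, ⌊c k⌋ • (a k : Fin 5 → ℤ)) i : ℤ) : ℚ)
        = t * (Pi.single j 1 : Fin 5 → ℤ) i + ∑ k, Int.fract (c k) * ((a k : Fin 5 → ℤ) i) := by
      simp only [Pi.sub_apply, Finset.sum_apply, Pi.smul_apply, smul_eq_mul]
      push_cast
      rw [hco, add_sub_assoc, ← Finset.sum_sub_distrib]
      congr 1
      refine Finset.sum_congr rfl fun k _ => ?_
      rw [Int.fract]; ring
    have h2 : |∑ k, Int.fract (c k) * ((a k : Fin 5 → ℤ) i : ℚ)| ≤ 5 * H := by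
      refine (Finset.abs_sum_le_sum_abs _ _).trans ?_
      have : ∀ k ∈ Finset.univ, |Int.fract (c k) * ((a k : Fin 5 → ℤ) i : ℚ)| ≤ (H : ℚ) := by
        intro k _
        rw [abs_mul, abs_of_nonneg (Int.fract_nonneg _)]
        have h3 : |((a k : Fin 5 → ℤ) i : ℚ)| ≤ H := by
          have := mem_vbox.mp (hSH (a k).2) i
          exact_mod_cast this
        have h4 := (Int.fract_lt_one (c k)).le
        calc _ ≤ 1 * |((a k : Fin 5 → ℤ) i : ℚ)| := by gcongr
          _ ≤ H := by rw [one_mul]; exact h3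
      refine (Finset.sum_le_card_nsmul _ _ _ this).trans ?_
      rw [nsmul_eq_mul, Finset.card_univ]
      gcongr
      exact_mod_cast hcard
    have h3 : |t * (Pi.single j 1 : Fin 5 → ℤ) i| ≤ (H : ℚ) := by
      by_cases hij : i = j
      · subst hij; simpa using htH
      · simp [Pi.single_eq_of_ne hij]
    have h4 : |(((y - ∑ k, ⌊c k⌋ • (a k : Fin 5 → ℤ)) i : ℤ) : ℚ)| ≤ 6 * H := by
      rw [h1]
      refine (abs_add_le _ _).trans ?_
      linarith
    exact_mod_cast h4
  · rw [sub_dotProduct, sum_dotProduct]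
    simp only [smul_dotProduct]
    rw [Finset.sum_eq_zero, sub_zero]
    intro k _
    rw [hv _ (a k).2, smul_zero]

/-- box vectors orthogonal to `v` -/
noncomputable def orth (H : ℕ) (v : Fin 5 → ℤ) : Finset (Fin 5 → ℤ) := (vbox H).filter fun x => x ⬝ᵥ v = 0

theorem singular_kernel (H : ℕ) (hH : 1 ≤ H) (A : Matrix (Fin 5) (Fin 5) ℤ)
    (hA : ∀ i j, |A i j| ≤ (H : ℤ)) (hdet : A.det = 0) :
    ∃ (v : Fin 5 → ℤ) (K : ℕ), (∀ i, A i ∈ orth H v) ∧ 1 ≤ K ∧ v ∈ vbox K ∧ v ∉ vbox (K - 1) ∧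
      K * (orth H v).card ≤ 15 ^ 5 * H ^ 4 := by
  classical
  obtain ⟨S, hSH, hAS, hne, hor⟩ := exists_hyper H hH A hA hdet
  obtain ⟨v, y, hy, hv⟩ := exists_prim S hne
  obtain ⟨j, -, hj⟩ := Finset.exists_max_image Finset.univ (fun i => |v i|) ⟨0, Finset.mem_univ _⟩
  have hvj : v j ≠ 0 := by
    intro h0
    have : v = 0 := by
      ext i
      have := hj i (Finset.mem_univ _)
      rw [h0, abs_zero] at this
      simpa using this
    rw [this] at hy; simp at hy
  have htop : Submodule.span ℚ (insert (qc (Pi.single j 1)) (qc '' S)) = ⊤ := by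
    refine (hor j).resolve_left fun hm => ?_
    let L : (Fin 5 → ℚ) →ₗ[ℚ] ℚ := dotL (qc v)
    have hle : Submodule.span ℚ (qc '' S) ≤ LinearMap.ker L := by
      rw [Submodule.span_le]
      rintro _ ⟨x, hx, rfl⟩
      have := hv x hx
      have h2 : ∑ i, (x i : ℚ) * v i = 0 := by
        rw [dotProduct] at this
        exact_mod_cast this
      simpa [L, qc, dotProduct] using h2
    have := hle hm
    have h2 : qc (Pi.single j 1) = Pi.single j 1 := by
      ext i; by_cases hij : i = j
      · subst hij; simp [qc]
      · simp [qc, Pi.single_eq_of_ne hij]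
    rw [h2] at this
    simp [L, qc] at this
    exact hvj this
  have hK : ((v j).natAbs : ℤ) = |v j| := Int.natCast_natAbs _
  have hK1 : 1 ≤ (v j).natAbs := Int.natAbs_pos.mpr hvj
  refine ⟨v, (v j).natAbs, ?_, hK1, ?_, ?_, ?_⟩
  · intro i
    exact Finset.mem_filter.mpr ⟨hSH (hAS i), hv _ (hAS i)⟩
  · rw [mem_vbox]; intro i; rw [hK]; exact hj i (Finset.mem_univ _)
  · rw [mem_vbox]; intro h
    have := h j
    rw [← hK] at this
    omega
  · have hrep : ∀ c : ℕ, c < (v j).natAbs * H → ∃ z, z ∈ vbox (6 * H) ∧ z ⬝ᵥ v = c := by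
      intro c hc
      have hc' : ((c : ℤ) • y) ⬝ᵥ v = c := by rw [smul_dotProduct, hy]; simp
      obtain ⟨z, hz, hz2⟩ := small_rep H S hSH v ((c : ℤ) • y) hv j hvj htop (by
        rw [hc', ← hK]
        rw [abs_of_nonneg (by positivity)]
        exact_mod_cast hc.le)
      exact ⟨z, hz, hz2.trans hc'⟩
    choose! z hz hzc using hrep
    have hcard : (Finset.range ((v j).natAbs * H) ×ˢ orth H v).card ≤ (vbox (7 * H)).card := by
      refine Finset.card_le_card_of_injOn (fun p => z p.1 + p.2) ?_ ?_
      · rintro ⟨c, x⟩ hp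
        simp only [Finset.coe_product, Set.mem_prod, Finset.mem_coe, Finset.mem_range, orth,
          Finset.mem_filter] at hp
        obtain ⟨hc, hx, -⟩ := hp
        have h1 := mem_vbox.mp (hz c hc)
        have h2 := mem_vbox.mp hx
        rw [Finset.mem_coe, mem_vbox]
        intro i
        refine (abs_add_le _ _).trans ?_
        have := h1 i
        have := h2 i
        push_cast at *
        linarith
      · rintro ⟨c, x⟩ hp ⟨c', x'⟩ hp' heq
        simp only [Finset.coe_product, Set.mem_prod, Finset.mem_coe, Finset.mem_range, orth,
          Finset.mem_filter] at hp hp'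
        simp only at heq
        have h1 := congrArg (fun u => u ⬝ᵥ v) heq
        simp only [add_dotProduct, hzc c hp.1, hzc c' hp'.1, hp.2.2, hp'.2.2, add_zero] at h1
        have h2 : c = c' := by exact_mod_cast h1
        subst h2
        simpa using heq
    rw [Finset.card_product, Finset.card_range, card_vbox] at hcard
    have h5 : (2 * (7 * H) + 1) ^ 5 ≤ (15 * H) ^ 5 := by gcongr; omega
    have h6 : H * ((v j).natAbs * (orth H v).card) ≤ H * (15 ^ 5 * H ^ 4) := by
      calc _ = (v j).natAbs * H * (orth H v).card := by ring
        _ ≤ (15 * H) ^ 5 := hcard.trans h5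
        _ = _ := by ring
    exact Nat.le_of_mul_le_mul_left h6 hH

theorem shell_card (K : ℕ) (hK : 1 ≤ K) :
    ((vbox K \ vbox (K - 1)).card : ℝ) ≤ 810 * (K : ℝ) ^ 4 := by
  have hsub : vbox (K - 1) ⊆ vbox K := by
    intro x hx
    rw [mem_vbox] at *
    intro i
    have := hx i
    omega
  have h := Finset.card_sdiff_add_card_eq_card hsub
  rw [card_vbox, card_vbox] at h
  obtain ⟨k, rfl⟩ : ∃ k, K = k + 1 := ⟨K - 1, by omega⟩
  have h2 : (((vbox (k + 1) \ vbox (k + 1 - 1)).card : ℝ)) + (2 * k + 1) ^ 5 = (2 * (k + 1) + 1) ^ 5 := by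
    exact_mod_cast h
  simp only [Nat.add_sub_cancel] at h2
  have hk : (0 : ℝ) ≤ k := by positivity
  push_cast
  have : (810 * ((k : ℝ) + 1) ^ 4) - ((2 * (k + 1) + 1) ^ 5 - (2 * k + 1) ^ 5) ≥ 0 := by
    ring_nf
    positivity
  linarith

theorem sing_count (H : ℕ) (hH : 1 ≤ H) (T : ℕ) (hT : T = 15 ^ 5 * H ^ 4) :
    ∃ F : Finset (Matrix (Fin 5) (Fin 5) ℤ),
      (∀ A : Matrix (Fin 5) (Fin 5) ℤ, (∀ i j, |A i j| ≤ (H : ℤ)) → A.det = 0 → A ∈ F) ∧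
      (F.card : ℝ) ≤ 810 * (T : ℝ) ^ 5 * (1 + Real.log T) := by
  classical
  let G : ℕ → Finset (Fin 5 → ℤ) := fun K =>
    (vbox K \ vbox (K - 1)).filter fun v => K * (orth H v).card ≤ T
  let P : (Fin 5 → ℤ) → Finset (Matrix (Fin 5) (Fin 5) ℤ) := fun v =>
    Fintype.piFinset fun _ : Fin 5 => orth H v
  refine ⟨(Finset.Icc 1 T).biUnion fun K => (G K).biUnion P, ?_, ?_⟩
  · intro A hA hdet
    obtain ⟨v, K, h1, h2, h3, h4, h5⟩ := singular_kernel H hH A hA hdet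
    rw [← hT] at h5
    have hpos : 1 ≤ (orth H v).card := Finset.card_pos.mpr ⟨_, h1 0⟩
    simp only [Finset.mem_biUnion, Finset.mem_Icc]
    refine ⟨K, ⟨h2, by nlinarith⟩, v, ?_, ?_⟩
    · simp only [G, Finset.mem_filter, Finset.mem_sdiff]
      exact ⟨⟨h3, h4⟩, h5⟩
    · exact Fintype.mem_piFinset.mpr h1
  · have hP : ∀ K, 1 ≤ K → ∀ v ∈ G K, ((P v).card : ℝ) ≤ ((T : ℝ) / K) ^ 5 := by
      intro K hK v hv
      have h1 := (Finset.mem_filter.mp hv).2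
      have hc : (P v).card = (orth H v).card ^ 5 := by
        simp only [P]
        erw [Fintype.card_piFinset]
        simp
      rw [hc]
      push_cast
      have hK' : (0 : ℝ) < K := by exact_mod_cast hK
      gcongr
      rw [le_div_iff₀ hK', mul_comm]
      exact_mod_cast h1
    have hK : ∀ K ∈ Finset.Icc 1 T, (((G K).biUnion P).card : ℝ) ≤ 810 * (T : ℝ) ^ 5 * (K : ℝ)⁻¹ := by
      intro K hK
      have hK1 := (Finset.mem_Icc.mp hK).1
      have hK' : (0 : ℝ) < K := by exact_mod_cast hK1
      calc (((G K).biUnion P).card : ℝ) ≤ ∑ v ∈ G K, ((P v).card : ℝ) := by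
            exact_mod_cast Finset.card_biUnion_le
        _ ≤ (G K).card • ((T : ℝ) / K) ^ 5 := Finset.sum_le_card_nsmul _ _ _ (hP K hK1)
        _ = ((G K).card : ℝ) * ((T : ℝ) / K) ^ 5 := by rw [nsmul_eq_mul]
        _ ≤ (810 * (K : ℝ) ^ 4) * ((T : ℝ) / K) ^ 5 := by
            gcongr
            refine le_trans ?_ (shell_card K hK1)
            exact_mod_cast Finset.card_filter_le _ _
        _ = _ := by field_simp
    calc _ ≤ ∑ K ∈ Finset.Icc 1 T, (((G K).biUnion P).card : ℝ) := by
          exact_mod_cast Finset.card_biUnion_le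
      _ ≤ ∑ K ∈ Finset.Icc 1 T, 810 * (T : ℝ) ^ 5 * (K : ℝ)⁻¹ := Finset.sum_le_sum hK
      _ = 810 * (T : ℝ) ^ 5 * (harmonic T : ℝ) := by
          rw [← Finset.mul_sum, harmonic_eq_sum_Icc]; push_cast; rfl
      _ ≤ _ := by
          gcongr
          exact harmonic_le_one_add_log T

/-- Theorem 1.2, case `n = 5`: `R_5(H) ≪ H^21 log H`. -/
theorem repeated_eigenvalue_count_five :
    ∃ C : ℝ, 0 < C ∧ ∀ H : ℕ, 2 ≤ H →
      (Set.ncard {A : Matrix (Fin 5) (Fin 5) ℤ | (∀ i j, |A i j| ≤ (H : ℤ)) ∧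
        ¬ Squarefree (Polynomial.map (Int.castRingHom ℂ) A.charpoly)} : ℝ) ≤
      C * (H : ℝ) ^ (21 : ℕ) * Real.log H := by
  classical
  refine ⟨11 * 810 * 36 * (984150000 : ℝ) ^ 5, by positivity, fun H hH => ?_⟩
  obtain ⟨F, hF, hFc⟩ := sing_count (6 * H) (by omega) (984150000 * H ^ 4) (by ring)
  let E : Finset (Matrix (Fin 5) (Fin 5) ℤ) :=
    (Finset.Icc (-(5 * H : ℤ)) (5 * H)).biUnion fun l => F.image fun B => B + scalar (Fin 5) l
  have hsub : {A : Matrix (Fin 5) (Fin 5) ℤ | (∀ i j, |A i j| ≤ (H : ℤ)) ∧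
        ¬ Squarefree (Polynomial.map (Int.castRingHom ℂ) A.charpoly)} ⊆ (E : Set _) := by
    rintro A ⟨hA, hns⟩
    obtain ⟨l, hl⟩ := int_root A.charpoly A.charpoly_monic (by simp [charpoly_natDegree_eq_dim]) hns
    have hdet : (A - scalar (Fin 5) l).det = 0 := by
      rw [IsRoot.def, eval_charpoly] at hl
      rw [← neg_sub, det_neg, hl, mul_zero]
    have hlb := eig_bound A H hA l hdet
    simp only [E, Finset.coe_biUnion, Set.mem_iUnion, Finset.mem_coe, Finset.mem_image]
    refine ⟨l, by rw [Finset.mem_Icc]; exact abs_le.mp hlb, A - scalar (Fin 5) l, ?_, by simp⟩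
    refine hF _ ?_ hdet
    intro i j
    rw [Matrix.sub_apply]
    have h1 : |scalar (Fin 5) l i j| ≤ 5 * H := by
      rw [scalar_apply]
      by_cases hij : i = j
      · subst hij; rw [diagonal_apply_eq]; exact hlb
      · rw [diagonal_apply_ne _ hij, abs_zero]; positivity
    have h2 := abs_sub (A i j) (scalar (Fin 5) l i j)
    have h3 := hA i j
    push_cast
    linarith
  have hE : (E.card : ℝ) ≤ (10 * H + 1) * F.card := by
    have h1 : E.card ≤ (10 * H + 1) * F.card := by
      refine (Finset.card_biUnion_le_card_mul _ _ F.card fun l _ => Finset.card_image_le).trans ?_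
      gcongr
      rw [Int.card_Icc]; omega
    exact_mod_cast h1
  have hnc : (Set.ncard {A : Matrix (Fin 5) (Fin 5) ℤ | (∀ i j, |A i j| ≤ (H : ℤ)) ∧
        ¬ Squarefree (Polynomial.map (Int.castRingHom ℂ) A.charpoly)} : ℝ) ≤ E.card := by
    have := Set.ncard_le_ncard hsub (Finset.finite_toSet E)
    rw [Set.ncard_coe_finset] at this
    exact_mod_cast this
  have hH' : (2 : ℝ) ≤ H := by exact_mod_cast hH
  have hl2 : Real.log 2 ≤ Real.log H := Real.log_le_log (by norm_num) hH'
  have hl20 := Real.log_two_gt_d9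
  have hlog : 1 + Real.log ((984150000 * H ^ 4 : ℕ) : ℝ) ≤ 36 * Real.log H := by
    push_cast
    rw [Real.log_mul (by norm_num) (by positivity), Real.log_pow]
    have : Real.log 984150000 ≤ 30 * Real.log 2 := by
      have h := Real.log_le_log (x := (984150000 : ℝ)) (y := 2 ^ 30) (by norm_num) (by norm_num)
      rw [Real.log_pow] at h
      exact_mod_cast h
    push_cast
    linarith
  calc _ ≤ (E.card : ℝ) := hnc
    _ ≤ (10 * H + 1) * F.card := hE
    _ ≤ (11 * H) * (810 * ((984150000 * H ^ 4 : ℕ) : ℝ) ^ 5 * (36 * Real.log H)) := by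
        have hlog0 : 0 ≤ Real.log H := by linarith
        apply mul_le_mul (by linarith) _ (by positivity) (by positivity)
        refine hFc.trans ?_
        gcongr
    _ = _ := by push_cast; ring
end

section
/- There exists a constant C > 0 such that for all integers H ≥ 2, the number R_7(H) of 7×7 matrices in M_7(ℤ;H) whose characteristic polynomial has a repeated complex root satisfies R_7(H) ≤ C · H^(49 − 4) · log H = C · H^45 · log H. -/
open Matrix Polynomial

/-- Box of integer vectors. -/
noncomputable def bx (K : ℤ) : Finset (Fin 7 → ℤ) := Fintype.piFinset fun _ => Finset.Icc (-K) K

/-- Box of integer matrices. -/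
noncomputable def mbx (K : ℤ) : Finset (Matrix (Fin 7) (Fin 7) ℤ) := Fintype.piFinset fun _ => bx K

lemma mem_bx {K : ℤ} {x : Fin 7 → ℤ} : x ∈ bx K ↔ ∀ i, |x i| ≤ K := by
  simp [bx, Fintype.mem_piFinset, abs_le]

lemma mem_mbx {K : ℤ} {A : Matrix (Fin 7) (Fin 7) ℤ} : A ∈ mbx K ↔ ∀ i j, |A i j| ≤ K := by
  exact (Fintype.mem_piFinset (t := fun _ => bx K) (f := A)).trans (forall_congr' fun i => mem_bx)

lemma perturb_indep {k V ι : Type*} [Field k] [AddCommGroup V] [Module k V] [DecidableEq ι]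
    (d D : ι → V) (J : Finset ι) (hd : LinearIndepOn k d (J : Set ι)) :
    ∃ T ⊆ J, LinearIndepOn k (fun i => D i + if i ∈ T then d i else 0) (J : Set ι) := by
  have key : ∀ S : Finset ι, S ⊆ J → ∃ T ⊆ S, LinearIndepOn k
      (fun i => if i ∈ S then D i + (if i ∈ T then d i else 0) else d i) (J : Set ι) := by
    intro S
    induction S using Finset.induction_on with
    | empty => intro _; exact ⟨∅, by simp, by simpa using hd⟩
    | insert a S ha ih =>
      intro hS
      obtain ⟨T, hT, hli⟩ := ih (fun x hx => hS (Finset.mem_insert_of_mem hx))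
      have haJ : a ∈ J := hS (Finset.mem_insert_self _ _)
      have haT : a ∉ T := fun h => ha (hT h)
      have hJ : (J : Set ι) = insert a ((J : Set ι) \ {a}) := by
        rw [Set.insert_sdiff_singleton, Set.insert_eq_of_mem (by exact_mod_cast haJ)]
      rw [hJ, linearIndepOn_insert (by simp)] at hli
      obtain ⟨h1, h2⟩ := hli
      simp only [ha, if_false] at h2
      have fin : ∀ T' ⊆ insert a S, (∀ i, i ≠ a → (i ∈ T' ↔ i ∈ T)) →
          (D a + (if a ∈ T' then d a else 0)) ∉ Submodule.span k
            ((fun i => if i ∈ S then D i + (if i ∈ T then d i else 0) else d i) '' ((J : Set ι) \ {a})) →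
          ∃ T ⊆ insert a S, LinearIndepOn k
            (fun i => if i ∈ insert a S then D i + (if i ∈ T then d i else 0) else d i) (J : Set ι) := by
        intro T' hT' hiff hn
        refine ⟨T', hT', ?_⟩
        have heq : Set.EqOn (fun i => if i ∈ S then D i + (if i ∈ T then d i else 0) else d i)
            (fun i => if i ∈ insert a S then D i + (if i ∈ T' then d i else 0) else d i)
            ((J : Set ι) \ {a}) := by
          intro i hi
          have hia : i ≠ a := by simpa using hi.2
          simp only [Finset.mem_insert, hia, false_or, hiff i hia]
        rw [hJ, linearIndepOn_insert (by simp)]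
        refine ⟨h1.congr heq, ?_⟩
        rw [← heq.image_eq]
        simpa using hn
      by_cases hDa : D a ∈ Submodule.span k
            ((fun i => if i ∈ S then D i + (if i ∈ T then d i else 0) else d i) '' ((J : Set ι) \ {a}))
      · refine fin (insert a T) (Finset.insert_subset_insert _ hT) ?_ ?_
        · intro i hi; simp [hi]
        · simp only [Finset.mem_insert, true_or, if_true]
          intro h
          exact h2 (by simpa using Submodule.sub_mem _ h hDa)
      · refine fin T (fun x hx => Finset.mem_insert_of_mem (hT hx)) (fun i _ => Iff.rfl) ?_
        simpa [haT] using hDa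
  obtain ⟨T, hT, h⟩ := key J subset_rfl
  refine ⟨T, hT, h.congr ?_⟩
  intro i hi
  have : i ∈ J := by exact_mod_cast hi
  simp [this]

/-- cast of an integer vector -/
noncomputable def cv (x : Fin 7 → ℤ) : Fin 7 → ℂ := fun k => (x k : ℂ)

lemma cv_add (x y) : cv (x + y) = cv x + cv y := by ext; simp [cv]
lemma cv_sub (x y) : cv (x - y) = cv x - cv y := by ext; simp [cv]
lemma cv_zero : cv 0 = 0 := by ext; simp [cv]

/-- rows of `A - α` -/
noncomputable def yv (α : ℂ) (a : Fin 7 → ℤ) (i : Fin 7) : Fin 7 → ℂ := cv a - Pi.single i α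

/-- short integer vectors in a subspace -/
def XF (H : ℤ) (F : Submodule ℂ (Fin 7 → ℂ)) : Set (Fin 7 → ℤ) := {x | x ∈ bx (2 * H) ∧ cv x ∈ F}

def PF (H : ℤ) (F : Submodule ℂ (Fin 7 → ℂ)) (I : Finset (Fin 7)) (d : Fin 7 → Fin 7 → ℤ) : Prop :=
  ∃ J : Finset (Fin 7), Disjoint J I ∧ (∀ i, d i ∈ XF H F) ∧
    LinearIndepOn ℂ (fun i => cv (d i)) (J : Set (Fin 7)) ∧
    Submodule.span ℂ (cv '' XF H F) ≤ Submodule.span ℂ ((fun i => cv (d i)) '' (J : Set (Fin 7))) ∧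
    J.card + I.card < 7

lemma exists_pick (H : ℤ) (hH : 0 ≤ H) (y : Fin 7 → Fin 7 → ℂ) (F : Submodule ℂ (Fin 7 → ℂ))
    (hF : F = Submodule.span ℂ (Set.range y)) (hdim : Module.finrank ℂ F ≤ 6) :
    ∃ I : Finset (Fin 7), (∃ d, PF H F I d) ∧
      F ≤ Submodule.span ℂ (y '' (I : Set (Fin 7))) ⊔ Submodule.span ℂ (cv '' XF H F) := by
  classical
  obtain ⟨b, hbX, -, hXb, hb⟩ := exists_linearIndepOn_extension (K := ℂ) (v := cv)
    (linearIndepOn_empty ℂ cv) (Set.empty_subset (XF H F))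
  have hbfin : b.Finite := ((bx (2 * H)).finite_toSet).subset (fun x hx => (hbX hx).1)
  set v : (Fin 7 → ℤ) ⊕ Fin 7 → (Fin 7 → ℂ) := Sum.elim cv y with hv
  have hs : LinearIndepOn ℂ v (Sum.inl '' b) := by
    rw [linearIndepOn_iff_image (by
      rintro _ ⟨x, hx, rfl⟩ _ ⟨z, hz, rfl⟩ h
      exact congrArg _ (hb.injOn hx hz h))]
    rw [Set.image_image]
    have := (linearIndepOn_iff_image hb.injOn).1 hb
    simpa [hv] using this
  obtain ⟨b1, hb1t, hsb1, htb1, hb1⟩ := exists_linearIndepOn_extension (K := ℂ) (v := v)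
    hs (Set.subset_union_left (t := Set.range Sum.inr))
  set I : Finset (Fin 7) := Finset.univ.filter (fun i => Sum.inr i ∈ b1) with hI
  set b0 : Finset (Fin 7 → ℤ) := hbfin.toFinset with hb0
  have hb1eq : b1 = ((b0.disjSum I : Finset _) : Set ((Fin 7 → ℤ) ⊕ Fin 7)) := by
    ext z
    rcases z with x | i
    · rw [Finset.mem_coe, Finset.inl_mem_disjSum, hbfin.mem_toFinset]
      constructor
      · intro h
        rcases hb1t h with ⟨x', hx', h'⟩ | ⟨i, hi⟩
        · cases h'; exact hx'
        · cases hi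
      · intro h
        exact hsb1 ⟨x, h, rfl⟩
    · simp [hI]
  have hcard : b0.card + I.card ≤ 6 := by
    rw [← Finset.card_disjSum]
    rw [hb1eq] at hb1
    have h1 := finrank_span_eq_card (R := ℂ) (b := fun z : (b0.disjSum I : Finset _) => v z) hb1
    rw [Fintype.card_coe] at h1
    rw [← h1]
    refine le_trans (Submodule.finrank_mono ?_) hdim
    rw [Submodule.span_le]
    rintro _ ⟨⟨z, hz⟩, rfl⟩
    rcases z with x | i
    · have : x ∈ b := by simpa [hb0] using hz
      exact (hbX this).2
    · rw [hF]; exact Submodule.subset_span ⟨i, rfl⟩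
  obtain ⟨J, hJ, hJc⟩ := Finset.exists_subset_card_eq (s := Iᶜ) (n := b0.card) (by
    rw [Finset.card_compl, Fintype.card_fin]; omega)
  have e : J ≃ b0 := Finset.equivOfCardEq hJc
  set d : Fin 7 → Fin 7 → ℤ := fun i => if h : i ∈ J then (e ⟨i, h⟩ : Fin 7 → ℤ) else 0 with hd
  have hdJ : ∀ i (h : i ∈ J), d i = e ⟨i, h⟩ := fun i h => by simp [hd, h]
  have himg : (fun i => cv (d i)) '' (J : Set (Fin 7)) = cv '' b := by
    ext z; constructor
    · rintro ⟨i, hi, rfl⟩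
      have hi' : i ∈ J := by exact_mod_cast hi
      refine ⟨d i, ?_, rfl⟩
      rw [hdJ i hi']
      exact hbfin.mem_toFinset.1 (e ⟨i, hi'⟩).2
    · rintro ⟨x, hx, rfl⟩
      have hx' : x ∈ b0 := by simpa [hb0] using hx
      refine ⟨(e.symm ⟨x, hx'⟩ : Fin 7), (e.symm ⟨x, hx'⟩).2, ?_⟩
      simp only
      rw [hdJ _ (e.symm ⟨x, hx'⟩).2]
      simp
  refine ⟨I, ⟨d, J, ?_, ?_, ?_, ?_, ?_⟩, ?_⟩
  · rw [Finset.disjoint_left]; intro i hi; simpa using hJ hi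
  · intro i
    by_cases h : i ∈ J
    · rw [hdJ i h]
      apply hbX
      exact hbfin.mem_toFinset.1 (e ⟨i, h⟩).2
    · simp only [hd, h, dif_neg, not_false_eq_true]
      refine ⟨mem_bx.2 (by intro i; simp; omega), ?_⟩
      rw [cv_zero]; exact F.zero_mem
  · have hinj : Set.InjOn (fun i => cv (d i)) (J : Set (Fin 7)) := by
      intro i hi j hj h
      have hi' : i ∈ J := by exact_mod_cast hi
      have hj' : j ∈ J := by exact_mod_cast hj
      have h2 : d i = d j := by
        ext k
        have := congrFun h k
        simpa [cv] using this
      rw [hdJ i hi', hdJ j hj'] at h2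
      have := e.injective (Subtype.ext h2)
      simpa using this
    rw [linearIndepOn_iff_image hinj, himg]
    exact (linearIndepOn_iff_image hb.injOn).1 hb
  · rw [himg, Submodule.span_le]; exact hXb
  · omega
  · rw [hF, Submodule.span_le]
    rintro _ ⟨i, rfl⟩
    have h1 : y i ∈ Submodule.span ℂ (v '' b1) := htb1 ⟨Sum.inr i, Or.inr ⟨i, rfl⟩, rfl⟩
    rw [← hF]
    refine (Submodule.span_le.2 ?_) h1
    rintro _ ⟨z, hz, rfl⟩
    rcases z with x | j
    · have hx : x ∈ b := by rw [hb1eq] at hz; simpa [hb0] using hz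
      exact Submodule.mem_sup_right (Submodule.subset_span ⟨x, hbX hx, rfl⟩)
    · exact Submodule.mem_sup_left (Submodule.subset_span ⟨j, by simpa [hI] using hz, rfl⟩)

open Classical in
/-- chosen base point of the affine row set -/
noncomputable def sF (H : ℤ) (α : ℂ) (F : Submodule ℂ (Fin 7 → ℂ)) (i : Fin 7) : Fin 7 → ℤ :=
  Classical.epsilon fun s => s ∈ bx H ∧ yv α s i ∈ F

noncomputable def dF (H : ℤ) (F : Submodule ℂ (Fin 7 → ℂ)) (I : Finset (Fin 7)) :
    Fin 7 → Fin 7 → ℤ :=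
  Classical.epsilon fun d => PF H F I d

noncomputable def GF (α : ℂ) (I : Finset (Fin 7)) (B : Matrix (Fin 7) (Fin 7) ℤ) :
    Submodule ℂ (Fin 7 → ℂ) :=
  Submodule.span ℂ ((fun i => yv α (B i) i) '' (I : Set (Fin 7))) ⊔
    Submodule.span ℂ ((fun i => cv (B i)) '' ((I : Set (Fin 7))ᶜ))

lemma exists_code (H : ℤ) (hH : 0 ≤ H) (α : ℂ) (A : Matrix (Fin 7) (Fin 7) ℤ) (hA : A ∈ mbx H)
    (F : Submodule ℂ (Fin 7 → ℂ))
    (hF : F = Submodule.span ℂ (Set.range (fun i => yv α (A i) i)))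
    (hdim : Module.finrank ℂ F ≤ 6) :
    ∃ (I T : Finset (Fin 7)) (B : Matrix (Fin 7) (Fin 7) ℤ), B ∈ mbx (4 * H) ∧ B.det = 0 ∧
      F = GF α I B ∧ (∀ i ∈ I, A i = B i) ∧
      (∀ i ∉ I, A i = B i + sF H α F i - if i ∈ T then dF H F I i else 0) := by
  classical
  obtain ⟨I, hd, hFI⟩ := exists_pick H hH _ F hF hdim
  have hd' : PF H F I (dF H F I) := Classical.epsilon_spec hd
  have hyF : ∀ i, yv α (A i) i ∈ F := fun i => by rw [hF]; exact Submodule.subset_span ⟨i, rfl⟩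
  have hs : ∀ i, sF H α F i ∈ bx H ∧ yv α (sF H α F i) i ∈ F := fun i =>
    Classical.epsilon_spec (p := fun s => s ∈ bx H ∧ yv α s i ∈ F)
      ⟨A i, mem_bx.2 (mem_mbx.1 hA i), hyF i⟩
  set d := dF H F I
  set s := sF H α F
  obtain ⟨J, hJI, hdX, hli, hsp, hcard⟩ := hd'
  have hDX : ∀ i, A i - s i ∈ XF H F := by
    intro i
    constructor
    · rw [mem_bx]
      intro j
      have h1 := mem_mbx.1 hA i j
      have h2 := mem_bx.1 (hs i).1 j
      rw [Pi.sub_apply, abs_le]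
      rw [abs_le] at h1 h2
      constructor <;> linarith [h1.1, h1.2, h2.1, h2.2]
    · have : cv (A i - s i) = yv α (A i) i - yv α (s i) i := by
        rw [cv_sub]; unfold yv; abel
      rw [this]
      exact F.sub_mem (hyF i) (hs i).2
  set V := Submodule.span ℂ (cv '' XF H F) with hV
  obtain ⟨T, hTJ, hT⟩ := perturb_indep (k := ℂ) (fun i => cv (d i)) (fun i => cv (A i - s i)) J hli
  set B : Matrix (Fin 7) (Fin 7) ℤ := fun i =>
    if i ∈ I then A i else (A i - s i) + if i ∈ T then d i else 0 with hB
  have hBI : ∀ i ∈ I, B i = A i := fun i hi => by simp [hB, hi]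
  have hBI' : ∀ i ∉ I, B i = (A i - s i) + if i ∈ T then d i else 0 := fun i hi => by
    simp [hB, hi]
  have hBcv : ∀ i ∉ I, cv (B i) = cv (A i - s i) + if i ∈ T then cv (d i) else 0 := fun i hi => by
    rw [hBI' i hi, cv_add]; split_ifs <;> simp [cv_zero]
  have hXV : ∀ x ∈ XF H F, cv x ∈ V := fun x hx => Submodule.subset_span ⟨x, hx, rfl⟩
  have hBV : ∀ i ∉ I, cv (B i) ∈ V := fun i hi => by
    rw [hBcv i hi]
    refine V.add_mem (hXV _ (hDX i)) ?_
    split_ifs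
    · exact hXV _ (hdX i)
    · exact V.zero_mem
  have hVF : V ≤ F := by
    rw [hV, Submodule.span_le]; rintro _ ⟨x, hx, rfl⟩; exact hx.2
  have hVdim : Module.finrank ℂ V ≤ J.card := by
    refine (Submodule.finrank_mono hsp).trans ?_
    have := finrank_span_finset_le_card (R := ℂ) (J.image (fun i => cv (d i)))
    rw [Set.finrank, Finset.coe_image] at this
    exact this.trans Finset.card_image_le
  have hJB : Submodule.span ℂ ((fun i => cv (B i)) '' (J : Set (Fin 7))) = V := by
    apply Submodule.eq_of_le_of_finrank_le
    · rw [Submodule.span_le]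
      rintro _ ⟨i, hi, rfl⟩
      exact hBV i (Finset.disjoint_left.1 hJI (by exact_mod_cast hi))
    · refine hVdim.trans ?_
      have hli2 : LinearIndepOn ℂ (fun i => cv (B i)) (J : Set (Fin 7)) := by
        refine hT.congr ?_
        intro i hi
        exact (hBcv i (Finset.disjoint_left.1 hJI (by exact_mod_cast hi))).symm
      have h1 := finrank_span_eq_card (R := ℂ) (b := fun z : J => cv (B z)) hli2
      rw [Fintype.card_coe] at h1
      rw [← h1]
      apply le_of_eq
      rw [Set.image_eq_range]
      rfl
  refine ⟨I, T, B, ?_, ?_, ?_, fun i hi => (hBI i hi).symm, ?_⟩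
  · rw [mem_mbx]
    intro i j
    have h1 := mem_mbx.1 hA i j
    by_cases hi : i ∈ I
    · rw [hBI i hi]; linarith
    · rw [hBI' i hi]
      have h2 := mem_bx.1 (hDX i).1 j
      have h3 := mem_bx.1 (hdX i).1 j
      rw [Pi.add_apply]
      refine (abs_add_le _ _).trans ?_
      split_ifs
      · linarith
      · simp only [Pi.zero_apply, abs_zero]; linarith
  · by_contra hdet
    have hdetC : (B.map (Int.castRingHom ℂ)).det ≠ 0 := by
      have : (B.map (Int.castRingHom ℂ)).det = ((B.det : ℤ) : ℂ) := by
        rw [← RingHom.mapMatrix_apply, ← RingHom.map_det]; rfl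
      rw [this]; exact_mod_cast hdet
    have hrow := Matrix.linearIndependent_rows_of_det_ne_zero hdetC
    have hrow2 : LinearIndependent ℂ (fun i : (Iᶜ : Finset (Fin 7)) =>
        (B.map (Int.castRingHom ℂ)).row i) := hrow.comp _ Subtype.val_injective
    have h1 := finrank_span_eq_card hrow2
    have h2 : Submodule.span ℂ (Set.range (fun i : (Iᶜ : Finset (Fin 7)) =>
        (B.map (Int.castRingHom ℂ)).row i)) ≤ V := by
      rw [Submodule.span_le]
      rintro _ ⟨⟨i, hi⟩, rfl⟩
      exact hBV i (by simpa using hi)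
    have h3 := Submodule.finrank_mono h2
    rw [h1, Fintype.card_coe, Finset.card_compl, Fintype.card_fin] at h3
    omega
  · unfold GF
    apply le_antisymm
    · refine hFI.trans (sup_le_sup ?_ ?_)
      · apply Submodule.span_mono
        rintro _ ⟨i, hi, rfl⟩
        exact ⟨i, hi, by simp only; rw [hBI i (by exact_mod_cast hi)]⟩
      · rw [← hJB]
        apply Submodule.span_mono
        apply Set.image_mono
        intro i hi hi'
        exact Finset.disjoint_left.1 hJI (by exact_mod_cast hi) (by exact_mod_cast hi')
    · refine sup_le ?_ ?_
      · rw [Submodule.span_le]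
        rintro _ ⟨i, hi, rfl⟩
        simp only
        rw [hBI i (by exact_mod_cast hi)]
        exact hyF i
      · rw [Submodule.span_le]
        rintro _ ⟨i, hi, rfl⟩
        exact hVF (hBV i (by simpa using hi))
  · intro i hi
    rw [hBI' i hi]; abel

open Classical in
lemma count_eig (H : ℤ) (hH : 0 ≤ H) (α : ℂ) :
    ((mbx H).filter fun A => (A.map (Int.castRingHom ℂ) - Matrix.scalar (Fin 7) α).det = 0).card ≤
      2 ^ 14 * ((mbx (4 * H)).filter fun B => B.det = 0).card := by
  set S := (mbx H).filter fun A => (A.map (Int.castRingHom ℂ) - Matrix.scalar (Fin 7) α).det = 0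
    with hS
  have hex : ∀ A : Matrix (Fin 7) (Fin 7) ℤ, A ∈ S →
    ∃ p : Finset (Fin 7) × Finset (Fin 7) × Matrix (Fin 7) (Fin 7) ℤ,
      p.2.2 ∈ mbx (4 * H) ∧ p.2.2.det = 0 ∧
      Submodule.span ℂ (Set.range (fun i => yv α (A i) i)) = GF α p.1 p.2.2 ∧
      (∀ i ∈ p.1, A i = p.2.2 i) ∧
      (∀ i ∉ p.1, A i = p.2.2 i + sF H α (GF α p.1 p.2.2) i -
        if i ∈ p.2.1 then dF H (GF α p.1 p.2.2) p.1 i else 0) := by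
    intro A hA
    rw [hS, Finset.mem_filter] at hA
    obtain ⟨hA, hdet⟩ := hA
    have hdim : Module.finrank ℂ (Submodule.span ℂ (Set.range (fun i => yv α (A i) i))) ≤ 6 := by
      by_contra hcon
      have hli : LinearIndependent ℂ (fun i => yv α (A i) i) := by
        rw [linearIndependent_iff_card_le_finrank_span, Set.finrank, Fintype.card_fin]
        omega
      have : LinearIndependent ℂ (A.map (Int.castRingHom ℂ) - Matrix.scalar (Fin 7) α).row := by
        convert hli using 1
        ext i j
        simp only [Matrix.row, Matrix.sub_apply, Matrix.map_apply, yv, cv, Pi.sub_apply,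
          Matrix.scalar_apply, Matrix.diagonal_apply, Pi.single_apply, eq_comm]
        rfl
      rw [Matrix.linearIndependent_rows_iff_isUnit, Matrix.isUnit_iff_isUnit_det, hdet] at this
      exact not_isUnit_zero this
    obtain ⟨I, T, B, h1, h2, h3, h4, h5⟩ := exists_code H hH α A hA _ rfl hdim
    refine ⟨(I, T, B), h1, h2, h3, h4, ?_⟩
    rw [h3] at h5
    exact h5
  choose! f hf using hex
  have hinj : Set.InjOn f (S : Set (Matrix (Fin 7) (Fin 7) ℤ)) := by
    intro A hA A' hA' h
    obtain ⟨-, -, -, h4, h5⟩ := hf A hA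
    obtain ⟨-, -, -, h4', h5'⟩ := hf A' hA'
    rw [h] at h4 h5
    funext i
    by_cases hi : i ∈ (f A').1
    · rw [h4 i hi, h4' i hi]
    · rw [h5 i hi, h5' i hi]
  have hmaps : ∀ A ∈ S, f A ∈ (Finset.univ : Finset (Finset (Fin 7))) ×ˢ
      (Finset.univ : Finset (Finset (Fin 7))) ×ˢ ((mbx (4 * H)).filter fun B => B.det = 0) := by
    intro A hA
    obtain ⟨h1, h2, -⟩ := hf A hA
    simp [h1, h2]
  refine (Finset.card_le_card_of_injOn f hmaps hinj).trans ?_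
  rw [Finset.card_product, Finset.card_product, Finset.card_univ, Fintype.card_finset,
    Fintype.card_fin, ← mul_assoc]
  norm_num

/-- zero-one diagonal matrix -/
noncomputable def dg (T : Finset (Fin 7)) : Matrix (Fin 7) (Fin 7) ℤ :=
  fun i => if i ∈ T then Pi.single i 1 else 0

lemma exists_diag (A : Matrix (Fin 7) (Fin 7) ℤ) (hA : A.det = 0) :
    ∃ (T : Finset (Fin 7)) (i : Fin 7), (A + dg T).det = 0 ∧
      ((A + dg T).updateRow i (Pi.single i 1)).det ≠ 0 := by
  classical
  have h0 : ∃ T : Finset (Fin 7), (A + dg T).det ≠ 0 := by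
    have hd : LinearIndepOn ℚ (fun i : Fin 7 => (Pi.single i 1 : Fin 7 → ℚ))
        ((Finset.univ : Finset (Fin 7)) : Set (Fin 7)) := by
      rw [Finset.coe_univ, linearIndepOn_univ_iff]
      exact Pi.linearIndependent_single_one (Fin 7) ℚ
    obtain ⟨T, -, hT⟩ := perturb_indep (k := ℚ) _ (fun i j => ((A i j : ℤ) : ℚ)) _ hd
    rw [Finset.coe_univ, linearIndepOn_univ_iff] at hT
    refine ⟨T, fun h => ?_⟩
    have h2 : LinearIndependent ℚ ((A + dg T).map (Int.castRingHom ℚ)).row := by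
      have he : ((A + dg T).map (Int.castRingHom ℚ)).row = fun i =>
          (fun j => ((A i j : ℤ) : ℚ)) + if i ∈ T then Pi.single i (1 : ℚ) else 0 := by
        ext i j
        simp only [Matrix.row, Matrix.map_apply, Matrix.add_apply, dg, Pi.add_apply]
        split_ifs
        · by_cases hij : j = i
          · subst hij; simp
          · simp [hij]
        · simp
      rw [he]
      exact hT
    rw [Matrix.linearIndependent_rows_iff_isUnit, Matrix.isUnit_iff_isUnit_det] at h2
    have h3 : ((A + dg T).map (Int.castRingHom ℚ)).det = (((A + dg T).det : ℤ) : ℚ) := by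
      rw [← RingHom.mapMatrix_apply, ← RingHom.map_det]; rfl
    rw [h3, h] at h2
    simp at h2
  obtain ⟨T, hT, hmin⟩ := Finset.exists_min_image
    ((Finset.univ : Finset (Finset (Fin 7))).filter fun T => (A + dg T).det ≠ 0) Finset.card
    (by obtain ⟨T, hT⟩ := h0; exact ⟨T, by simpa using hT⟩)
  simp only [Finset.mem_filter, Finset.mem_univ, true_and] at hT hmin
  have hTne : T.Nonempty := by
    rw [Finset.nonempty_iff_ne_empty]
    rintro rfl
    apply hT
    have : dg ∅ = 0 := by ext i j; simp [dg]
    rw [this, add_zero, hA]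
  obtain ⟨i, hi⟩ := hTne
  have hE : (A + dg (T.erase i)).det = 0 := by
    by_contra hcon
    have h1 := hmin _ hcon
    have h2 := Finset.card_erase_lt_of_mem hi
    omega
  refine ⟨T.erase i, i, hE, ?_⟩
  have h1 : A + dg T = (A + dg (T.erase i)).updateRow i ((A + dg (T.erase i)) i + Pi.single i 1) := by
    ext k l
    by_cases hk : k = i
    · subst hk
      simp [dg, hi, Matrix.add_apply]
    · rw [Matrix.updateRow_ne hk]
      simp [dg, hk, Matrix.add_apply]
  rw [h1, Matrix.det_updateRow_add, Matrix.updateRow_eq_self, hE, zero_add] at hT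
  exact hT

lemma reduce_mod (K : ℤ) (Q : Matrix (Fin 7) (Fin 7) ℤ) (hQ : Q ∈ mbx K) (hdet : Q.det ≠ 0)
    (z : Fin 7 → ℤ) : ∃ q : Fin 7 → ℤ, z - Matrix.vecMul q Q ∈ bx (7 * K) := by
  set Q' : Matrix (Fin 7) (Fin 7) ℚ := Q.map (Int.castRingHom ℚ) with hQ'
  have hdet' : IsUnit Q'.det := by
    have h3 : Q'.det = ((Q.det : ℤ) : ℚ) := by
      rw [hQ', ← RingHom.mapMatrix_apply, ← RingHom.map_det]; rfl
    rw [h3, isUnit_iff_ne_zero]; exact_mod_cast hdet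
  set p : Fin 7 → ℚ := Matrix.vecMul (fun k => (z k : ℚ)) Q'⁻¹ with hp
  have hpz : ∀ l, (z l : ℚ) = ∑ k, p k * (Q k l : ℚ) := by
    intro l
    have : Matrix.vecMul p Q' = fun k => (z k : ℚ) := by
      rw [hp, Matrix.vecMul_vecMul, Matrix.nonsing_inv_mul _ hdet', Matrix.vecMul_one]
    have h2 := congrFun this l
    simp only [Matrix.vecMul, dotProduct] at h2
    rw [← h2]; rfl
  refine ⟨fun k => ⌊p k⌋, ?_⟩
  rw [mem_bx]
  intro l
  have hl : (((z - Matrix.vecMul (fun k => ⌊p k⌋) Q) l : ℤ) : ℚ) =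
      ∑ k, Int.fract (p k) * (Q k l : ℚ) := by
    simp only [Pi.sub_apply, Matrix.vecMul, dotProduct, Int.cast_sub, Int.cast_sum, Int.cast_mul]
    rw [hpz l, ← Finset.sum_sub_distrib]
    refine Finset.sum_congr rfl fun k _ => ?_
    rw [← sub_mul]; rfl
  have hb : |∑ k, Int.fract (p k) * (Q k l : ℚ)| ≤ 7 * (K : ℚ) := by
    refine (Finset.abs_sum_le_sum_abs _ _).trans ?_
    have : ∀ k ∈ (Finset.univ : Finset (Fin 7)), |Int.fract (p k) * (Q k l : ℚ)| ≤ (K : ℚ) := by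
      intro k _
      rw [abs_mul, abs_of_nonneg (Int.fract_nonneg _)]
      have h1 : |(Q k l : ℚ)| ≤ K := by exact_mod_cast mem_mbx.1 hQ k l
      have h2 := (Int.fract_lt_one (p k)).le
      nlinarith [abs_nonneg (Q k l : ℚ), Int.fract_nonneg (p k)]
    refine (Finset.sum_le_card_nsmul _ _ _ this).trans ?_
    simp
  rw [← hl] at hb
  exact_mod_cast hb

lemma card_bx (K : ℕ) : (bx (K : ℤ)).card = (2 * K + 1) ^ 7 := by
  unfold bx
  rw [Fintype.card_piFinset]
  simp only [Int.card_Icc, Finset.prod_const, Finset.card_univ, Fintype.card_fin]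
  congr 1
  omega

/-- integer vectors in the box orthogonal to `w` -/
noncomputable def Xw (K : ℤ) (w : Fin 7 → ℤ) : Finset (Fin 7 → ℤ) := (bx K).filter fun x => x ⬝ᵥ w = 0

/-- matrices all of whose rows are orthogonal to `w` -/
noncomputable def mXw (K : ℤ) (w : Fin 7 → ℤ) : Finset (Matrix (Fin 7) (Fin 7) ℤ) :=
  Fintype.piFinset fun _ => Xw K w

lemma mem_mXw {K : ℤ} {w : Fin 7 → ℤ} {B : Matrix (Fin 7) (Fin 7) ℤ} :
    B ∈ mXw K w ↔ ∀ i, B i ∈ Xw K w :=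
  Fintype.mem_piFinset (t := fun _ => Xw K w) (f := B)

lemma card_mXw (K : ℤ) (w : Fin 7 → ℤ) : (mXw K w).card = (Xw K w).card ^ 7 := by
  have := Fintype.card_piFinset (fun _ : Fin 7 => Xw K w)
  rw [Finset.prod_const, Finset.card_univ, Fintype.card_fin] at this
  exact this

lemma count_orth (K : ℕ) (hK : 1 ≤ K) (w : Fin 7 → ℤ) (hw : ∀ c : ℤ, ∃ z : Fin 7 → ℤ, z ⬝ᵥ w = c)
    (B : Matrix (Fin 7) (Fin 7) ℤ) (hB : B ∈ mbx K) (hBw : B *ᵥ w = 0) (i j : Fin 7)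
    (hwj : w j ≠ 0)
    (hdet : (B.updateRow i (Pi.single j 1)).det ≠ 0) :
    (Xw K w).card * (w j).natAbs * K ≤ (19 * K) ^ 7 := by
  classical
  set Q := B.updateRow i (Pi.single j 1) with hQ
  have hQb : Q ∈ mbx K := by
    rw [mem_mbx]; intro k l
    by_cases hk : k = i
    · subst hk
      rw [hQ, Matrix.updateRow_self, Pi.single_apply]
      split_ifs <;> simp <;> omega
    · rw [hQ, Matrix.updateRow_ne hk]; exact mem_mbx.1 hB k l
  have hQw : Q *ᵥ w = Pi.single i (w j) := by
    ext k
    by_cases hk : k = i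
    · subst hk
      simp [hQ, Matrix.mulVec]
    · have := congrFun hBw k
      simp only [Matrix.mulVec, hQ, Matrix.updateRow_ne hk, Pi.zero_apply] at this ⊢
      rw [Pi.single_apply, if_neg hk]; exact this
  have hz : ∀ c : ℤ, ∃ z : Fin 7 → ℤ, z ∈ bx (7 * K) ∧ w j ∣ z ⬝ᵥ w - c := by
    intro c
    obtain ⟨z, hz⟩ := hw c
    obtain ⟨q, hq⟩ := reduce_mod K Q hQb hdet z
    refine ⟨_, hq, ?_⟩
    rw [sub_dotProduct, hz, ← Matrix.dotProduct_mulVec, hQw, dotProduct_single]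
    exact ⟨-q i, by ring⟩
  choose z hzb hzd using hz
  set f : (Fin 7 → ℤ) × ℕ × ℕ → (Fin 7 → ℤ) := fun p =>
    p.1 + z p.2.1 + (p.2.2 : ℤ) • Pi.single j 1 with hf
  have hfw : ∀ p, p.1 ∈ Xw K w → f p ⬝ᵥ w = z p.2.1 ⬝ᵥ w + p.2.2 * w j := by
    intro p hp
    have := (Finset.mem_filter.1 hp).2
    simp only [hf, add_dotProduct, this, smul_dotProduct, single_dotProduct, smul_eq_mul]
    ring
  have hmaps : ∀ p ∈ Xw K w ×ˢ Finset.range (w j).natAbs ×ˢ Finset.range K, f p ∈ bx ((9 * K : ℕ) : ℤ) := by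
    rintro ⟨x, c, s⟩ hp
    simp only [Finset.mem_product, Finset.mem_range] at hp
    obtain ⟨hx, hc, hs⟩ := hp
    rw [mem_bx]
    intro l
    have h1 := mem_bx.1 (Finset.mem_filter.1 hx).1 l
    have h2 := mem_bx.1 (hzb c) l
    have h3 : |((s : ℤ) • (Pi.single j 1 : Fin 7 → ℤ)) l| ≤ K := by
      rw [Pi.smul_apply, Pi.single_apply]
      split_ifs <;> simp; omega
    simp only [hf, Pi.add_apply]
    have h4 := abs_add_le (x l + z c l) (((s : ℤ) • (Pi.single j 1 : Fin 7 → ℤ)) l)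
    have h5 := abs_add_le (x l) (z c l)
    push_cast
    linarith
  have hinj : Set.InjOn f ((Xw K w ×ˢ Finset.range (w j).natAbs ×ˢ Finset.range K : Finset _) :
      Set ((Fin 7 → ℤ) × ℕ × ℕ)) := by
    rintro ⟨x, c, s⟩ hp ⟨x', c', s'⟩ hp' h
    rw [Finset.mem_coe] at hp hp'
    simp only [Finset.mem_product, Finset.mem_range] at hp hp'
    obtain ⟨hx, hc, hs⟩ := hp
    obtain ⟨hx', hc', hs'⟩ := hp'
    have h1 := hfw (x, c, s) hx
    have h2 := hfw (x', c', s') hx'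
    rw [h, h2] at h1
    simp only at h1
    have hcc : c = c' := by
      obtain ⟨u, hu⟩ := hzd c
      obtain ⟨u', hu'⟩ := hzd c'
      have h3 : w j ∣ (c : ℤ) - c' := ⟨u' - u + (s' - s), by linear_combination hu' - hu - h1⟩
      have h4 : |(c : ℤ) - c'| < |w j| := by
        rw [abs_lt]; rw [Int.abs_eq_natAbs]; constructor <;> omega
      have := Int.eq_zero_of_abs_lt_dvd ((abs_dvd _ _).2 h3) h4
      omega
    subst hcc
    have hss : s = s' := by
      have : ((s' : ℤ) - s) * w j = 0 := by linear_combination h1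
      rcases mul_eq_zero.1 this with h | h
      · omega
      · exact absurd h hwj
    subst hss
    have : x = x' := by
      simp only [hf] at h
      exact add_right_cancel (add_right_cancel h)
    rw [this]
  have := Finset.card_le_card_of_injOn f hmaps hinj
  rw [Finset.card_product, Finset.card_product, Finset.card_range, Finset.card_range, card_bx,
    ← mul_assoc] at this
  refine this.trans (Nat.pow_le_pow_left (by omega) 7)

/-- the good normals: maximum norm `M`, count bound -/
noncomputable def good (K M : ℕ) : Finset (Fin 7 → ℤ) :=
  (bx (M : ℤ) \ bx ((M : ℤ) - 1)).filter fun w => (Xw K w).card * M * K ≤ (19 * K) ^ 7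

lemma exists_good (K : ℕ) (hK : 1 ≤ K) (B : Matrix (Fin 7) (Fin 7) ℤ) (hB : B ∈ mbx K)
    (hdet : B.det = 0) (i : Fin 7) (hi : (B.updateRow i (Pi.single i 1)).det ≠ 0) :
    ∃ M : ℕ, M ∈ Finset.Icc 1 (19 ^ 7 * K ^ 6) ∧ ∃ w ∈ good K M,
      B ∈ mXw K w := by
  classical
  obtain ⟨v, hv0, hv⟩ := Matrix.exists_mulVec_eq_zero_iff.2 hdet
  obtain ⟨w, hw, hgcd⟩ := Finset.extract_gcd (s := (Finset.univ : Finset (Fin 7))) v ⟨0, by simp⟩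
  set g := (Finset.univ : Finset (Fin 7)).gcd v with hg
  have hvw : v = g • w := by ext k; simpa using hw k (Finset.mem_univ _)
  have hg0 : g ≠ 0 := by
    intro h; apply hv0; rw [hvw, h, zero_smul]
  have hBw : B *ᵥ w = 0 := by
    rw [hvw, Matrix.mulVec_smul] at hv
    exact (smul_eq_zero.1 hv).resolve_left hg0
  have hw0 : w ≠ 0 := by rintro rfl; apply hv0; rw [hvw, smul_zero]
  have hbez : ∀ c : ℤ, ∃ z : Fin 7 → ℤ, z ⬝ᵥ w = c := by
    intro c
    have hp := (IsPrincipalIdealRing.principal (Ideal.span (Set.range w))).principal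
    obtain ⟨a, ha⟩ := hp
    have hdvd : ∀ k ∈ (Finset.univ : Finset (Fin 7)), a ∣ w k := by
      intro k _
      have h1 : w k ∈ Ideal.span (Set.range w) := Ideal.subset_span ⟨k, rfl⟩
      rw [ha] at h1
      exact Ideal.mem_span_singleton.1 h1
    have h1 := Finset.dvd_gcd hdvd
    rw [hgcd] at h1
    have h2 : c ∈ Ideal.span (Set.range w) := by
      rw [ha]
      exact Ideal.mem_span_singleton.2 (h1.trans (one_dvd c))
    obtain ⟨z, hz⟩ := Ideal.mem_span_range_iff_exists_fun.1 h2
    exact ⟨z, hz⟩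
  obtain ⟨j, -, hj⟩ := Finset.exists_max_image (Finset.univ : Finset (Fin 7)) (fun k => (w k).natAbs)
    ⟨0, by simp⟩
  have hwj : w j ≠ 0 := by
    intro h
    apply hw0
    ext k
    have := hj k (Finset.mem_univ _)
    simp [h] at this
    simpa using this
  -- the determinant with e_j is nonzero as well
  have hrow : ∀ (x : Fin 7 → ℤ) (l : Fin 7), (∀ k, k ≠ i → B k ⬝ᵥ x = 0) → x l = 0 →
      (B.updateRow i (Pi.single l 1)) *ᵥ x = 0 := by
    intro x l hx hl
    ext k
    by_cases hk : k = i
    · subst hk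
      simp [Matrix.mulVec, hl]
    · simp only [Matrix.mulVec, Matrix.updateRow_ne hk]
      exact hx k hk
  have hker : ∀ x : Fin 7 → ℤ, (∀ k, k ≠ i → B k ⬝ᵥ x = 0) → x i = 0 → x = 0 := by
    intro x hx hxi
    by_contra hne
    exact hi (Matrix.exists_mulVec_eq_zero_iff.1 ⟨x, hne, hrow x i hx hxi⟩)
  have hwk : ∀ k, B k ⬝ᵥ w = 0 := fun k => congrFun hBw k
  have hdj : (B.updateRow i (Pi.single j 1)).det ≠ 0 := by
    intro h
    obtain ⟨x, hx0, hx⟩ := Matrix.exists_mulVec_eq_zero_iff.2 h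
    have hxk : ∀ k, k ≠ i → B k ⬝ᵥ x = 0 := by
      intro k hk
      have := congrFun hx k
      simpa only [Matrix.mulVec, Matrix.updateRow_ne hk, Pi.zero_apply] using this
    have hxj : x j = 0 := by
      have := congrFun hx i
      simpa [Matrix.mulVec] using this
    have hxi : x i ≠ 0 := fun h => hx0 (hker x hxk h)
    have hcomb := hker (x i • w - w i • x) (by
      intro k hk
      rw [dotProduct_sub, dotProduct_smul, dotProduct_smul, hwk k, hxk k hk]; simp) (by
      simp; ring)
    have := congrFun hcomb j
    simp [hxj, hxi, hwj] at this
  have hmain := count_orth K hK w hbez B hB hBw i j hwj hdj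
  have hX0 : 1 ≤ (Xw K w).card := by
    apply Finset.card_pos.2
    refine ⟨0, Finset.mem_filter.2 ⟨mem_bx.2 (by simp), by simp⟩⟩
  refine ⟨(w j).natAbs, ?_, w, ?_, ?_⟩
  · rw [Finset.mem_Icc]
    refine ⟨by omega, ?_⟩
    have h1 : (w j).natAbs * K ≤ (19 ^ 7 * K ^ 6) * K := by
      calc (w j).natAbs * K ≤ (Xw K w).card * ((w j).natAbs * K) := Nat.le_mul_of_pos_left _ hX0
        _ ≤ (19 * K) ^ 7 := by rw [← mul_assoc]; exact hmain
        _ = _ := by ring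
    exact Nat.le_of_mul_le_mul_right h1 (by omega)
  · unfold good
    rw [Finset.mem_filter, Finset.mem_sdiff, mem_bx, mem_bx]
    refine ⟨⟨?_, ?_⟩, hmain⟩
    · intro k; have := hj k (Finset.mem_univ _); rw [Int.abs_eq_natAbs]; omega
    · intro h; have := h j; rw [Int.abs_eq_natAbs] at this; omega
  · rw [mem_mXw]
    intro k
    exact Finset.mem_filter.2 ⟨mem_bx.2 (mem_mbx.1 hB k), hwk k⟩

lemma card_shell (M : ℕ) (hM : 1 ≤ M) :
    ((bx (M : ℤ) \ bx ((M : ℤ) - 1)).card : ℝ) ≤ 14 * 3 ^ 6 * (M : ℝ) ^ 6 := by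
  obtain ⟨m, rfl⟩ : ∃ m, M = m + 1 := ⟨M - 1, by omega⟩
  have hsub : bx (m : ℤ) ⊆ bx ((m + 1 : ℕ) : ℤ) := by
    intro x hx; rw [mem_bx] at hx ⊢; intro i; have := hx i; push_cast; linarith
  have he : (((m + 1 : ℕ) : ℤ) - 1) = (m : ℤ) := by push_cast; ring
  rw [he]
  have h1 := Finset.card_sdiff_add_card_eq_card hsub
  rw [card_bx, card_bx] at h1
  have h2 : ((bx ((m + 1 : ℕ) : ℤ) \ bx (m : ℤ)).card : ℝ) =
      (2 * ((m : ℝ) + 1) + 1) ^ 7 - (2 * (m : ℝ) + 1) ^ 7 := by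
    have : (((bx ((m + 1 : ℕ) : ℤ) \ bx (m : ℤ)).card + (2 * m + 1) ^ 7 : ℕ) : ℝ) =
      ((2 * (m + 1) + 1) ^ 7 : ℕ) := by exact_mod_cast h1
    push_cast at this
    push_cast
    linarith
  rw [h2]
  push_cast
  have hm : (0 : ℝ) ≤ m := Nat.cast_nonneg m
  rw [← sub_nonneg]
  ring_nf
  positivity

lemma good_term (K M : ℕ) (hK : 1 ≤ K) (hM : 1 ≤ M) :
    ((∑ w ∈ good K M, (mXw K w).card : ℕ) : ℝ) ≤
      14 * 3 ^ 6 * 19 ^ 49 * (K : ℝ) ^ 42 * (M : ℝ)⁻¹ := by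
  have hKr : (0 : ℝ) < K := by exact_mod_cast hK
  have hMr : (0 : ℝ) < M := by exact_mod_cast hM
  have hterm : ∀ w ∈ good K M, ((mXw K w).card : ℝ) ≤ (19 ^ 7 * (K : ℝ) ^ 6 / M) ^ 7 := by
    intro w hw
    rw [card_mXw]
    push_cast
    apply pow_le_pow_left₀ (by positivity)
    rw [le_div_iff₀ hMr]
    have h1 := (Finset.mem_filter.1 hw).2
    have h2 : ((Xw K w).card : ℝ) * M * K ≤ (19 * K) ^ 7 := by exact_mod_cast h1
    have h3 : (19 * (K : ℝ)) ^ 7 = (19 ^ 7 * (K : ℝ) ^ 6) * K := by ring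
    rw [h3] at h2
    exact le_of_mul_le_mul_right h2 hKr
  rw [Nat.cast_sum]
  refine (Finset.sum_le_card_nsmul _ _ _ hterm).trans ?_
  rw [nsmul_eq_mul]
  have hc : ((good K M).card : ℝ) ≤ 14 * 3 ^ 6 * (M : ℝ) ^ 6 := by
    refine le_trans ?_ (card_shell M hM)
    exact Nat.cast_le.2 (Finset.card_filter_le _ _)
  refine (mul_le_mul_of_nonneg_right hc (by positivity)).trans (le_of_eq ?_)
  field_simp

lemma count_corank (K : ℕ) (hK : 1 ≤ K) (S : Finset (Matrix (Fin 7) (Fin 7) ℤ))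
    (hS : ∀ B ∈ S, B ∈ mbx K ∧ B.det = 0 ∧ ∃ i, (B.updateRow i (Pi.single i 1)).det ≠ 0) :
    (S.card : ℝ) ≤ 14 * 3 ^ 6 * 19 ^ 49 * (K : ℝ) ^ 42 *
      (1 + Real.log ((19 ^ 7 * K ^ 6 : ℕ) : ℝ)) := by
  classical
  have hsub : S ⊆ (Finset.Icc 1 (19 ^ 7 * K ^ 6)).biUnion fun M =>
      (good K M).biUnion fun w => mXw K w := by
    intro B hB
    obtain ⟨h1, h2, i, hi⟩ := hS B hB
    obtain ⟨M, hM, w, hw, hBw⟩ := exists_good K hK B h1 h2 i hi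
    rw [Finset.mem_biUnion]
    exact ⟨M, hM, Finset.mem_biUnion.2 ⟨w, hw, hBw⟩⟩
  have h1 : S.card ≤ ∑ M ∈ Finset.Icc 1 (19 ^ 7 * K ^ 6), ∑ w ∈ good K M, (mXw K w).card :=
    (Finset.card_le_card hsub).trans (Finset.card_biUnion_le.trans
      (Finset.sum_le_sum fun M _ => Finset.card_biUnion_le))
  have h2 : (S.card : ℝ) ≤ ∑ M ∈ Finset.Icc 1 (19 ^ 7 * K ^ 6),
      ((∑ w ∈ good K M, (mXw K w).card : ℕ) : ℝ) := by exact_mod_cast h1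
  refine h2.trans ((Finset.sum_le_sum fun M hM =>
    good_term K M hK (Finset.mem_Icc.1 hM).1).trans ?_)
  rw [← Finset.mul_sum]
  apply mul_le_mul_of_nonneg_left _ (by positivity)
  have h3 := harmonic_le_one_add_log (19 ^ 7 * K ^ 6)
  rw [harmonic_eq_sum_Icc] at h3
  push_cast at h3 ⊢
  exact h3

open Classical in
lemma count_sing (K : ℕ) (hK : 1 ≤ K) :
    (((mbx K).filter fun B => B.det = 0).card : ℝ) ≤
      128 * (14 * 3 ^ 6 * 19 ^ 49 * ((K + 1 : ℕ) : ℝ) ^ 42 *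
        (1 + Real.log ((19 ^ 7 * (K + 1) ^ 6 : ℕ) : ℝ))) := by
  set S := (mbx ((K + 1 : ℕ) : ℤ)).filter fun B => B.det = 0 ∧
    ∃ i, (B.updateRow i (Pi.single i 1)).det ≠ 0 with hSdef
  have hS := count_corank (K + 1) (by omega) S (by
    intro B hB
    have := Finset.mem_filter.1 hB
    exact ⟨this.1, this.2⟩)
  have hsub : ((mbx K).filter fun B => B.det = 0) ⊆
      ((Finset.univ : Finset (Finset (Fin 7))) ×ˢ S).image fun p => p.2 - dg p.1 := by
    intro A hA
    rw [Finset.mem_filter] at hA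
    obtain ⟨T, i, h1, h2⟩ := exists_diag A hA.2
    rw [Finset.mem_image]
    refine ⟨(T, A + dg T), ?_, by simp⟩
    rw [Finset.mem_product]
    refine ⟨Finset.mem_univ _, Finset.mem_filter.2 ⟨?_, h1, i, h2⟩⟩
    rw [mem_mbx]
    intro k l
    have h3 := mem_mbx.1 hA.1 k l
    have h4 : |dg T k l| ≤ 1 := by
      unfold dg
      split_ifs
      · rw [Pi.single_apply]; split_ifs <;> simp
      · simp
    change |A k l + dg T k l| ≤ _
    refine (abs_add_le _ _).trans ?_
    push_cast
    linarith
  have h5 : ((mbx K).filter fun B => B.det = 0).card ≤ 128 * S.card := by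
    refine (Finset.card_le_card hsub).trans (Finset.card_image_le.trans ?_)
    rw [Finset.card_product, Finset.card_univ, Fintype.card_finset, Fintype.card_fin]
    norm_num
  have h6 : (((mbx K).filter fun B => B.det = 0).card : ℝ) ≤ 128 * S.card := by exact_mod_cast h5
  linarith

lemma exists_quadratic (f : ℤ[X]) (hf : f.Monic) (hdeg : f.natDegree = 7)
    (hns : ¬ Squarefree (f.map (Int.castRingHom ℂ))) :
    ∃ q : ℤ[X], q.Monic ∧ q.natDegree = 2 ∧ ∀ z : ℂ, aeval z q = 0 → aeval z f = 0 := by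
  have hns' : ∃ x : ℂ[X], x * x ∣ f.map (Int.castRingHom ℂ) ∧ ¬ IsUnit x := by
    unfold Squarefree at hns
    push Not at hns
    exact hns
  obtain ⟨x, ⟨r, hr⟩, hxu⟩ := hns'
  have hF0 : f.map (Int.castRingHom ℂ) ≠ 0 := (hf.map _).ne_zero
  have hx0 : x ≠ 0 := by rintro rfl; apply hF0; rw [hr]; simp
  obtain ⟨μ, hμ⟩ := IsAlgClosed.exists_root x (fun h => hxu (isUnit_iff_degree_eq_zero.2 h))
  have hμ' : x.eval μ = 0 := hμ
  have hfe : ∀ p : ℤ[X], aeval μ p = (p.map (Int.castRingHom ℂ)).eval μ := fun p => by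
    rw [Polynomial.eval_map, Polynomial.aeval_def]; rfl
  have h0 : aeval μ f = 0 := by
    rw [hfe, hr]; simp [hμ']
  have h1 : aeval μ (derivative f) = 0 := by
    rw [hfe, ← Polynomial.derivative_map, hr]; simp [Polynomial.derivative_mul, hμ']
  have hinteg : IsIntegral ℤ μ := ⟨f, hf, h0⟩
  set g := minpoly ℤ μ with hg
  have hgm : g.Monic := minpoly.monic hinteg
  have hgpos : 0 < g.natDegree := minpoly.natDegree_pos hinteg
  obtain ⟨h, hh⟩ := minpoly.isIntegrallyClosed_dvd hinteg h0
  rw [← hg] at hh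
  have hg' : aeval μ (derivative g) ≠ 0 := by
    intro hc
    have hd := minpoly.isIntegrallyClosed_dvd hinteg hc
    rw [← hg] at hd
    have hlt := Polynomial.natDegree_derivative_lt (p := g) (by omega)
    have hne : derivative g ≠ 0 := by
      intro h0'
      have := Polynomial.natDegree_eq_zero_of_derivative_eq_zero h0'
      omega
    exact Polynomial.not_dvd_of_natDegree_lt hne hlt hd
  have hhμ : aeval μ h = 0 := by
    rw [hh, Polynomial.derivative_mul] at h1
    simp only [map_add, map_mul] at h1
    rw [hg, minpoly.aeval, zero_mul, add_zero, ← hg] at h1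
    exact (mul_eq_zero.1 h1).resolve_left hg'
  obtain ⟨k, hk⟩ := minpoly.isIntegrallyClosed_dvd hinteg hhμ
  rw [← hg] at hk
  have hfk : f = g * (g * k) := by rw [← hk, ← hh]
  have hkm : k.Monic := by
    have : (g * k).Monic := hgm.of_mul_monic_left (hfk ▸ hf)
    exact hgm.of_mul_monic_left this
  have hd : g.natDegree + (g.natDegree + k.natDegree) = 7 := by
    rw [← hgm.natDegree_mul hkm, ← hgm.natDegree_mul (hgm.mul hkm), ← hfk, hdeg]
  have hcases : g.natDegree = 1 ∨ g.natDegree = 2 ∨ k.natDegree = 1 := by omega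
  rcases hcases with h | h | h
  · refine ⟨g * g, hgm.mul hgm, by rw [hgm.natDegree_mul hgm]; omega, fun z hz => ?_⟩
    have : aeval z g = 0 := by simpa using hz
    rw [hfk]; simp [this]
  · refine ⟨g, hgm, h, fun z hz => ?_⟩
    rw [hfk]; simp [hz]
  · refine ⟨k * k, hkm.mul hkm, by rw [hkm.natDegree_mul hkm]; omega, fun z hz => ?_⟩
    have : aeval z k = 0 := by simpa using hz
    rw [hfk]; simp [this]

lemma root_det (A : Matrix (Fin 7) (Fin 7) ℤ) (z : ℂ) (hz : aeval z A.charpoly = 0) :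
    (A.map (Int.castRingHom ℂ) - Matrix.scalar (Fin 7) z).det = 0 := by
  have h1 : (A.charpoly.map (Int.castRingHom ℂ)).eval z = 0 := by
    rw [Polynomial.eval_map]; rw [Polynomial.aeval_def] at hz; exact hz
  rw [← Matrix.charpoly_map, Matrix.eval_charpoly] at h1
  rw [← neg_sub, Matrix.det_neg, h1, mul_zero]

lemma root_bound (H : ℕ) (A : Matrix (Fin 7) (Fin 7) ℤ) (hA : A ∈ mbx H) (z : ℂ)
    (hz : aeval z A.charpoly = 0) : ‖z‖ ≤ 7 * H := by
  obtain ⟨v, hv0, hv⟩ := Matrix.exists_mulVec_eq_zero_iff.2 (root_det A z hz)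
  obtain ⟨i, -, hi⟩ := Finset.exists_max_image (Finset.univ : Finset (Fin 7)) (fun k => ‖v k‖)
    ⟨0, by simp⟩
  have hvi : 0 < ‖v i‖ := by
    rw [norm_pos_iff]
    intro h
    apply hv0
    ext k
    have := hi k (Finset.mem_univ _)
    simpa [h] using this
  have h1 := congrFun hv i
  rw [Matrix.sub_mulVec, Pi.sub_apply, Pi.zero_apply, sub_eq_zero] at h1
  have h2 : (Matrix.scalar (Fin 7) z *ᵥ v) i = z * v i := by
    rw [Matrix.scalar_apply, Matrix.mulVec_diagonal]
  rw [h2] at h1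
  have h3 : ‖z‖ * ‖v i‖ ≤ 7 * H * ‖v i‖ := by
    rw [← norm_mul, ← h1]
    simp only [Matrix.mulVec, dotProduct]
    refine (norm_sum_le _ _).trans ?_
    have : ∀ k ∈ (Finset.univ : Finset (Fin 7)),
        ‖(A.map (Int.castRingHom ℂ)) i k * v k‖ ≤ H * ‖v i‖ := by
      intro k hk
      rw [norm_mul]
      refine mul_le_mul ?_ (hi k hk) (norm_nonneg _) (Nat.cast_nonneg _)
      rw [Matrix.map_apply]
      have h4 := mem_mbx.1 hA i k
      have h5 : ‖((A i k : ℤ) : ℂ)‖ = ((|A i k| : ℤ) : ℝ) := by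
        rw [Complex.norm_intCast]; push_cast; rfl
      change ‖((A i k : ℤ) : ℂ)‖ ≤ _
      rw [h5]
      exact_mod_cast h4
    refine (Finset.sum_le_card_nsmul _ _ _ this).trans (le_of_eq ?_)
    simp; ring
  exact le_of_mul_le_mul_right h3 hvi

lemma exists_rt (u v : ℤ) : ∃ z : ℂ, z ^ 2 + u * z + v = 0 := by
  have hdeg : (X ^ 2 + C (u : ℂ) * X + C (v : ℂ)).degree = 2 := by compute_degree!
  obtain ⟨z, hz⟩ := IsAlgClosed.exists_root (X ^ 2 + C (u : ℂ) * X + C (v : ℂ)) (by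
    rw [hdeg]; norm_num)
  refine ⟨z, ?_⟩
  simpa [Polynomial.IsRoot] using hz

/-- a chosen root of an integer quadratic -/
noncomputable def rt (u v : ℤ) : ℂ := (exists_rt u v).choose

lemma rt_spec (u v : ℤ) : (rt u v) ^ 2 + u * rt u v + v = 0 := (exists_rt u v).choose_spec

lemma exists_uv (H : ℕ) (A : Matrix (Fin 7) (Fin 7) ℤ) (hA : A ∈ mbx H)
    (hns : ¬ Squarefree (A.charpoly.map (Int.castRingHom ℂ))) :
    ∃ u v : ℤ, |u| ≤ 14 * H ∧ |v| ≤ 49 * H ^ 2 ∧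
      (A.map (Int.castRingHom ℂ) - Matrix.scalar (Fin 7) (rt u v)).det = 0 := by
  obtain ⟨q, hqm, hqd, hq⟩ := exists_quadratic A.charpoly A.charpoly_monic
    (by rw [Matrix.charpoly_natDegree_eq_dim, Fintype.card_fin]) hns
  set u := q.coeff 1
  set v := q.coeff 0
  have hqe : ∀ z : ℂ, aeval z q = z ^ 2 + u * z + v := by
    intro z
    have h2 : q.coeff 2 = 1 := by rw [← hqd]; exact hqm
    rw [Polynomial.aeval_eq_sum_range, hqd, Finset.sum_range_succ, Finset.sum_range_succ,
      Finset.sum_range_one, h2]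
    simp only [zsmul_eq_mul, pow_zero, pow_one, mul_one, Int.cast_one, one_mul]
    ring
  have hz1 := rt_spec u v
  set z := rt u v with hz
  have hr1 : aeval z A.charpoly = 0 := hq z (by rw [hqe]; exact hz1)
  have hr2 : aeval (-u - z) A.charpoly = 0 := hq _ (by rw [hqe]; linear_combination hz1)
  have b1 := root_bound H A hA _ hr1
  have b2 := root_bound H A hA _ hr2
  refine ⟨u, v, ?_, ?_, root_det A _ hr1⟩
  · have h1 : (u : ℂ) = -(z + (-u - z)) := by ring
    have h2 : ‖(u : ℂ)‖ ≤ 14 * H := by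
      rw [h1, norm_neg]
      exact (norm_add_le _ _).trans (by linarith)
    rw [Complex.norm_intCast] at h2
    exact_mod_cast h2
  · have h1 : (v : ℂ) = z * (-u - z) := by linear_combination hz1
    have h2 : ‖(v : ℂ)‖ ≤ 49 * H ^ 2 := by
      rw [h1, norm_mul]
      exact (mul_le_mul b1 b2 (norm_nonneg _) (by positivity)).trans (le_of_eq (by ring))
    rw [Complex.norm_intCast] at h2
    exact_mod_cast h2

lemma log_bound (H : ℕ) (hH : 2 ≤ H) :
    1 + Real.log ((19 ^ 7 * (4 * H + 1) ^ 6 : ℕ) : ℝ) ≤ 61 * Real.log H := by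
  have hHr : (2 : ℝ) ≤ H := by exact_mod_cast hH
  have h1 : Real.log ((19 ^ 7 * (4 * H + 1) ^ 6 : ℕ) : ℝ) ≤ Real.log ((H : ℝ) ^ 59) := by
    apply Real.log_le_log
    · positivity
    · have h2 : 19 ^ 7 * (4 * H + 1) ^ 6 ≤ H ^ 59 := by
        calc 19 ^ 7 * (4 * H + 1) ^ 6 ≤ 19 ^ 7 * (5 * H) ^ 6 := by gcongr; omega
          _ = (19 ^ 7 * 5 ^ 6) * H ^ 6 := by ring
          _ ≤ 2 ^ 53 * H ^ 6 := by gcongr; norm_num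
          _ ≤ H ^ 53 * H ^ 6 := by gcongr
          _ = H ^ 59 := by ring
      exact_mod_cast h2
  rw [Real.log_pow] at h1
  have h3 : Real.log 2 ≤ Real.log H := Real.log_le_log (by norm_num) hHr
  have h4 := Real.log_two_gt_d9
  push_cast at h1 ⊢
  linarith

/-- Theorem 1.2, case `n = 7`: `R_7(H) ≪ H^45 log H`. -/
theorem repeated_eigenvalue_count_seven :
    ∃ C : ℝ, 0 < C ∧ ∀ H : ℕ, 2 ≤ H →
      (Set.ncard {A : Matrix (Fin 7) (Fin 7) ℤ | (∀ i j, |A i j| ≤ (H : ℤ)) ∧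
        ¬ Squarefree (Polynomial.map (Int.castRingHom ℂ) A.charpoly)} : ℝ) ≤
      C * (H : ℝ) ^ (45 : ℕ) * Real.log H := by
  classical
  obtain ⟨c0, hc0⟩ : ∃ c : ℝ, c = 14 * 3 ^ 6 * 19 ^ 49 := ⟨_, rfl⟩
  have hc0pos : 0 < c0 := by rw [hc0]; positivity
  refine ⟨29 * 99 * (2 ^ 14 * (128 * (c0 * 5 ^ 42 * 61))), by positivity, ?_⟩
  intro H hH
  have hHr : (2 : ℝ) ≤ H := by exact_mod_cast hH
  set N := ((mbx (4 * (H : ℤ))).filter fun B => B.det = 0).card with hN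
  set P : Finset (ℤ × ℤ) := Finset.Icc (-(14 * (H : ℤ))) (14 * (H : ℤ)) ×ˢ
    Finset.Icc (-(49 * (H : ℤ) ^ 2)) (49 * (H : ℤ) ^ 2) with hP
  have hsub : {A : Matrix (Fin 7) (Fin 7) ℤ | (∀ i j, |A i j| ≤ (H : ℤ)) ∧
        ¬ Squarefree (Polynomial.map (Int.castRingHom ℂ) A.charpoly)} ⊆
      ((P.biUnion fun p => (mbx H).filter fun A =>
        (A.map (Int.castRingHom ℂ) - Matrix.scalar (Fin 7) (rt p.1 p.2)).det = 0 :
        Finset (Matrix (Fin 7) (Fin 7) ℤ)) : Set (Matrix (Fin 7) (Fin 7) ℤ)) := by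
    rintro A ⟨hA, hns⟩
    have hA' : A ∈ mbx H := mem_mbx.2 hA
    obtain ⟨u, v, hu, hv, hdet⟩ := exists_uv H A hA' hns
    rw [Finset.mem_coe, Finset.mem_biUnion]
    refine ⟨(u, v), ?_, Finset.mem_filter.2 ⟨hA', hdet⟩⟩
    rw [hP, Finset.mem_product, Finset.mem_Icc, Finset.mem_Icc]
    exact ⟨abs_le.1 hu, abs_le.1 hv⟩
  have h1 := Set.ncard_le_ncard hsub (Finset.finite_toSet _)
  rw [Set.ncard_coe_finset] at h1
  have hPc : P.card ≤ 29 * 99 * H ^ 3 := by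
    rw [hP, Finset.card_product, Int.card_Icc, Int.card_Icc]
    have e1 : (14 * (H : ℤ) + 1 - -(14 * (H : ℤ))).toNat ≤ 29 * H := by omega
    have e2 : (49 * (H : ℤ) ^ 2 + 1 - -(49 * (H : ℤ) ^ 2)).toNat ≤ 99 * H ^ 2 := by
      rw [Int.toNat_le]
      push_cast
      have : (1 : ℤ) ≤ (H : ℤ) ^ 2 := by
        have : (2 : ℤ) ≤ H := by exact_mod_cast hH
        nlinarith
      linarith
    exact (Nat.mul_le_mul e1 e2).trans (le_of_eq (by ring))
  have h2 := h1.trans (Finset.card_biUnion_le.trans (Finset.sum_le_card_nsmul P _ (2 ^ 14 * N)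
    (fun p _ => count_eig H (by positivity) (rt p.1 p.2))))
  rw [smul_eq_mul] at h2
  have h3 := h2.trans (Nat.mul_le_mul_right _ hPc)
  have h4 : (Set.ncard {A : Matrix (Fin 7) (Fin 7) ℤ | (∀ i j, |A i j| ≤ (H : ℤ)) ∧
        ¬ Squarefree (Polynomial.map (Int.castRingHom ℂ) A.charpoly)} : ℝ) ≤
      29 * 99 * (H : ℝ) ^ 3 * (2 ^ 14 * N) := by exact_mod_cast h3
  have h5 := count_sing (4 * H) (by omega)
  rw [← hc0] at h5
  have h6 : ((4 * H : ℕ) : ℤ) = 4 * (H : ℤ) := by push_cast; ring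
  rw [h6, ← hN] at h5
  have h7 := log_bound H hH
  have h8 : ((4 * H + 1 : ℕ) : ℝ) ^ 42 ≤ (5 * (H : ℝ)) ^ 42 := by
    apply pow_le_pow_left₀ (by positivity)
    push_cast; linarith
  have hlog : 0 ≤ Real.log H := Real.log_nonneg (by linarith)
  have h9 : (N : ℝ) ≤ 128 * (c0 * (5 * (H : ℝ)) ^ 42 * (61 * Real.log H)) := by
    refine h5.trans ?_
    apply mul_le_mul_of_nonneg_left _ (by norm_num)
    refine (mul_le_mul_of_nonneg_left h7 (by positivity)).trans ?_
    apply mul_le_mul_of_nonneg_right _ (by positivity)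
    exact mul_le_mul_of_nonneg_left h8 hc0pos.le
  refine h4.trans ?_
  have h10 : 29 * 99 * (H : ℝ) ^ 3 * (2 ^ 14 * N) ≤ 29 * 99 * (H : ℝ) ^ 3 *
      (2 ^ 14 * (128 * (c0 * (5 * (H : ℝ)) ^ 42 * (61 * Real.log H)))) := by gcongr
  refine h10.trans (le_of_eq ?_)
  rw [mul_pow]
  ring
end

section
/- For every ε > 0 there exists H₀ such that for all integers H ≥ H₀ and all polynomials f ∈ ℤ[X] of degree 2, the number P_2(H;f) of matrices A in M_2(ℤ;H) whose characteristic polynomial equals f satisfies P_2(H;f) ≤ H^(1+ε); the bound is uniform in f. -/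
open Matrix Polynomial

/-- The divisor bound, uniform in `n`. -/
lemma divisor_bound (δ : ℝ) (hδ : 0 < δ) : ∃ C : ℝ, 1 ≤ C ∧ ∀ n : ℕ, n ≠ 0 →
    (n.divisors.card : ℝ) ≤ C * (n : ℝ) ^ δ := by
  obtain ⟨N, hN⟩ := exists_nat_ge ((2 : ℝ) ^ (1 / δ))
  have hl : 0 < Real.log 2 := Real.log_pos (by norm_num)
  set K : ℝ := 1 + 1 / (δ * Real.log 2) with hK
  have hK1 : 1 ≤ K := by
    have : 0 ≤ 1 / (δ * Real.log 2) := by positivity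
    linarith
  have hK2 : 1 ≤ K * (δ * Real.log 2) := by
    have h0 : 0 < δ * Real.log 2 := by positivity
    rw [hK, add_mul, one_div, inv_mul_cancel₀ h0.ne']
    linarith
  refine ⟨K ^ N, one_le_pow₀ hK1, fun n hn => ?_⟩
  have key : ∀ p ∈ n.primeFactors, ((n.factorization p : ℝ) + 1) ≤
      (if p < N then K else 1) * ((p : ℝ) ^ (n.factorization p)) ^ δ := by
    intro p hp
    have hp2 : (2 : ℝ) ≤ p := by exact_mod_cast (Nat.prime_of_mem_primeFactors hp).two_le
    generalize n.factorization p = a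
    have hsw : ((p : ℝ) ^ a) ^ δ = ((p : ℝ) ^ δ) ^ a := by
      rw [← Real.rpow_natCast, ← Real.rpow_natCast, ← Real.rpow_mul (by linarith),
        ← Real.rpow_mul (by linarith), mul_comm]
    rw [hsw]
    split_ifs with h
    · have h1 : 1 + δ * Real.log 2 ≤ (p : ℝ) ^ δ := by
        have h2 : (2 : ℝ) ^ δ ≤ (p : ℝ) ^ δ := Real.rpow_le_rpow (by norm_num) hp2 hδ.le
        have h3 : (2 : ℝ) ^ δ = Real.exp (Real.log 2 * δ) := Real.rpow_def_of_pos (by norm_num) δ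
        have h4 := Real.add_one_le_exp (Real.log 2 * δ)
        linarith
      have h5 : 1 + (a : ℝ) * (δ * Real.log 2) ≤ (1 + δ * Real.log 2) ^ a :=
        one_add_mul_le_pow (by nlinarith [mul_pos hδ hl]) a
      have h6 : (1 + δ * Real.log 2) ^ a ≤ ((p : ℝ) ^ δ) ^ a :=
        pow_le_pow_left₀ (by positivity) h1 a
      have ha : (0 : ℝ) ≤ a := Nat.cast_nonneg a
      calc (a : ℝ) + 1 ≤ K * (1 + (a : ℝ) * (δ * Real.log 2)) := by nlinarith
        _ ≤ _ := by gcongr; exact h5.trans h6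
    · have h1 : (2 : ℝ) ≤ (p : ℝ) ^ δ := by
        have h2 : (2 : ℝ) ^ (1 / δ) ≤ p := hN.trans (by exact_mod_cast not_lt.mp h)
        have h3 := Real.rpow_le_rpow (by positivity) h2 hδ.le
        rwa [← Real.rpow_mul (by norm_num), one_div, inv_mul_cancel₀ hδ.ne', Real.rpow_one] at h3
      have h2 : (2 : ℝ) ^ a ≤ ((p : ℝ) ^ δ) ^ a := pow_le_pow_left₀ (by norm_num) h1 a
      have h3 : ((a : ℝ) + 1) ≤ 2 ^ a := by exact_mod_cast Nat.lt_two_pow_self (n := a)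
      linarith
  have hprod : (n : ℝ) ^ δ = ∏ p ∈ n.primeFactors, ((p : ℝ) ^ (n.factorization p)) ^ δ := by
    rw [Real.finsetProd_rpow _ _ (fun i _ => by positivity)]
    congr 1
    conv_lhs => rw [← Nat.prod_factorization_pow_eq_self hn]
    rw [Finsupp.prod, Nat.support_factorization]
    push_cast
    rfl
  rw [Nat.card_divisors hn]
  push_cast
  refine (Finset.prod_le_prod (fun i _ => by positivity) key).trans ?_
  rw [Finset.prod_mul_distrib, ← hprod]
  gcongr
  rw [Finset.prod_ite, Finset.prod_const, Finset.prod_const_one, mul_one]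
  refine pow_le_pow_right₀ hK1 ?_
  calc _ ≤ (Finset.range N).card := Finset.card_le_card (by
        intro p hp
        simpa using (Finset.mem_filter.mp hp).2)
    _ = N := Finset.card_range N

/-- Pairs in the box with prescribed product. -/
noncomputable def pairFibre (H : ℕ) (m : ℤ) : Finset (ℤ × ℤ) :=
  (Finset.Icc (-(H : ℤ)) H ×ˢ Finset.Icc (-(H : ℤ)) H).filter (fun x => x.1 * x.2 = m)

lemma card_box (H : ℕ) : (Finset.Icc (-(H : ℤ)) H).card = 2 * H + 1 := by
  rw [Int.card_Icc]; omega

lemma pairFibre_zero (H : ℕ) : (pairFibre H 0).card ≤ 2 * (2 * H + 1) := by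
  have hsub : pairFibre H 0 ⊆ ({0} ×ˢ Finset.Icc (-(H : ℤ)) H) ∪
      (Finset.Icc (-(H : ℤ)) H ×ˢ {0}) := by
    rintro ⟨b, c⟩ h
    simp only [pairFibre, Finset.mem_filter, Finset.mem_product, mul_eq_zero] at h
    simp only [Finset.mem_union, Finset.mem_product, Finset.mem_singleton]
    tauto
  refine (Finset.card_le_card hsub).trans ((Finset.card_union_le _ _).trans ?_)
  rw [Finset.card_product, Finset.card_product, card_box]
  simp
  omega

lemma pairFibre_ne (H : ℕ) (m : ℤ) (hm : m ≠ 0) :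
    (pairFibre H m).card ≤ 2 * m.natAbs.divisors.card := by
  have h1 : (pairFibre H m).card ≤ (m.natAbs.divisors.image (fun n : ℕ => (n : ℤ)) ∪
      m.natAbs.divisors.image (fun n : ℕ => -(n : ℤ))).card := by
    refine Finset.card_le_card_of_injOn Prod.fst ?_ ?_
    · rintro ⟨b, c⟩ h
      have h := (Finset.mem_filter.mp h).2
      simp only at h
      have hd : b.natAbs ∣ m.natAbs := Int.natAbs_dvd_natAbs.mpr ⟨c, h.symm⟩
      have hmem : b.natAbs ∈ m.natAbs.divisors := Nat.mem_divisors.mpr ⟨hd, by omega⟩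
      rw [Finset.mem_coe, Finset.mem_union, Finset.mem_image, Finset.mem_image]
      rcases Int.natAbs_eq b with hb | hb
      · exact Or.inl ⟨_, hmem, hb.symm⟩
      · exact Or.inr ⟨_, hmem, hb.symm⟩
    · rintro ⟨b, c⟩ h ⟨b', c'⟩ h' hbb
      have h := (Finset.mem_filter.mp h).2
      have h' := (Finset.mem_filter.mp h').2
      simp only at h h' hbb
      subst hbb
      have hb : b ≠ 0 := by rintro rfl; simp at h; exact hm h.symm
      rw [mul_left_cancel₀ hb (h.trans h'.symm)]
  refine h1.trans ((Finset.card_union_le _ _).trans ?_)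
  have := Finset.card_image_le (s := m.natAbs.divisors) (f := fun n : ℕ => (n : ℤ))
  have := Finset.card_image_le (s := m.natAbs.divisors) (f := fun n : ℕ => -(n : ℤ))
  omega

lemma pairFibre_bound (δ C : ℝ) (hδ : 0 < δ) (hC : 1 ≤ C)
    (hdiv : ∀ n : ℕ, n ≠ 0 → (n.divisors.card : ℝ) ≤ C * (n : ℝ) ^ δ) (H : ℕ) (m : ℤ)
    (hm : m ≠ 0) : ((pairFibre H m).card : ℝ) ≤ 2 * (C * ((H : ℝ) ^ 2) ^ δ) := by
  rcases (pairFibre H m).eq_empty_or_nonempty with he | ⟨⟨b, c⟩, hbc⟩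
  · rw [he]; simp; positivity
  · have hle : m.natAbs ≤ H ^ 2 := by
      simp only [pairFibre, Finset.mem_filter, Finset.mem_product, Finset.mem_Icc] at hbc
      obtain ⟨⟨hb, hc⟩, rfl⟩ := hbc
      rw [Int.natAbs_mul, sq]
      exact Nat.mul_le_mul (by omega) (by omega)
    have h1 : ((pairFibre H m).card : ℝ) ≤ 2 * (m.natAbs.divisors.card : ℝ) := by
      exact_mod_cast pairFibre_ne H m hm
    refine h1.trans ?_
    gcongr
    refine (hdiv _ (by omega)).trans ?_
    gcongr
    exact_mod_cast hle

lemma count_bound (δ C : ℝ) (hδ : 0 < δ) (hC : 1 ≤ C)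
    (hdiv : ∀ n : ℕ, n ≠ 0 → (n.divisors.card : ℝ) ≤ C * (n : ℝ) ^ δ) (H : ℕ)
    (f : Polynomial ℤ) :
    (Set.ncard {A : Matrix (Fin 2) (Fin 2) ℤ | (∀ i j, |A i j| ≤ (H : ℤ)) ∧
        A.charpoly = f} : ℝ) ≤
      (2 * H + 1) * (2 * (C * ((H : ℝ) ^ 2) ^ δ)) + 2 * (2 * (2 * H + 1)) := by
  set t : ℤ := -f.coeff 1 with ht
  set D : ℤ := f.coeff 0 with hD
  set m : ℤ → ℤ := fun a => a * (t - a) - D with hmdef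
  set T : Finset (Σ _ : ℤ, ℤ × ℤ) :=
    (Finset.Icc (-(H : ℤ)) H).sigma (fun a => pairFibre H (m a)) with hT
  have htd : ∀ A : Matrix (Fin 2) (Fin 2) ℤ, A.charpoly = f →
      A 0 0 + A 1 1 = t ∧ A 0 0 * A 1 1 - A 0 1 * A 1 0 = D := by
    intro A hA
    rw [Matrix.charpoly_fin_two] at hA
    rw [ht, hD, ← hA, ← Matrix.trace_fin_two, ← Matrix.det_fin_two]
    constructor <;> simp [coeff_X, coeff_C, coeff_X_pow, -eq_intCast]
  have h1 : Set.ncard {A : Matrix (Fin 2) (Fin 2) ℤ | (∀ i j, |A i j| ≤ (H : ℤ)) ∧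
        A.charpoly = f} ≤ T.card := by
    rw [← Set.ncard_coe_finset]
    refine Set.ncard_le_ncard_of_injOn (fun A => ⟨A 0 0, (A 0 1, A 1 0)⟩) ?_ ?_ T.finite_toSet
    · rintro A ⟨hb, hA⟩
      obtain ⟨h2, h3⟩ := htd A hA
      simp only [hT, pairFibre, Finset.mem_coe, Finset.mem_sigma, Finset.mem_filter,
        Finset.mem_product, Finset.mem_Icc, hmdef]
      refine ⟨abs_le.mp (hb 0 0), ⟨abs_le.mp (hb 0 1), abs_le.mp (hb 1 0)⟩, ?_⟩
      rw [← h2, ← h3]; ring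
    · rintro A ⟨_, hA⟩ B ⟨_, hB⟩ hAB
      obtain ⟨h2, _⟩ := htd A hA
      obtain ⟨h4, _⟩ := htd B hB
      simp only [Sigma.mk.injEq, heq_eq_eq, Prod.mk.injEq] at hAB
      obtain ⟨h00, h01, h10⟩ := hAB
      ext i j
      fin_cases i <;> fin_cases j <;> simp <;> omega
  set M : ℝ := 2 * (C * ((H : ℝ) ^ 2) ^ δ) with hM
  have hM0 : 0 ≤ M := by positivity
  have hz : ((Finset.Icc (-(H : ℤ)) H).filter (fun a => m a = 0)).card ≤ 2 := by
    rcases ((Finset.Icc (-(H : ℤ)) H).filter (fun a => m a = 0)).eq_empty_or_nonempty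
      with he | ⟨a₀, h0⟩
    · rw [he]; simp
    · refine (Finset.card_le_card (t := {a₀, t - a₀}) ?_).trans Finset.card_le_two
      intro a ha
      have h0 := (Finset.mem_filter.mp h0).2
      have ha := (Finset.mem_filter.mp ha).2
      simp only [hmdef] at h0 ha
      have : (a - a₀) * (a - (t - a₀)) = 0 := by linarith
      rcases mul_eq_zero.mp this with h | h
      · simp [sub_eq_zero.mp h]
      · simp [sub_eq_zero.mp h]
  have hz' : (((Finset.Icc (-(H : ℤ)) H).filter (fun a => m a = 0)).card : ℝ) ≤ 2 := by
    exact_mod_cast hz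
  calc _ ≤ (T.card : ℝ) := by exact_mod_cast h1
    _ = ∑ a ∈ Finset.Icc (-(H : ℤ)) H, ((pairFibre H (m a)).card : ℝ) := by
      rw [hT, Finset.card_sigma]; push_cast; rfl
    _ ≤ ∑ a ∈ Finset.Icc (-(H : ℤ)) H,
        (M + if m a = 0 then (2 * (2 * (H : ℝ) + 1)) else 0) := by
      refine Finset.sum_le_sum fun a _ => ?_
      split_ifs with h
      · rw [h]
        have : ((pairFibre H 0).card : ℝ) ≤ 2 * (2 * (H : ℝ) + 1) := by
          exact_mod_cast pairFibre_zero H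
        linarith
      · rw [add_zero]
        exact pairFibre_bound δ C hδ hC hdiv H _ h
    _ ≤ _ := by
      rw [Finset.sum_add_distrib, Finset.sum_const, ← Finset.sum_filter, Finset.sum_const,
        card_box, nsmul_eq_mul, nsmul_eq_mul]
      push_cast
      gcongr

/-- Lemma 2.1: uniformly over polynomials `f ∈ ℤ[X]` of degree 2, the number of matrices
`A ∈ M_2(ℤ;H)` with characteristic polynomial `f` is at most `H^(1+ε)` for `H` large. -/
theorem char_poly_fibre_count_two : ∀ ε : ℝ, 0 < ε → ∃ H₀ : ℕ, ∀ H : ℕ, H₀ ≤ H →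
    ∀ f : Polynomial ℤ, f.degree = 2 →
      (Set.ncard {A : Matrix (Fin 2) (Fin 2) ℤ | (∀ i j, |A i j| ≤ (H : ℤ)) ∧
        A.charpoly = f} : ℝ) ≤ (H : ℝ) ^ ((1 : ℝ) + ε) := by
  intro ε hε
  obtain ⟨C, hC, hdiv⟩ := divisor_bound (ε / 4) (by positivity)
  have htend := (tendsto_rpow_atTop (show 0 < ε / 2 by positivity)).comp
    (tendsto_natCast_atTop_atTop (R := ℝ))
  obtain ⟨H₁, hH₁⟩ := Filter.eventually_atTop.mp
    (htend.eventually_ge_atTop (3 * (2 * C + 4)))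
  refine ⟨max H₁ 1, fun H hH f _ => ?_⟩
  have hbig : 3 * (2 * C + 4) ≤ (H : ℝ) ^ (ε / 2) := hH₁ H (le_trans (le_max_left _ _) hH)
  have hH1 : (1 : ℝ) ≤ H := by exact_mod_cast le_trans (le_max_right _ _) hH
  have hpos : (0 : ℝ) < H := by linarith
  refine (count_bound (ε / 4) C (by positivity) hC hdiv H f).trans ?_
  have hsq : ((H : ℝ) ^ 2) ^ (ε / 4) = (H : ℝ) ^ (ε / 2) := by
    rw [← Real.rpow_natCast, ← Real.rpow_mul hpos.le]
    congr 1
    push_cast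
    ring
  have hsplit : (H : ℝ) ^ (1 + ε) = H * ((H : ℝ) ^ (ε / 2) * (H : ℝ) ^ (ε / 2)) := by
    rw [← Real.rpow_add hpos, Real.rpow_add hpos, Real.rpow_one, add_halves]
  rw [hsq, hsplit]
  generalize (H : ℝ) ^ (ε / 2) = y at hbig
  have hy : 1 ≤ y := by linarith
  calc (2 * (H : ℝ) + 1) * (2 * (C * y)) + 2 * (2 * (2 * H + 1))
      = (2 * (H : ℝ) + 1) * (2 * C * y + 4) := by ring
    _ ≤ (3 * H) * ((2 * C + 4) * y) := by
      gcongr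
      · linarith
      · linarith
    _ = H * (3 * (2 * C + 4) * y) := by ring
    _ ≤ H * (y * y) := by gcongr
end

section
/- Fix an integer n ≥ 1. For every ε > 0 there exists p₀ such that for every prime p ≥ p₀ and every monic polynomial f ∈ 𝔽_p[X] of degree n, the number P_{n,p}(f) of n×n matrices over 𝔽_p with characteristic polynomial f satisfies |P_{n,p}(f) − p^(n² − n)| ≤ ε · p^(n² − n). -/
open Matrix Polynomial

namespace FibreCount

/-- The first `k` columns of `A` are the shifted standard basis vectors. -/
def IsShift {F : Type} [Field F] {n : ℕ} (k : ℕ) (A : Matrix (Fin n) (Fin n) F) : Prop :=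
  ∀ i j : Fin n, j.val < k → A i j = if i.val = j.val + 1 then 1 else 0

variable {F : Type} [Field F]

lemma shift_pow {k : ℕ} {A : Matrix (Fin (k+1)) (Fin (k+1)) F} (hA : IsShift k A) (i : ℕ)
    (hi : i < k + 1) : (A ^ i) *ᵥ (Pi.single 0 1) = Pi.single ⟨i, hi⟩ 1 := by
  induction i with
  | zero => rw [pow_zero, Matrix.one_mulVec]; rfl
  | succ i ih =>
    rw [pow_succ', ← Matrix.mulVec_mulVec, ih (by omega)]
    ext r
    rw [Matrix.mulVec_single_one, Matrix.col_apply, hA _ _ (by simpa using hi)]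
    simp [Pi.single_apply, Fin.ext_iff]

lemma comp_last {k : ℕ} {A : Matrix (Fin (k+1)) (Fin (k+1)) F} (hA : IsShift k A)
    (i : Fin (k+1)) : A i (Fin.last k) = - A.charpoly.coeff i := by
  have h := Matrix.aeval_self_charpoly A
  have hd : A.charpoly.natDegree = k + 1 := by simp [Matrix.charpoly_natDegree_eq_dim]
  have hm := (Matrix.charpoly_monic A).coeff_natDegree
  rw [hd] at hm
  rw [Polynomial.aeval_eq_sum_range, hd, Finset.sum_range_succ, hm, one_smul] at h
  have h2 := congrFun (congrArg (fun M => M *ᵥ (Pi.single 0 1 : Fin (k+1) → F)) h) i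
  beta_reduce at h2
  rw [Matrix.add_mulVec, Pi.add_apply, Matrix.zero_mulVec, Pi.zero_apply] at h2
  rw [pow_succ', ← Matrix.mulVec_mulVec, shift_pow hA k (by omega),
    Matrix.sum_mulVec, Finset.sum_apply] at h2
  have h3 : ∑ c ∈ Finset.range (k+1),
      ((A.charpoly.coeff c • A ^ c) *ᵥ (Pi.single 0 1)) i = A.charpoly.coeff i := by
    rw [Finset.sum_eq_single_of_mem i.val (Finset.mem_range.2 i.2)]
    · rw [Matrix.smul_mulVec, shift_pow hA _ i.2]; simp
    · intro b hb hne
      rw [Matrix.smul_mulVec, shift_pow hA _ (Finset.mem_range.1 hb)]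
      simp only [Pi.smul_apply, Pi.single_apply, Fin.ext_iff, smul_eq_mul]
      rw [if_neg (Ne.symm hne), mul_zero]
  rw [h3, Matrix.mulVec_single_one] at h2
  simp only [Matrix.col_apply] at h2
  exact eq_neg_of_add_eq_zero_right h2

lemma comp_unique {k : ℕ} {A B : Matrix (Fin (k+1)) (Fin (k+1)) F} (hA : IsShift k A)
    (hB : IsShift k B) (h : A.charpoly = B.charpoly) : A = B := by
  ext i j
  by_cases hj : j.val < k
  · rw [hA i j hj, hB i j hj]
  · obtain rfl : j = Fin.last k := by ext; simp; omega
    rw [comp_last hA, comp_last hB, h]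

lemma comp_exists {k : ℕ} {f : F[X]} (hf : f.Monic) (hd : f.natDegree = k + 1) :
    ∃ A : Matrix (Fin (k+1)) (Fin (k+1)) F, IsShift k A ∧ A.charpoly = f := by
  have key : ∀ pb : PowerBasis F (AdjoinRoot f), pb.dim = k + 1 → minpoly F pb.gen = f →
      ∃ A : Matrix (Fin (k+1)) (Fin (k+1)) F, IsShift k A ∧ A.charpoly = f := by
    rintro ⟨g, d, b, hb⟩ h1 h2
    simp only at h1 h2
    subst h1
    refine ⟨_, ?_, (charpoly_leftMulMatrix (⟨g, k+1, b, hb⟩ : PowerBasis F (AdjoinRoot f))).trans h2⟩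
    intro i j hj
    rw [PowerBasis.leftMulMatrix]
    have : j.val + 1 ≠ k + 1 := by omega
    simp [eq_comm]
    omega
  exact key (AdjoinRoot.powerBasis hf.ne_zero) (by simp [hd]) (AdjoinRoot.minpoly_powerBasis_gen_of_monic hf)

lemma card_divisors {f : F[X]} {n : ℕ} (hf : f.Monic) (hd : f.natDegree = n) :
    ∃ t : Finset F[X], t.card ≤ 2 ^ n ∧ ∀ g : F[X], g.Monic → g ∣ f → g ∈ t := by
  classical
  refine ⟨((UniqueFactorizationMonoid.normalizedFactors f).powerset.map Multiset.prod).toFinset,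
    ?_, ?_⟩
  · refine (Multiset.toFinset_card_le _).trans ?_
    rw [Multiset.card_map, Multiset.card_powerset]
    refine Nat.pow_le_pow_right (by norm_num) ?_
    have h1 : (UniqueFactorizationMonoid.normalizedFactors f).prod = f := by
      rw [UniqueFactorizationMonoid.prod_normalizedFactors_eq hf.ne_zero, hf.normalize_eq_self]
    have h2 := Polynomial.natDegree_multiset_prod (UniqueFactorizationMonoid.normalizedFactors f)
      (UniqueFactorizationMonoid.zero_notMem_normalizedFactors f)
    rw [h1, hd] at h2
    rw [h2]
    have := Multiset.card_nsmul_le_sum (s := (UniqueFactorizationMonoid.normalizedFactors f).map natDegree) (a := 1) ?_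
    · simpa using this
    · intro x hx
      obtain ⟨y, hy, rfl⟩ := Multiset.mem_map.1 hx
      exact (UniqueFactorizationMonoid.irreducible_of_normalized_factor y hy).natDegree_pos
  · intro g hg hgf
    rw [Multiset.mem_toFinset, Multiset.mem_map]
    refine ⟨UniqueFactorizationMonoid.normalizedFactors g, ?_, ?_⟩
    · rw [Multiset.mem_powerset]
      exact (UniqueFactorizationMonoid.dvd_iff_normalizedFactors_le_normalizedFactors hg.ne_zero
        hf.ne_zero).1 hgf
    · rw [UniqueFactorizationMonoid.prod_normalizedFactors_eq hg.ne_zero, hg.normalize_eq_self]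

/-- Conjugating matrix. -/
lemma exists_conj {n k : ℕ} (hk : k + 1 < n) (w : Fin n → F) (hw : ∃ j : Fin n, k < j.val ∧ w j ≠ 0) :
    ∃ P : (Matrix (Fin n) (Fin n) F)ˣ, (∀ i : Fin n, i.val ≤ k → P.val *ᵥ Pi.single i 1 = Pi.single i 1)
      ∧ P.val *ᵥ Pi.single ⟨k+1, hk⟩ 1 = w := by
  obtain ⟨j, hj, hwj⟩ := hw
  let σ : Equiv.Perm (Fin n) := Equiv.swap ⟨k+1, hk⟩ j
  let T : Matrix (Fin n) (Fin n) F := (1 : Matrix (Fin n) (Fin n) F).updateCol j w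
  have hT : T.det = w j := by
    have := congrFun (congrArg (fun l => l w) (Matrix.cramer_one (n := Fin n) (α := F))) j
    beta_reduce at this
    rw [Matrix.cramer_apply] at this
    exact this
  let Q : Matrix (Fin n) (Fin n) F := T.submatrix id σ
  have hQ : IsUnit Q := by
    rw [Matrix.isUnit_iff_isUnit_det]
    have : Q.det = _ := Matrix.det_permute' σ T
    rw [this, hT]
    refine IsUnit.mul ?_ (isUnit_iff_ne_zero.2 hwj)
    exact (Units.isUnit (Equiv.Perm.sign σ)).map (Int.castRingHom F)
  obtain ⟨P, hP⟩ := hQ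
  refine ⟨P, ?_, ?_⟩
  · intro i hi
    rw [hP, Matrix.mulVec_single_one]
    ext r
    have h1 : i ≠ ⟨k+1, hk⟩ := by intro h; rw [h] at hi; simp at hi
    have h2 : i ≠ j := by rintro rfl; omega
    have hs : σ i = i := Equiv.swap_apply_of_ne_of_ne h1 h2
    simp [Q, T, hs, h2, Pi.single_apply, Matrix.one_apply]
  · rw [hP, Matrix.mulVec_single_one]
    ext r
    simp [Q, T, σ]


lemma isShift_iff {n k : ℕ} (hk : k < n) (A : Matrix (Fin n) (Fin n) F) :
    IsShift k A ↔ ∀ i (hi : i < k), A *ᵥ Pi.single ⟨i, by omega⟩ 1 =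
      Pi.single (⟨i+1, by omega⟩ : Fin n) (1 : F) := by
  constructor
  · intro h i hi
    ext r
    rw [Matrix.mulVec_single_one, Matrix.col_apply, h _ _ (by simpa using hi)]
    simp [Pi.single_apply, Fin.ext_iff]
  · intro h r j hj
    have := congrFun (h j.val hj) r
    rw [Matrix.mulVec_single_one, Matrix.col_apply] at this
    simpa [Pi.single_apply, Fin.ext_iff] using this

variable [Fintype F]

open Classical in
/-- Matrices with characteristic polynomial `f` with first `k` columns shifted. -/
noncomputable def S (n k : ℕ) (f : F[X]) : Finset (Matrix (Fin n) (Fin n) F) :=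
  Finset.univ.filter (fun A => A.charpoly = f ∧ IsShift k A)

lemma mem_S {n k : ℕ} {f : F[X]} {A : Matrix (Fin n) (Fin n) F} :
    A ∈ S n k f ↔ A.charpoly = f ∧ IsShift k A := by
  simp [S]

open Classical in
lemma card_fibre {n k : ℕ} (hk : k + 1 < n) (f : F[X]) (w : Fin n → F)
    (hw : ∃ j : Fin n, k < j.val ∧ w j ≠ 0) :
    ((S n k f).filter (fun A => A *ᵥ Pi.single ⟨k, by omega⟩ 1 = w)).card
      = (S n (k+1) f).card := by
  obtain ⟨P, hP, hPw⟩ := exists_conj hk w hw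
  have hPi : ∀ i : Fin n, i.val ≤ k → P⁻¹.val *ᵥ Pi.single i 1 = Pi.single i 1 := by
    intro i hi
    conv_lhs => rw [← hP i hi]
    rw [Matrix.mulVec_mulVec, Units.inv_mul, Matrix.one_mulVec]
  have hPwi : P⁻¹.val *ᵥ w = Pi.single ⟨k+1, hk⟩ 1 := by
    rw [← hPw, Matrix.mulVec_mulVec, Units.inv_mul, Matrix.one_mulVec]
  refine Finset.card_bij' (fun A _ => P⁻¹.val * A * P.val) (fun A _ => P.val * A * P⁻¹.val)
    ?_ ?_ ?_ ?_
  · intro A hA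
    rw [Finset.mem_filter, mem_S, isShift_iff (by omega)] at hA
    obtain ⟨⟨h1, h2⟩, h3⟩ := hA
    rw [mem_S, isShift_iff hk]
    refine ⟨by rw [Matrix.coe_units_inv, Matrix.charpoly_units_conj', h1], ?_⟩
    intro i hi
    rw [← Matrix.mulVec_mulVec, hP _ (by simp; omega), ← Matrix.mulVec_mulVec]
    rcases Nat.lt_succ_iff_lt_or_eq.1 hi with h | rfl
    · rw [h2 i h, hPi _ (by simp; omega)]
    · rw [h3, hPwi]
  · intro A hA
    rw [mem_S, isShift_iff (by omega)] at hA
    obtain ⟨h1, h2⟩ := hA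
    rw [Finset.mem_filter, mem_S, isShift_iff (by omega)]
    refine ⟨⟨by rw [Matrix.coe_units_inv, Matrix.charpoly_units_conj, h1], ?_⟩, ?_⟩
    · intro i hi
      rw [← Matrix.mulVec_mulVec, hPi _ (by simp; omega), ← Matrix.mulVec_mulVec, h2 i (by omega),
        hP _ (by simp; omega)]
    · rw [← Matrix.mulVec_mulVec, hPi _ (by simp), ← Matrix.mulVec_mulVec, h2 k (by omega), hPw]
  · intro A _
    simp [mul_assoc]
  · intro A _
    simp [mul_assoc]

open Classical in
/-- Block upper triangular part. -/
noncomputable def E (n k : ℕ) (f : F[X]) : Finset (Matrix (Fin n) (Fin n) F) :=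
  (S n k f).filter (fun A => ∀ i j : Fin n, j.val = k → k < i.val → A i j = 0)

lemma card_rec {n k : ℕ} (hk : k + 1 < n) (f : F[X]) :
    ∃ δ : ℕ, δ ≤ Fintype.card F ^ (k+1) ∧
    (S n k f).card + δ * (S n (k+1) f).card =
      Fintype.card F ^ n * (S n (k+1) f).card + (E n k f).card := by
  classical
  let W0 : Finset (Fin n → F) := Finset.univ.filter (fun w => ∀ i : Fin n, k < i.val → w i = 0)
  let W1 : Finset (Fin n → F) := Finset.univ.filter (fun w => ¬ ∀ i : Fin n, k < i.val → w i = 0)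
  have hW : W0.card + W1.card = Fintype.card F ^ n := by
    rw [Finset.card_filter_add_card_filter_not]; simp
  refine ⟨W0.card, ?_, ?_⟩
  · have : W0.card ≤ (Finset.univ : Finset (Fin (k+1) → F)).card := by
      refine Finset.card_le_card_of_injOn (fun w i => w ⟨i.val, by omega⟩) (by simp) ?_
      intro a ha b hb hab
      have ha' := (Finset.mem_filter.1 ha).2
      have hb' := (Finset.mem_filter.1 hb).2
      ext i
      by_cases hi : k < i.val
      · rw [ha' i hi, hb' i hi]
      · exact congrFun hab ⟨i.val, by omega⟩
    simpa using this
  · have h1 : (S n k f).card = (E n k f).card +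
        ((S n k f).filter (fun A => ¬ ∀ i j : Fin n, j.val = k → k < i.val → A i j = 0)).card :=
      (Finset.card_filter_add_card_filter_not _).symm
    have h2 : ((S n k f).filter (fun A => ¬ ∀ i j : Fin n, j.val = k → k < i.val → A i j = 0)).card
        = W1.card * (S n (k+1) f).card := by
      have hiff : ∀ A : Matrix (Fin n) (Fin n) F,
          (∀ i j : Fin n, j.val = k → k < i.val → A i j = 0) ↔
          (∀ i : Fin n, k < i.val → (A *ᵥ Pi.single ⟨k, by omega⟩ 1) i = 0) := by
        intro A
        simp only [Matrix.mulVec_single_one, Matrix.col_apply]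
        constructor
        · intro h i hi
          exact h i _ rfl hi
        · intro h i j hj hi
          have hj' : j = ⟨k, by omega⟩ := Fin.ext hj
          rw [hj']
          exact h i hi
      rw [Finset.card_eq_sum_card_fiberwise (f := fun A => A *ᵥ Pi.single ⟨k, by omega⟩ 1) (t := W1)]
      · rw [Finset.sum_const_nat]
        intro w hw
        have hw' := (Finset.mem_filter.1 hw).2
        rw [← card_fibre hk f w (by push Not at hw'; exact hw')]
        congr 1
        ext A
        simp only [Finset.mem_filter]
        constructor
        · rintro ⟨⟨h1, -⟩, h3⟩; exact ⟨h1, h3⟩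
        · rintro ⟨h1, h3⟩
          refine ⟨⟨h1, ?_⟩, h3⟩
          rw [hiff, h3]; exact hw'
      · intro A hA
        have hA' := (Finset.mem_filter.1 hA).2
        rw [hiff] at hA'
        exact Finset.mem_filter.2 ⟨Finset.mem_univ _, hA'⟩
    rw [h1, h2, ← hW]; ring

lemma card_E {k m : ℕ} {f : F[X]} (hf : f.Monic) (hd : f.natDegree = k + 1 + m) (B : ℕ)
    (hB : ∀ h : F[X], h.Monic → h.natDegree = m → (S m 0 h).card ≤ B) :
    (E (k+1+m) k f).card ≤ (Fintype.card F ^ ((k+1)*m) * B) * 2 ^ (k+1+m) := by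
  classical
  obtain ⟨t, ht, ht'⟩ := card_divisors hf hd
  let e : Fin (k+1) ⊕ Fin m ≃ Fin (k+1+m) := finSumFinEquiv
  let b11 : Matrix (Fin (k+1+m)) (Fin (k+1+m)) F → Matrix (Fin (k+1)) (Fin (k+1)) F :=
    fun A => A.submatrix (Fin.castAdd m) (Fin.castAdd m)
  let b12 : Matrix (Fin (k+1+m)) (Fin (k+1+m)) F → Matrix (Fin (k+1)) (Fin m) F :=
    fun A => A.submatrix (Fin.castAdd m) (Fin.natAdd (k+1))
  let b22 : Matrix (Fin (k+1+m)) (Fin (k+1+m)) F → Matrix (Fin m) (Fin m) F :=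
    fun A => A.submatrix (Fin.natAdd (k+1)) (Fin.natAdd (k+1))
  have hE : ∀ A ∈ E (k+1+m) k f, A.submatrix e e = Matrix.fromBlocks (b11 A) (b12 A) 0 (b22 A)
      ∧ (b11 A).charpoly * (b22 A).charpoly = f ∧ IsShift k (b11 A) := by
    intro A hA
    rw [E, Finset.mem_filter, mem_S] at hA
    obtain ⟨⟨h1, h2⟩, h3⟩ := hA
    have hbl : A.submatrix e e = Matrix.fromBlocks (b11 A) (b12 A) 0 (b22 A) := by
      ext i j
      rcases i with i | i <;> rcases j with j | j
      · simp [e, b11]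
      · simp [e, b12]
      · simp only [e, Matrix.submatrix_apply, finSumFinEquiv_apply_left, finSumFinEquiv_apply_right,
          Matrix.fromBlocks_apply₂₁, Matrix.zero_apply]
        by_cases hj : j.val = k
        · exact h3 _ _ (by simpa using hj) (by simp; omega)
        · rw [h2 _ _ (by simp; omega), if_neg]
          simp; omega
      · simp [e, b22]
    refine ⟨hbl, ?_, ?_⟩
    · rw [← Matrix.charpoly_fromBlocks_zero₂₁, ← hbl, ← h1]
      exact Matrix.charpoly_reindex e.symm A
    · intro i j hj
      have := h2 (Fin.castAdd m i) (Fin.castAdd m j) (by simpa using hj)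
      simpa [b11] using this
  refine (Finset.card_le_mul_card_image_of_maps_to (f := fun A => (b11 A).charpoly) (t := t) ?_
    (Fintype.card F ^ ((k+1)*m) * B) ?_).trans (Nat.mul_le_mul_left _ ht)
  · intro A hA
    exact ht' _ (Matrix.charpoly_monic _) ⟨_, (hE A hA).2.1.symm⟩
  · intro g hg
    by_cases hne : ∃ A0 ∈ E (k+1+m) k f, (b11 A0).charpoly = g
    · obtain ⟨A0, hA0, hg0⟩ := hne
      let h := (b22 A0).charpoly
      have hh : (S m 0 h).card ≤ B := hB h (Matrix.charpoly_monic _)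
        (by simp [h, Matrix.charpoly_natDegree_eq_dim])
      have hcard : ((Finset.univ : Finset (Matrix (Fin (k+1)) (Fin m) F)) ×ˢ S m 0 h).card
          ≤ Fintype.card F ^ ((k+1)*m) * B := by
        rw [Finset.card_product]
        refine Nat.mul_le_mul (le_of_eq ?_) hh
        rw [Finset.card_univ, ← Nat.card_eq_fintype_card]
        change Nat.card (Fin (k+1) → Fin m → F) = _
        rw [Nat.card_eq_fintype_card, Fintype.card_fun, Fintype.card_fun, Fintype.card_fin,
          Fintype.card_fin, ← pow_mul, mul_comm]
      refine le_trans (Finset.card_le_card_of_injOn (fun A => (b12 A, b22 A)) ?_ ?_) hcard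
      · intro A hA
        obtain ⟨hA1, hA2⟩ := Finset.mem_filter.1 hA
        simp only [Finset.coe_product, Set.mem_prod, Finset.coe_univ, Set.mem_univ, true_and,
          Finset.mem_coe]
        rw [mem_S]
        refine ⟨?_, fun i j hj => absurd hj (Nat.not_lt_zero _)⟩
        have e1 := (hE A hA1).2.1
        have e2 := (hE A0 hA0).2.1
        rw [hA2] at e1
        rw [hg0] at e2
        have hg1 : g ≠ 0 := by rw [← hg0]; exact (Matrix.charpoly_monic _).ne_zero
        exact mul_left_cancel₀ hg1 (e1.trans e2.symm)
      · intro A hA A' hA' heq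
        obtain ⟨hA1, hA2⟩ := Finset.mem_filter.1 hA
        obtain ⟨hA1', hA2'⟩ := Finset.mem_filter.1 hA'
        obtain ⟨q1, q2⟩ := Prod.mk.inj heq
        have q0 : b11 A = b11 A' := comp_unique (hE A hA1).2.2 (hE A' hA1').2.2 (hA2.trans hA2'.symm)
        have hs : A.submatrix e e = A'.submatrix e e := by
          rw [(hE A hA1).1, (hE A' hA1').1, q0, q1, q2]
        exact (Matrix.reindex e.symm e.symm).injective hs
    · rw [Finset.filter_eq_empty_iff.2]
      · simp
      · intro A hA hAg
        exact hne ⟨A, hA, hAg⟩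

lemma card_S_last {k : ℕ} {f : F[X]} (hf : f.Monic) (hd : f.natDegree = k + 1) :
    (S (k+1) k f).card = 1 := by
  obtain ⟨A, hA, hA'⟩ := comp_exists hf hd
  rw [Finset.card_eq_one]
  refine ⟨A, ?_⟩
  ext B
  rw [mem_S, Finset.mem_singleton]
  constructor
  · rintro ⟨h1, h2⟩
    exact comp_unique h2 hA (h1.trans hA'.symm)
  · rintro rfl
    exact ⟨hA', hA⟩

end FibreCount

open FibreCount in
/-- Quantitative form. -/
lemma FibreCount.main (n : ℕ) (hn : 1 ≤ n) : ∃ C : ℝ, 0 ≤ C ∧ ∀ (F : Type) [Field F] [Fintype F]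
    (f : F[X]), f.Monic → f.natDegree = n →
    (Fintype.card F : ℝ) * |((S n 0 f).card : ℝ) - (Fintype.card F : ℝ) ^ (n^2 - n)| ≤
      C * (Fintype.card F : ℝ) ^ (n^2 - n) := by
  induction n using Nat.strong_induction_on with
  | _ n ih =>
  have key : ∀ j k : ℕ, n = k + 1 + j → ∃ C : ℝ, 0 ≤ C ∧ ∀ (F : Type) [Field F] [Fintype F]
    (f : F[X]), f.Monic → f.natDegree = n →
    (Fintype.card F : ℝ) * |((S n k f).card : ℝ) - (Fintype.card F : ℝ) ^ (n * j)| ≤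
      C * (Fintype.card F : ℝ) ^ (n * j) := by
    intro j
    induction j with
    | zero =>
      rintro k rfl
      refine ⟨0, le_rfl, ?_⟩
      intro F _ _ f hf hd
      have := card_S_last (k := k) hf hd
      simp only [add_zero, this]
      simp
    | succ j ihj =>
      intro k hk
      obtain ⟨C, hC, hC'⟩ := ihj (k+1) (by omega)
      obtain ⟨D, hD, hD'⟩ := ih (j+1) (by omega) (by omega)
      refine ⟨C + (1 + C) + (D + 2) * 2 ^ n, by positivity, ?_⟩
      intro F _ _ f hf hd
      obtain ⟨δ, hδ, hrec⟩ := card_rec (n := n) (k := k) (by omega) f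
      specialize hC' F f hf hd
      have hq1 : (1 : ℝ) ≤ Fintype.card F := by exact_mod_cast Fintype.card_pos
      have hEb : ((E n k f).card : ℝ) ≤ (D + 2) * 2 ^ n * (Fintype.card F : ℝ) ^ ((n-1)*(j+1)) := by
        have hcE := card_E (k := k) (m := j+1) hf (by omega)
          ⌊(D + 2) * (Fintype.card F : ℝ) ^ ((j+1)^2 - (j+1))⌋₊ (by
            intro h hh hhd
            refine Nat.le_floor ?_
            have h1 := hD' F h hh hhd
            have h2 := le_abs_self (((S (j+1) 0 h).card : ℝ) - (Fintype.card F : ℝ) ^ ((j+1)^2 - (j+1)))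
            have h3 := abs_nonneg (((S (j+1) 0 h).card : ℝ) - (Fintype.card F : ℝ) ^ ((j+1)^2 - (j+1)))
            have h4 : (0:ℝ) ≤ (Fintype.card F : ℝ) ^ ((j+1)^2 - (j+1)) := by positivity
            nlinarith)
        rw [← hk] at hcE
        have hfl := Nat.floor_le (show (0:ℝ) ≤ (D + 2) * (Fintype.card F : ℝ) ^ ((j+1)^2 - (j+1)) by positivity)
        have hcE' : ((E n k f).card : ℝ) ≤ ((Fintype.card F : ℝ) ^ ((k+1)*(j+1)) *
          (⌊(D + 2) * (Fintype.card F : ℝ) ^ ((j+1)^2 - (j+1))⌋₊ : ℝ)) * 2 ^ n := by exact_mod_cast hcE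
        have hexp : (n-1)*(j+1) = (k+1)*(j+1) + ((j+1)^2 - (j+1)) := by
          have e1 : (j+1)^2 - (j+1) = j * (j+1) := by
            rw [Nat.sub_eq_iff_eq_add (by nlinarith)]; ring
          rw [e1, show n - 1 = k + 1 + j by omega]; ring
        refine hcE'.trans ?_
        rw [hexp, pow_add]
        calc _ ≤ ((Fintype.card F : ℝ) ^ ((k+1)*(j+1)) * ((D + 2) * (Fintype.card F : ℝ) ^ ((j+1)^2 - (j+1)))) * 2 ^ n := by
              gcongr
          _ = _ := by ring
      have hrec' : ((S n k f).card : ℝ) + δ * (S n (k+1) f).card =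
        (Fintype.card F : ℝ) ^ n * (S n (k+1) f).card + (E n k f).card := by exact_mod_cast hrec
      have hδ' : (δ : ℝ) * Fintype.card F ≤ (Fintype.card F : ℝ) ^ n := by
        calc (δ : ℝ) * Fintype.card F ≤ (Fintype.card F : ℝ) ^ (k+1) * Fintype.card F := by
              gcongr; exact_mod_cast hδ
          _ = (Fintype.card F : ℝ) ^ (k+2) := by ring
          _ ≤ _ := pow_le_pow_right₀ hq1 (by omega)
      have hEq : (Fintype.card F : ℝ) * (E n k f).card ≤ (D + 2) * 2 ^ n * (Fintype.card F : ℝ) ^ (n * (j+1)) := by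
        calc _ ≤ (Fintype.card F : ℝ) * ((D + 2) * 2 ^ n * (Fintype.card F : ℝ) ^ ((n-1)*(j+1))) := by gcongr
          _ = (D + 2) * 2 ^ n * (Fintype.card F : ℝ) ^ ((n-1)*(j+1) + 1) := by ring
          _ ≤ _ := by
            gcongr
            obtain ⟨n', rfl⟩ : ∃ n', n = n' + 1 := ⟨n - 1, by omega⟩
            simp only [Nat.add_sub_cancel]
            nlinarith
      have hMq : (0 : ℝ) ≤ (S n (k+1) f).card := by positivity
      have hE0 : (0 : ℝ) ≤ (E n k f).card := by positivity
      have hδ0 : (0 : ℝ) ≤ δ := by positivity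
      have hpow : (Fintype.card F : ℝ) ^ (n * (j+1)) = (Fintype.card F : ℝ) ^ n * (Fintype.card F : ℝ) ^ (n * j) := by
        rw [← pow_add]; congr 1; ring
      rw [hpow] at hEq ⊢
      generalize (Fintype.card F : ℝ) = q at *
      generalize ((S n (k+1) f).card : ℝ) = M' at *
      generalize ((S n k f).card : ℝ) = M at *
      generalize ((E n k f).card : ℝ) = e at *
      generalize (δ : ℝ) = d at *
      have hQ0 : 0 ≤ q ^ n := by positivity
      have hR0 : 0 ≤ q ^ (n * j) := by positivity
      generalize q ^ n = Q at *
      generalize q ^ (n * j) = R at *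
      have hM'le : M' ≤ (1 + C) * R := by
        have h2 := le_abs_self (M' - R)
        have h3 := abs_nonneg (M' - R)
        nlinarith
      have hM : M - Q * R = Q * (M' - R) - d * M' + e := by linarith
      have hsplit : |M - Q * R| ≤ Q * |M' - R| + d * M' + e := by
        rw [hM]
        have t1 := abs_add_le (Q * (M' - R) - d * M') e
        have t2 := abs_sub (Q * (M' - R)) (d * M')
        rw [abs_mul, abs_of_nonneg hQ0, abs_of_nonneg (mul_nonneg hδ0 hMq)] at t2
        rw [abs_of_nonneg hE0] at t1
        linarith
      have hq0 : 0 ≤ q := by linarith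
      have s1 : q * |M - Q * R| ≤ q * (Q * |M' - R| + d * M' + e) :=
        mul_le_mul_of_nonneg_left hsplit hq0
      have s2 : Q * (q * |M' - R|) ≤ Q * (C * R) := mul_le_mul_of_nonneg_left hC' hQ0
      have s3 : (d * q) * M' ≤ Q * ((1 + C) * R) := mul_le_mul hδ' hM'le hMq hQ0
      nlinarith
  obtain ⟨C, hC, h⟩ := key (n-1) 0 (by omega)
  refine ⟨C, hC, ?_⟩
  intro F _ _ f hf hd
  have := h F f hf hd
  rwa [show n * (n-1) = n^2 - n by rw [Nat.mul_sub, mul_one, sq]] at this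

/-- Lemma 2.2 (Reiner): for any monic polynomial `f ∈ 𝔽_p[X]` of degree `n`, the number of
`n × n` matrices over `𝔽_p` with characteristic polynomial `f` is `(1+o(1)) p^(n²-n)`
as `p → ∞`. -/
theorem char_poly_fibre_count_finite_field (n : ℕ) (hn : 1 ≤ n) :
    ∀ ε : ℝ, 0 < ε → ∃ p₀ : ℕ, ∀ p : ℕ, p.Prime → p₀ ≤ p →
      ∀ f : Polynomial (ZMod p), f.Monic → f.natDegree = n →
        |(Set.ncard {A : Matrix (Fin n) (Fin n) (ZMod p) | A.charpoly = f} : ℝ) -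
            (p : ℝ) ^ (n ^ 2 - n)| ≤ ε * (p : ℝ) ^ (n ^ 2 - n) := by
  intro ε hε
  obtain ⟨C, hC, h⟩ := FibreCount.main n hn
  refine ⟨⌈C / ε⌉₊, ?_⟩
  intro p hp hpp f hf hd
  have : Fact p.Prime := ⟨hp⟩
  have h1 := h (ZMod p) f hf hd
  rw [ZMod.card] at h1
  have h2 : Set.ncard {A : Matrix (Fin n) (Fin n) (ZMod p) | A.charpoly = f}
      = (FibreCount.S n 0 f).card := by
    rw [← Set.ncard_coe_finset]
    congr 1
    ext A
    rw [Finset.mem_coe, FibreCount.mem_S, Set.mem_ofPred_eq]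
    exact ⟨fun h => ⟨h, fun i j hj => absurd hj (Nat.not_lt_zero _)⟩, fun h => h.1⟩
  rw [h2]
  have hp0 : (0 : ℝ) < p := by exact_mod_cast hp.pos
  have h3 : C ≤ p * ε := by
    have := Nat.ceil_le.1 hpp
    rwa [div_le_iff₀ hε] at this
  have h4 : (0:ℝ) ≤ (p : ℝ) ^ (n ^ 2 - n) := by positivity
  refine le_of_mul_le_mul_left ?_ hp0
  calc _ ≤ _ := h1
    _ ≤ (p * ε) * (p : ℝ) ^ (n ^ 2 - n) := mul_le_mul_of_nonneg_right h3 h4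
    _ = _ := by ring
end

section
/- Fix an integer n ≥ 1. There exists a constant C > 0 (depending only on n) such that for all integers H ≥ 2, all complex n×n matrices K and all complex numbers α, the number J_n(K;H,α) of matrices A in M_n(ℤ;H) with det(A − K) = α satisfies J_n(K;H,α) ≤ C · H^(n² − n) · log H; the bound is uniform in K and α. -/
open Matrix Polynomial

lemma sdf_span {n r : ℕ} (A : Fin n → Fin r → ℤ)
    (h : ∀ u : Fin r → ℤ, (∀ i, ∑ j, u j * A i j = 0) → u = 0) (x : Fin r → ℤ) :
    ∃ t : Fin n → ℚ, ∀ j, (x j : ℚ) = ∑ i, t i * A i j := by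
  set B : Matrix (Fin n) (Fin r) ℚ := Matrix.of fun i j => (A i j : ℚ) with hB
  have hker : LinearMap.ker (Matrix.toLin' B) = ⊥ := by
    rw [LinearMap.ker_eq_bot']
    intro q hq
    obtain ⟨⟨b, hb⟩, hbq⟩ := IsLocalization.exist_integer_multiples_of_finite
      (nonZeroDivisors ℤ) q
    choose u hu using hbq
    have hb0 : (b : ℚ) ≠ 0 := by
      have := nonZeroDivisors.ne_zero hb
      exact_mod_cast this
    have hu' : ∀ j, (u j : ℚ) = b * q j := by
      intro j
      have := hu j
      simpa using this
    have hu0 : u = 0 := by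
      apply h
      intro i
      have h1 : ∑ j, (A i j : ℚ) * q j = 0 := by
        have := congrFun hq i
        simpa [Matrix.toLin'_apply, Matrix.mulVec, dotProduct, hB] using this
      have h2 : ((∑ j, u j * A i j : ℤ) : ℚ) = 0 := by
        push_cast
        calc ∑ j, (u j : ℚ) * A i j = b * ∑ j, (A i j : ℚ) * q j := by
              rw [Finset.mul_sum]; refine Finset.sum_congr rfl fun j _ => ?_
              rw [hu']; ring
          _ = 0 := by rw [h1, mul_zero]
      exact_mod_cast h2
    funext j
    have := hu' j
    rw [hu0] at this
    simp only [Pi.zero_apply, Int.cast_zero] at this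
    rcases mul_eq_zero.1 this.symm with h | h
    · exact absurd h hb0
    · exact h
  obtain ⟨g, hg⟩ := LinearMap.exists_leftInverse_of_injective _ hker
  have hg' : LinearMap.toMatrix' g * B = 1 := by
    have := congrArg LinearMap.toMatrix' hg
    rwa [LinearMap.toMatrix'_comp, LinearMap.toMatrix'_toLin', LinearMap.toMatrix'_id] at this
  refine ⟨(fun j => (x j : ℚ)) ᵥ* LinearMap.toMatrix' g, fun j => ?_⟩
  have : ((fun j => (x j : ℚ)) ᵥ* LinearMap.toMatrix' g) ᵥ* B = fun j => (x j : ℚ) := by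
    rw [Matrix.vecMul_vecMul, hg', Matrix.vecMul_one]
  have h3 := congrFun this j
  simp only [Matrix.vecMul, dotProduct] at h3
  rw [← h3]
  rfl

lemma sdf_reduce {n r : ℕ} (H : ℕ) (A : Fin n → Fin r → ℤ) (hA : ∀ i j, |A i j| ≤ (H : ℤ))
    (h : ∀ u : Fin r → ℤ, (∀ i, ∑ j, u j * A i j = 0) → u = 0) (x : Fin r → ℤ) :
    ∃ s : Fin n → ℤ, ∀ j, |x j - ∑ i, s i * A i j| ≤ (n : ℤ) * H := by
  obtain ⟨t, ht⟩ := sdf_span A h x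
  refine ⟨fun i => ⌊t i⌋, fun j => ?_⟩
  have h1 : ((|x j - ∑ i, ⌊t i⌋ * A i j| : ℤ) : ℚ) ≤ ((n : ℤ) * H : ℤ) := by
    push_cast
    rw [ht j, ← Finset.sum_sub_distrib]
    calc |∑ i, (t i * (A i j : ℚ) - ⌊t i⌋ * A i j)|
        ≤ ∑ i, |t i * (A i j : ℚ) - ⌊t i⌋ * A i j| := Finset.abs_sum_le_sum_abs _ _
      _ ≤ ∑ _i : Fin n, (H : ℚ) := by
          refine Finset.sum_le_sum fun i _ => ?_
          rw [← sub_mul, abs_mul]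
          have h2 : |t i - ⌊t i⌋| ≤ 1 := by
            rw [abs_le]
            constructor
            · linarith [Int.floor_le (t i)]
            · linarith [Int.lt_floor_add_one (t i)]
          have h3 : |(A i j : ℚ)| ≤ H := by exact_mod_cast hA i j
          calc _ ≤ 1 * |(A i j : ℚ)| := by gcongr
            _ ≤ H := by linarith
      _ = _ := by simp
  exact_mod_cast h1

/-- the box in `ℤ^k` -/
noncomputable def sdfBox (k : ℕ) (H : ℤ) : Finset (Fin k → ℤ) := Fintype.piFinset fun _ => Finset.Icc (-H) H

lemma sdf_mem_box {k : ℕ} {H : ℤ} {x : Fin k → ℤ} : x ∈ sdfBox k H ↔ ∀ j, |x j| ≤ H := by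
  simp [sdfBox, abs_le]

lemma sdf_card_box (k H : ℕ) : (sdfBox k H).card = (2 * H + 1) ^ k := by
  simp only [sdfBox, Fintype.card_piFinset, Int.card_Icc, Finset.prod_const, Finset.card_univ,
    Fintype.card_fin]
  congr 1
  omega

/-- integer points of the box orthogonal to `v` -/
noncomputable def sdfR {k : ℕ} (H : ℕ) (v : Fin k → ℤ) : Finset (Fin k → ℤ) :=
  (sdfBox k H).filter fun x => ∑ j, v j * x j = 0

lemma sdf_index {n r : ℕ} (H m : ℕ) (hm : 0 < m) (v u : Fin (r + 1) → ℤ) (i0 : Fin (r + 1))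
    (hv : v i0 = m) (huv : ∑ j, u j * v j = 1) (A : Fin n → Fin (r + 1) → ℤ)
    (hA : ∀ i j, |A i j| ≤ (H : ℤ)) (hAv : ∀ i, ∑ j, v j * A i j = 0)
    (hk : ∀ w : Fin (r + 1) → ℤ, w i0 = 0 → (∀ i, ∑ j, w j * A i j = 0) → w = 0) :
    (sdfR H v).card * m ≤ (2 * ((n + 1) * H) + 1) ^ r := by
  have : NeZero m := ⟨hm.ne'⟩
  have key : ∀ c : ZMod m, ∃ y : Fin r → ℤ, (∀ j, |y j| ≤ (n : ℤ) * H) ∧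
      ((∑ j, v (i0.succAbove j) * y j : ℤ) : ZMod m) = c := by
    intro c
    obtain ⟨s, hs⟩ := sdf_reduce H (fun i j => A i (i0.succAbove j)) (fun i j => hA _ _) (by
      intro w hw
      have h0 := hk (i0.insertNth 0 w) (by simp) (by
        intro i
        rw [Fin.sum_univ_succAbove _ i0]
        simpa using hw i)
      funext j
      have := congrFun h0 (i0.succAbove j)
      simpa using this) (fun j => (c.val : ℤ) * u (i0.succAbove j))
    refine ⟨_, hs, ?_⟩
    have e1 : ∀ i, ∑ j, v (i0.succAbove j) * A i (i0.succAbove j) = - (m * A i i0) := by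
      intro i
      have := hAv i
      rw [Fin.sum_univ_succAbove _ i0, hv] at this
      linarith
    have e2 : ∑ j, u (i0.succAbove j) * v (i0.succAbove j) = 1 - u i0 * m := by
      rw [Fin.sum_univ_succAbove _ i0, hv] at huv
      linarith
    have e3 : ∑ j, v (i0.succAbove j) * ((c.val : ℤ) * u (i0.succAbove j) -
        ∑ i, s i * A i (i0.succAbove j)) =
        c.val * (1 - u i0 * m) + (∑ i, s i * A i i0) * m := by
      rw [← e2]
      simp only [mul_sub, Finset.sum_sub_distrib, Finset.mul_sum]
      rw [Finset.sum_comm, sub_eq_add_neg]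
      congr 1
      · exact Finset.sum_congr rfl fun j _ => by ring
      · rw [← Finset.sum_neg_distrib, Finset.sum_mul]
        refine Finset.sum_congr rfl fun i _ => ?_
        have : ∑ j, v (i0.succAbove j) * (s i * A i (i0.succAbove j)) =
            s i * ∑ j, v (i0.succAbove j) * A i (i0.succAbove j) := by
          rw [Finset.mul_sum]; exact Finset.sum_congr rfl fun j _ => by ring
        rw [this, e1]; ring
    rw [e3]
    push_cast
    simp
  choose y hy hyc using key
  have hcard : ((sdfR H v) ×ˢ (Finset.univ : Finset (ZMod m))).card ≤
      (sdfBox r ((((n + 1) * H : ℕ)) : ℤ)).card := by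
    refine Finset.card_le_card_of_injOn
      (fun p => fun j => p.1 (i0.succAbove j) + y p.2 j) ?_ ?_
    · rintro ⟨x, c⟩ hx
      simp only [Finset.coe_product, Set.mem_prod, Finset.mem_coe, sdfR, Finset.mem_filter,
        sdf_mem_box] at hx
      simp only [Finset.mem_coe, sdf_mem_box]
      intro j
      have h1 := hx.1.1 (i0.succAbove j)
      have h2 := hy c j
      have h3 := abs_add_le (x (i0.succAbove j)) (y c j)
      push_cast
      linarith
    · rintro ⟨x, c⟩ hx ⟨x', c'⟩ hx' he
      simp only [Finset.coe_product, Set.mem_prod, Finset.mem_coe, sdfR, Finset.mem_filter,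
        sdf_mem_box] at hx hx'
      have he' : ∀ j, x (i0.succAbove j) + y c j = x' (i0.succAbove j) + y c' j :=
        fun j => congrFun he j
      have f : ∀ x : Fin (r + 1) → ℤ, ∀ c, ∑ j, v j * x j = 0 →
          ((∑ j, v (i0.succAbove j) * (x (i0.succAbove j) + y c j) : ℤ) : ZMod m) = c := by
        intro x c hx
        rw [Fin.sum_univ_succAbove _ i0, hv] at hx
        have : ∑ j, v (i0.succAbove j) * (x (i0.succAbove j) + y c j) =
            - (m * x i0) + ∑ j, v (i0.succAbove j) * y c j := by
          simp only [mul_add, Finset.sum_add_distrib]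
          linarith
        rw [this, Int.cast_add, hyc]
        simp
      have hc : c = c' := by
        rw [← f x c hx.1.2, ← f x' c' hx'.1.2]
        simp only [he']
      subst hc
      have hxx : ∀ j, x (i0.succAbove j) = x' (i0.succAbove j) := fun j => by
        have := he' j; linarith
      have h0 : x i0 = x' i0 := by
        have h1 := hx.1.2
        have h2 := hx'.1.2
        rw [Fin.sum_univ_succAbove _ i0, hv] at h1 h2
        simp only [hxx] at h1
        have : (m : ℤ) * x i0 = m * x' i0 := by linarith
        exact mul_left_cancel₀ (by exact_mod_cast hm.ne') this
      have : x = x' := by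
        funext j
        rcases Fin.eq_self_or_eq_succAbove i0 j with rfl | ⟨k, rfl⟩
        · exact h0
        · exact hxx k
      rw [this]
  rw [Finset.card_product, Finset.card_univ, ZMod.card, sdf_card_box] at hcard
  exact hcard

lemma sdf_primitive {k : ℕ} (v : Fin k → ℤ) (hv : v ≠ 0) :
    ∃ g : ℤ, ∃ w u : Fin k → ℤ, g ≠ 0 ∧ (∀ j, v j = g * w j) ∧ ∑ j, u j * w j = 1 := by
  obtain ⟨g, hg⟩ := (IsPrincipalIdealRing.principal (Ideal.span (Set.range v))).principal
  have h1 : g ∈ Ideal.span (Set.range v) := by rw [hg]; exact Submodule.mem_span_singleton_self g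
  obtain ⟨u, hu⟩ := Ideal.mem_span_range_iff_exists_fun.1 h1
  have h2 : ∀ j, ∃ w, v j = g * w := by
    intro j
    have : v j ∈ Ideal.span (Set.range v) := Ideal.subset_span ⟨j, rfl⟩
    rw [hg] at this
    obtain ⟨w, hw⟩ := Submodule.mem_span_singleton.1 this
    exact ⟨w, by rw [← hw, smul_eq_mul, mul_comm]⟩
  choose w hw using h2
  have hg0 : g ≠ 0 := by
    rintro rfl
    exact hv (funext fun j => by simp [hw j])
  refine ⟨g, w, u, hg0, hw, ?_⟩
  apply mul_left_cancel₀ hg0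
  rw [mul_one, Finset.mul_sum]
  conv_rhs => rw [← hu]
  exact Finset.sum_congr rfl fun j _ => by rw [hw j]; ring

/-- primitive kernel vectors with largest coordinate `m` at `i0` -/
noncomputable def sdfSh (r : ℕ) (i0 : Fin (r + 1)) (m : ℕ) : Finset (Fin (r + 1) → ℤ) :=
  Fintype.piFinset fun j => if j = i0 then {(m : ℤ)} else Finset.Icc (-(m : ℤ)) m

lemma sdf_card_Sh (r : ℕ) (i0 : Fin (r + 1)) (m : ℕ) :
    (sdfSh r i0 m).card = (2 * m + 1) ^ r := by
  rw [sdfSh, Fintype.card_piFinset, Fin.prod_univ_succAbove _ i0]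
  simp only [if_true, Finset.card_singleton, one_mul, Fin.succAbove_ne, if_false, Int.card_Icc,
    Finset.prod_const, Finset.card_univ, Fintype.card_fin]
  congr 1
  omega

/-- matrices with a kernel vector such that no nonzero kernel vector vanishes at the last place -/
def sdfMain (n r H : ℕ) : Set (Fin n → Fin (r + 1) → ℤ) :=
  {A | (∀ i j, |A i j| ≤ (H : ℤ)) ∧ (∃ v : Fin (r + 1) → ℤ, v ≠ 0 ∧ ∀ i, ∑ j, v j * A i j = 0) ∧
    ∀ w : Fin (r + 1) → ℤ, w (Fin.last r) = 0 → (∀ i, ∑ j, w j * A i j = 0) → w = 0}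

lemma sdf_main_cover {n r H : ℕ} {A : Fin n → Fin (r + 1) → ℤ} (hA : A ∈ sdfMain n r H) :
    ∃ i0 : Fin (r + 1), ∃ m ∈ Finset.Icc 1 ((2 * ((n + 1) * H) + 1) ^ r), ∃ v ∈ sdfSh r i0 m,
      (sdfR H v).card * m ≤ (2 * ((n + 1) * H) + 1) ^ r ∧ ∀ i, A i ∈ sdfR H v := by
  obtain ⟨hbox, ⟨v, hv, hvA⟩, hlast⟩ := hA
  obtain ⟨g, w, u, hg, hvw, huw⟩ := sdf_primitive v hv
  have hwA : ∀ i, ∑ j, w j * A i j = 0 := by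
    intro i
    apply mul_left_cancel₀ hg
    rw [mul_zero, ← hvA i, Finset.mul_sum]
    exact Finset.sum_congr rfl fun j _ => by rw [hvw j]; ring
  obtain ⟨i0, hi0⟩ := Finite.exists_max fun j => |w j|
  have hw0 : w i0 ≠ 0 := by
    intro h
    have : ∀ j, w j = 0 := fun j => by
      have := hi0 j
      rw [h, abs_zero] at this
      exact abs_nonpos_iff.1 this
    simp [this] at huw
  -- make the largest coordinate positive
  obtain ⟨w, u, huw, hwA, hi0, hw0⟩ : ∃ w u : Fin (r + 1) → ℤ, ∑ j, u j * w j = 1 ∧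
      (∀ i, ∑ j, w j * A i j = 0) ∧ (∀ j, |w j| ≤ |w i0|) ∧ 0 < w i0 := by
    rcases lt_or_gt_of_ne hw0 with h | h
    · refine ⟨fun j => - w j, fun j => - u j, by simpa using huw, ?_, ?_, by simpa using h⟩
      · intro i
        simpa using hwA i
      · intro j
        simpa using hi0 j
    · exact ⟨w, u, huw, hwA, hi0, h⟩
  obtain ⟨m, hm⟩ := Int.eq_ofNat_of_zero_le hw0.le
  have hm0 : 0 < m := by omega
  have hwl : w (Fin.last r) ≠ 0 := by
    intro h
    have := hlast w h hwA
    rw [this] at hw0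
    simp at hw0
  have hk : ∀ z : Fin (r + 1) → ℤ, z i0 = 0 → (∀ i, ∑ j, z j * A i j = 0) → z = 0 := by
    intro z hz hzA
    have h1 := hlast (fun j => w (Fin.last r) * z j - z (Fin.last r) * w j) (by ring) (by
      intro i
      calc _ = w (Fin.last r) * ∑ j, z j * A i j - z (Fin.last r) * ∑ j, w j * A i j := by
            rw [Finset.mul_sum, Finset.mul_sum, ← Finset.sum_sub_distrib]
            exact Finset.sum_congr rfl fun j _ => by ring
        _ = 0 := by rw [hzA, hwA]; ring)
    have h2 : ∀ j, w (Fin.last r) * z j - z (Fin.last r) * w j = 0 := fun j => congrFun h1 j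
    have h3 : z (Fin.last r) = 0 := by
      have := h2 i0
      rw [hz, mul_zero, zero_sub, neg_eq_zero] at this
      rcases mul_eq_zero.1 this with h | h
      · exact h
      · omega
    funext j
    have := h2 j
    rw [h3, zero_mul, sub_zero] at this
    rcases mul_eq_zero.1 this with h | h
    · exact absurd h hwl
    · exact h
  have hidx := sdf_index H m hm0 w u i0 hm huw A hbox hwA hk
  have hpos : 1 ≤ (sdfR H w).card := by
    apply Finset.card_pos.2
    exact ⟨0, by simp [sdfR, sdf_mem_box]⟩
  refine ⟨i0, m, ?_, w, ?_, hidx, ?_⟩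
  · rw [Finset.mem_Icc]
    exact ⟨hm0, le_trans (by nlinarith) hidx⟩
  · rw [sdfSh, Fintype.mem_piFinset]
    intro j
    split_ifs with h
    · subst h; simpa using hm
    · rw [Finset.mem_Icc, ← abs_le]
      have := hi0 j
      rw [abs_of_pos hw0, hm] at this
      exact this
  · intro i
    rw [sdfR, Finset.mem_filter, sdf_mem_box]
    exact ⟨hbox i, hwA i⟩

lemma sdf_main_card {n r H : ℕ} (hr : r + 1 ≤ n) (M : ℕ) (hM : M = (2 * ((n + 1) * H) + 1) ^ r) :
    ((sdfMain n r H).ncard : ℝ) ≤ (r + 1) * 3 ^ r * (M : ℝ) ^ n * (1 + Real.log M) := by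
  classical
  set T : Finset (Fin n → Fin (r + 1) → ℤ) :=
    Finset.univ.biUnion fun i0 : Fin (r + 1) => (Finset.Icc 1 M).biUnion fun m =>
      ((sdfSh r i0 m).filter fun v => (sdfR H v).card * m ≤ M).biUnion fun v =>
        Fintype.piFinset fun _ : Fin n => sdfR H v with hT
  have hsub : sdfMain n r H ⊆ ↑T := by
    intro A hA
    obtain ⟨i0, m, hm, v, hv, h1, h2⟩ := sdf_main_cover hA
    rw [← hM] at hm h1
    simp only [hT, Finset.coe_biUnion, Set.mem_iUnion, Finset.mem_coe, Finset.mem_univ,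
      Finset.mem_filter, Fintype.mem_piFinset]
    exact ⟨i0, trivial, m, hm, v, ⟨hv, h1⟩, h2⟩
  have h1 : (sdfMain n r H).ncard ≤ T.card := by
    rw [← Set.ncard_coe_finset]
    exact Set.ncard_le_ncard hsub (Finset.finite_toSet _)
  have h2 : T.card ≤ ∑ i0 : Fin (r + 1), ∑ m ∈ Finset.Icc 1 M,
      ∑ v ∈ (sdfSh r i0 m).filter fun v => (sdfR H v).card * m ≤ M, (sdfR H v).card ^ n := by
    refine Finset.card_biUnion_le.trans (Finset.sum_le_sum fun i0 _ => ?_)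
    refine Finset.card_biUnion_le.trans (Finset.sum_le_sum fun m _ => ?_)
    refine Finset.card_biUnion_le.trans (Finset.sum_le_sum fun v _ => ?_)
    simp [Fintype.card_piFinset]
  have h3 : ∀ i0 : Fin (r + 1), ∀ m ∈ Finset.Icc 1 M,
      (∑ v ∈ (sdfSh r i0 m).filter fun v => (sdfR H v).card * m ≤ M,
        ((sdfR H v).card : ℝ) ^ n) ≤ 3 ^ r * (M : ℝ) ^ n * (m : ℝ)⁻¹ := by
    intro i0 m hm
    have hm1 : 1 ≤ m := (Finset.mem_Icc.1 hm).1
    have hm1' : (1 : ℝ) ≤ m := by exact_mod_cast hm1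
    have hm0 : (0 : ℝ) < m := by linarith
    calc _ ≤ ∑ v ∈ (sdfSh r i0 m).filter fun v => (sdfR H v).card * m ≤ M,
          ((M : ℝ) / m) ^ n := by
          refine Finset.sum_le_sum fun v hv => ?_
          have := (Finset.mem_filter.1 hv).2
          have : ((sdfR H v).card : ℝ) * m ≤ M := by exact_mod_cast this
          gcongr
          rwa [le_div_iff₀ hm0]
      _ ≤ ((2 * m + 1) ^ r : ℕ) * ((M : ℝ) / m) ^ n := by
          rw [Finset.sum_const, nsmul_eq_mul]
          gcongr
          rw [← sdf_card_Sh r i0 m]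
          exact Finset.card_filter_le _ _
      _ ≤ (3 ^ r * (m : ℝ) ^ r) * ((M : ℝ) ^ n / (m : ℝ) ^ (r + 1)) := by
          rw [div_pow]
          push_cast
          rw [← mul_pow]
          gcongr
          · linarith
      _ = _ := by
          rw [pow_succ]
          field_simp
  calc ((sdfMain n r H).ncard : ℝ) ≤ ((∑ i0 : Fin (r + 1), ∑ m ∈ Finset.Icc 1 M,
      ∑ v ∈ (sdfSh r i0 m).filter fun v => (sdfR H v).card * m ≤ M, (sdfR H v).card ^ n : ℕ) : ℝ) := by
        exact_mod_cast h1.trans h2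
    _ ≤ ∑ i0 : Fin (r + 1), ∑ m ∈ Finset.Icc 1 M, 3 ^ r * (M : ℝ) ^ n * (m : ℝ)⁻¹ := by
        push_cast
        exact Finset.sum_le_sum fun i0 _ => Finset.sum_le_sum fun m hm => h3 i0 m hm
    _ = (r + 1) * 3 ^ r * (M : ℝ) ^ n * ∑ m ∈ Finset.Icc 1 M, (m : ℝ)⁻¹ := by
        rw [Finset.sum_const, ← Finset.mul_sum]
        simp
        ring
    _ ≤ _ := by
        have := harmonic_le_one_add_log M
        rw [harmonic_eq_sum_Icc] at this
        push_cast at this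
        gcongr

lemma sdf_main_bound (n r : ℕ) (hr : r + 1 ≤ n) : ∃ C : ℝ, 0 ≤ C ∧ ∀ H : ℕ, 2 ≤ H →
    ((sdfMain n r H).ncard : ℝ) ≤ C * (H : ℝ) ^ (n * r) * Real.log H := by
  refine ⟨(r + 1) * 3 ^ r * ((2 * n + 3) ^ r) ^ n * (2 + r * (2 * n + 4)), by positivity, ?_⟩
  intro H hH
  have hH' : (2 : ℝ) ≤ H := by exact_mod_cast hH
  have hlog : 1 / 2 ≤ Real.log H := by
    have h1 := Real.log_le_log (by norm_num) hH'
    have := Real.log_two_gt_d9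
    linarith
  have hb : (((2 * ((n + 1) * H) + 1 : ℕ)) : ℝ) ≤ (2 * n + 3) * H := by
    push_cast; nlinarith
  have hb1 : (1 : ℝ) ≤ ((2 * ((n + 1) * H) + 1 : ℕ)) := by
    exact_mod_cast Nat.le_add_left _ _
  have hb2 : Real.log ((2 * ((n + 1) * H) + 1 : ℕ)) ≤ (2 * n + 4) * Real.log H := by
    have : (((2 * ((n + 1) * H) + 1 : ℕ)) : ℝ) ≤ (H : ℝ) ^ (2 * n + 4) := by
      refine hb.trans ?_
      rw [pow_succ (H : ℝ) (2 * n + 3)]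
      gcongr
      have h1 : (2 * n + 3 : ℕ) < 2 ^ (2 * n + 3) := Nat.lt_two_pow_self
      have h2 : ((2 * n + 3 : ℕ) : ℝ) ≤ 2 ^ (2 * n + 3) := by exact_mod_cast h1.le
      push_cast at h2
      exact h2.trans (by gcongr)
    have h3 := Real.log_le_log (by linarith) this
    rw [Real.log_pow] at h3
    push_cast at h3 ⊢
    exact h3
  have hmain := sdf_main_card (H := H) hr _ rfl
  refine hmain.trans ?_
  rw [Nat.cast_pow, Real.log_pow]
  have hp : ((((2 * ((n + 1) * H) + 1 : ℕ)) : ℝ) ^ r) ^ n ≤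
      ((2 * n + 3) ^ r) ^ n * (H : ℝ) ^ (n * r) := by
    calc _ ≤ (((2 * n + 3) * (H : ℝ)) ^ r) ^ n := by gcongr
      _ = _ := by rw [mul_pow, mul_pow, ← pow_mul (H : ℝ), mul_comm r n]
  have hl : 1 + r * Real.log ((2 * ((n + 1) * H) + 1 : ℕ)) ≤
      (2 + r * (2 * n + 4)) * Real.log H := by
    have : (r : ℝ) * Real.log ((2 * ((n + 1) * H) + 1 : ℕ)) ≤ r * ((2 * n + 4) * Real.log H) := by
      gcongr
    linarith
  have hl0 : 0 ≤ 1 + r * Real.log ((2 * ((n + 1) * H) + 1 : ℕ)) := by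
    have := Real.log_nonneg hb1
    positivity
  calc _ ≤ (r + 1) * 3 ^ r * (((2 * n + 3) ^ r) ^ n * (H : ℝ) ^ (n * r)) *
      ((2 + r * (2 * n + 4)) * Real.log H) := by gcongr
    _ = _ := by ring

/-- integer matrices in the box with dependent columns -/
def sdfDep (n k H : ℕ) : Set (Fin n → Fin k → ℤ) :=
  {A | (∀ i j, |A i j| ≤ (H : ℤ)) ∧ ∃ v : Fin k → ℤ, v ≠ 0 ∧ ∀ i, ∑ j, v j * A i j = 0}

lemma sdf_box_finite (n k : ℕ) (H : ℤ) : {A : Fin n → Fin k → ℤ | ∀ i j, |A i j| ≤ H}.Finite := by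
  refine (Finset.finite_toSet (Fintype.piFinset fun _ : Fin n => sdfBox k H)).subset ?_
  intro A hA
  simp only [Finset.mem_coe, Fintype.mem_piFinset, sdf_mem_box]
  exact hA

lemma sdf_dep_finite (n k H : ℕ) : (sdfDep n k H).Finite :=
  (sdf_box_finite n k H).subset fun _ hA => hA.1

lemma sdf_dep_succ (n r H : ℕ) :
    (sdfDep n (r + 1) H).ncard ≤ (sdfDep n r H).ncard * (2 * H + 1) ^ n + (sdfMain n r H).ncard := by
  set S : Set (Fin n → Fin (r + 1) → ℤ) := {A | (∀ i j, |A i j| ≤ (H : ℤ)) ∧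
    (fun i j => A i (Fin.castSucc j)) ∈ sdfDep n r H} with hS
  have h1 : sdfDep n (r + 1) H ⊆ S ∪ sdfMain n r H := by
    intro A hA
    by_cases h : ∀ w : Fin (r + 1) → ℤ, w (Fin.last r) = 0 →
      (∀ i, ∑ j, w j * A i j = 0) → w = 0
    · exact Or.inr ⟨hA.1, hA.2, h⟩
    · left
      push Not at h
      obtain ⟨w, hw, hwA, hw0⟩ := h
      refine ⟨hA.1, fun i j => hA.1 _ _, fun j => w (Fin.castSucc j), ?_, ?_⟩
      · intro h0
        apply hw0
        funext j
        refine Fin.lastCases hw (fun j => ?_) j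
        exact congrFun h0 j
      · intro i
        have := hwA i
        rw [Fin.sum_univ_castSucc, hw] at this
        simpa using this
  have hSfin : S.Finite := (sdf_box_finite n (r + 1) H).subset fun _ hA => hA.1
  have hMfin : (sdfMain n r H).Finite := (sdf_box_finite n (r + 1) H).subset fun _ hA => hA.1
  have h2 : S.ncard ≤ ((sdfDep n r H) ×ˢ (↑(sdfBox n H) : Set (Fin n → ℤ))).ncard := by
    refine Set.ncard_le_ncard_of_injOn
      (fun A => (fun i j => A i (Fin.castSucc j), fun i => A i (Fin.last r))) ?_ ?_
      ((sdf_dep_finite n r H).prod (Finset.finite_toSet _))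
    · intro A hA
      refine ⟨hA.2, ?_⟩
      simp only [Finset.mem_coe, sdf_mem_box]
      exact fun i => hA.1 _ _
    · intro A _ B _ hAB
      simp only [Prod.mk.injEq] at hAB
      funext i j
      refine Fin.lastCases ?_ (fun j => ?_) j
      · exact congrFun hAB.2 i
      · exact congrFun (congrFun hAB.1 i) j
  rw [Set.ncard_prod, Set.ncard_coe_finset, sdf_card_box] at h2
  calc _ ≤ (S ∪ sdfMain n r H).ncard := Set.ncard_le_ncard h1 (hSfin.union hMfin)
    _ ≤ S.ncard + (sdfMain n r H).ncard := Set.ncard_union_le _ _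
    _ ≤ _ := by gcongr

lemma sdf_dep_bound (n k : ℕ) (hk : k ≤ n) : ∃ C : ℝ, 0 ≤ C ∧ ∀ H : ℕ, 2 ≤ H →
    ((sdfDep n k H).ncard : ℝ) * (H : ℝ) ^ n ≤ C * (H : ℝ) ^ (n * k) * Real.log H := by
  induction k with
  | zero =>
    refine ⟨0, le_rfl, fun H _ => ?_⟩
    have : sdfDep n 0 H = ∅ := by
      ext A
      simp only [sdfDep, Set.mem_setOf_eq, Set.mem_empty_iff_false, iff_false]
      rintro ⟨_, v, hv, _⟩
      exact hv (Subsingleton.elim _ _)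
    simp [this]
  | succ r ih =>
    obtain ⟨C₁, hC₁, h₁⟩ := ih (by omega)
    obtain ⟨C₂, hC₂, h₂⟩ := sdf_main_bound n r hk
    refine ⟨C₁ * 3 ^ n + C₂, by positivity, fun H hH => ?_⟩
    have hH' : (2 : ℝ) ≤ H := by exact_mod_cast hH
    have a1 := h₁ H hH
    have a2 := h₂ H hH
    have a3 : ((sdfDep n (r + 1) H).ncard : ℝ) ≤
        (sdfDep n r H).ncard * (2 * H + 1) ^ n + (sdfMain n r H).ncard := by
      exact_mod_cast sdf_dep_succ n r H
    have a4 : (2 * (H : ℝ) + 1) ^ n ≤ 3 ^ n * (H : ℝ) ^ n := by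
      rw [← mul_pow]; gcongr; linarith
    calc ((sdfDep n (r + 1) H).ncard : ℝ) * (H : ℝ) ^ n
        ≤ ((sdfDep n r H).ncard * (3 ^ n * (H : ℝ) ^ n) + C₂ * (H : ℝ) ^ (n * r) * Real.log H)
          * (H : ℝ) ^ n := by
          gcongr
          refine a3.trans ?_
          gcongr
      _ = (3 ^ n * ((sdfDep n r H).ncard * (H : ℝ) ^ n) + C₂ * (H : ℝ) ^ (n * r) * Real.log H)
          * (H : ℝ) ^ n := by ring
      _ ≤ (3 ^ n * (C₁ * (H : ℝ) ^ (n * r) * Real.log H) + C₂ * (H : ℝ) ^ (n * r) * Real.log H)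
          * (H : ℝ) ^ n := by gcongr
      _ = _ := by rw [Nat.mul_succ, pow_add]; ring

/-- the fibre with row-dependent box sizes -/
def sdfJ (n : ℕ) (h : Fin n → ℤ) (K : Matrix (Fin n) (Fin n) ℂ) (α : ℂ) :
    Set (Matrix (Fin n) (Fin n) ℤ) :=
  {A | (∀ i j, |A i j| ≤ h i) ∧ (A.map (Int.cast : ℤ → ℂ) - K).det = α}

lemma sdfJ_finite (n : ℕ) (h : Fin n → ℤ) (K : Matrix (Fin n) (Fin n) ℂ) (α : ℂ) :
    (sdfJ n h K α).Finite := by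
  refine (Finset.finite_toSet (Fintype.piFinset fun i : Fin n => sdfBox n (h i))).subset ?_
  intro A hA
  simp only [Finset.mem_coe, Fintype.mem_piFinset, sdf_mem_box]
  exact hA.1

lemma sdf_step (n : ℕ) (h : Fin n → ℤ) (K : Matrix (Fin n) (Fin n) ℂ) (α : ℂ) (i0 : Fin n) :
    (sdfJ n h K α).ncard ≤
      (sdfJ n (Function.update h i0 (2 * h i0)) (K.updateRow i0 0) 0).ncard := by
  classical
  have hex : ∀ b : Matrix (Fin n) (Fin n) ℤ, ∃ B : Matrix (Fin n) (Fin n) ℤ,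
      (∃ A ∈ sdfJ n h K α, A.updateRow i0 0 = b) → B ∈ sdfJ n h K α ∧ B.updateRow i0 0 = b := by
    intro b
    by_cases hb : ∃ A ∈ sdfJ n h K α, A.updateRow i0 0 = b
    · obtain ⟨A, hA⟩ := hb
      exact ⟨A, fun _ => hA⟩
    · exact ⟨0, fun h => absurd h hb⟩
  choose f hf using hex
  have hf' : ∀ A ∈ sdfJ n h K α, f (A.updateRow i0 0) ∈ sdfJ n h K α ∧
      ∀ i, i ≠ i0 → f (A.updateRow i0 0) i = A i := by
    intro A hA
    obtain ⟨h1, h2⟩ := hf (A.updateRow i0 0) ⟨A, hA, rfl⟩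
    refine ⟨h1, fun i hi => ?_⟩
    have := congrFun h2 i
    rwa [Matrix.updateRow_ne hi, Matrix.updateRow_ne hi] at this
  refine Set.ncard_le_ncard_of_injOn
    (fun A => A.updateRow i0 (A i0 - f (A.updateRow i0 0) i0)) ?_ ?_ (sdfJ_finite _ _ _ _)
  · intro A hA
    obtain ⟨hB, hBA⟩ := hf' A hA
    set B := f (A.updateRow i0 0) with hBdef
    refine ⟨fun i j => ?_, ?_⟩
    · by_cases hi : i = i0
      · subst hi
        simp only [Matrix.updateRow_self, Function.update_self, Pi.sub_apply]
        have h1 := hA.1 i j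
        have h2 := hB.1 i j
        have h3 := abs_sub (A i j) (B i j)
        linarith
      · rw [Matrix.updateRow_ne hi, Function.update_of_ne hi]
        exact hA.1 i j
    · set P := A.map (Int.cast : ℤ → ℂ) - K with hP
      set Q := B.map (Int.cast : ℤ → ℂ) - K with hQ
      have e1 : (A.updateRow i0 (A i0 - B i0)).map (Int.cast : ℤ → ℂ) - K.updateRow i0 0 =
          P.updateRow i0 (P i0 - Q i0) := by
        ext i j
        by_cases hi : i = i0
        · subst hi
          simp [hP, hQ]
        · simp [hi, hP]
      have e2 : P.updateRow i0 (Q i0) = Q := by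
        ext i j
        by_cases hi : i = i0
        · subst hi
          simp
        · simp [hi, hP, hQ, hBA i hi]
      have e3 : P.det = (P.updateRow i0 (P i0 - Q i0)).det + Q.det := by
        conv_rhs => rw [← e2]
        rw [e2, ← congrArg Matrix.det e2, ← Matrix.det_updateRow_add, sub_add_cancel,
          Matrix.updateRow_eq_self]
      have hA2 : P.det = α := hA.2
      have hB2 : Q.det = α := hB.2
      rw [e1]
      rw [hA2, hB2] at e3
      simpa using e3.symm
  · intro A hA A' hA' he
    have he' : A.updateRow i0 (A i0 - f (A.updateRow i0 0) i0) =
      A'.updateRow i0 (A' i0 - f (A'.updateRow i0 0) i0) := he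
    have h1 : A.updateRow i0 0 = A'.updateRow i0 0 := by
      have := congrArg (fun X => Matrix.updateRow X i0 0) he'
      simpa using this
    have h2 := congrFun he' i0
    simp only [Matrix.updateRow_self] at h2
    rw [h1] at h2
    have h3 : A i0 = A' i0 := sub_left_injective h2
    calc A = (A.updateRow i0 0).updateRow i0 (A i0) := by simp
      _ = (A'.updateRow i0 0).updateRow i0 (A' i0) := by rw [h1, h3]
      _ = A' := by simp

lemma sdf_iter (n : ℕ) (H : ℤ) (K : Matrix (Fin n) (Fin n) ℂ) (α : ℂ) (s : Finset (Fin n)) :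
    ∃ α' : ℂ, (s.Nonempty → α' = 0) ∧ (sdfJ n (fun _ => H) K α).ncard ≤
      (sdfJ n (fun i => if i ∈ s then 2 * H else H)
        (Matrix.of fun i j => if i ∈ s then 0 else K i j) α').ncard := by
  classical
  induction s using Finset.induction_on with
  | empty =>
    refine ⟨α, by simp, le_of_eq ?_⟩
    congr 2
  | insert a s ha ih =>
    obtain ⟨α', _, h⟩ := ih
    refine ⟨0, fun _ => rfl, h.trans ((sdf_step n _ _ α' a).trans (le_of_eq ?_))⟩
    congr 2
    · funext i
      by_cases hi : i = a
      · subst hi; simp [ha]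
      · simp [hi]
    · ext i j
      by_cases hi : i = a
      · subst hi; simp
      · simp [hi]

/-- Lemma 2.3: uniformly over complex matrices `K` and `α ∈ ℂ`, the number of matrices
`A ∈ M_n(ℤ;H)` with `det(A - K) = α` is `O(H^(n²-n) log H)`. -/
theorem shifted_determinant_fibre_count (n : ℕ) (hn : 1 ≤ n) :
    ∃ C : ℝ, 0 < C ∧ ∀ H : ℕ, 2 ≤ H → ∀ K : Matrix (Fin n) (Fin n) ℂ, ∀ α : ℂ,
      (Set.ncard {A : Matrix (Fin n) (Fin n) ℤ | (∀ i j, |A i j| ≤ (H : ℤ)) ∧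
        (A.map (Int.cast : ℤ → ℂ) - K).det = α} : ℝ) ≤
      C * (H : ℝ) ^ (n ^ 2 - n) * Real.log H := by
  obtain ⟨C, hC, hb⟩ := sdf_dep_bound n n le_rfl
  refine ⟨2 * C * 2 ^ (n ^ 2 - n) + 1, by positivity, fun H hH K α => ?_⟩
  have hH' : (2 : ℝ) ≤ H := by exact_mod_cast hH
  obtain ⟨α', hα', h1⟩ := sdf_iter n H K α Finset.univ
  have : Nonempty (Fin n) := ⟨⟨0, hn⟩⟩
  obtain rfl := hα' Finset.univ_nonempty
  have h2 : (sdfJ n (fun i => if i ∈ Finset.univ then 2 * (H : ℤ) else H)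
        (Matrix.of fun i j => if i ∈ Finset.univ then 0 else K i j) 0).ncard ≤
        (sdfDep n n (2 * H)).ncard := by
    refine Set.ncard_le_ncard ?_ (sdf_dep_finite n n (2 * H))
    rintro A ⟨hA1, hA2⟩
    refine ⟨fun i j => by simpa using hA1 i j, ?_⟩
    have hz : (A.map (Int.cast : ℤ → ℂ)).det = 0 := by
      rw [← hA2]
      congr 1
      ext i j
      simp
    have hz' : A.det = 0 := by
      have h3 : ((A.det : ℤ) : ℂ) = (A.map (Int.cast : ℤ → ℂ)).det := by
        have := RingHom.map_det (Int.castRingHom ℂ) A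
        simpa using this
      rw [hz] at h3
      exact_mod_cast h3
    obtain ⟨v, hv, hAv⟩ := Matrix.exists_mulVec_eq_zero_iff.2 hz'
    refine ⟨v, hv, fun i => ?_⟩
    have := congrFun hAv i
    simp only [Matrix.mulVec, dotProduct, Pi.zero_apply] at this
    rw [← this]
    exact Finset.sum_congr rfl fun j _ => mul_comm _ _
  have h3 := hb (2 * H) (by omega)
  push_cast at h3
  have hnn : n * n = (n ^ 2 - n) + n := by
    have : n ≤ n ^ 2 := Nat.le_self_pow (by norm_num) n
    rw [Nat.sub_add_cancel this, sq]
  have hlogH : 0 ≤ Real.log H := Real.log_nonneg (by linarith)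
  have hlog2 : Real.log (2 * H) ≤ 2 * Real.log H := by
    rw [Real.log_mul (by norm_num) (by positivity)]
    have := Real.log_le_log (by norm_num) hH'
    linarith
  have h4 : ((sdfDep n n (2 * H)).ncard : ℝ) ≤
      C * (2 * (H : ℝ)) ^ (n ^ 2 - n) * Real.log (2 * H) := by
    rw [hnn, pow_add] at h3
    have hp : (0 : ℝ) < (2 * H) ^ n := by positivity
    refine le_of_mul_le_mul_right (h3.trans (le_of_eq ?_)) hp
    ring
  have h5 : ((sdfJ n (fun _ => (H : ℤ)) K α).ncard : ℝ) ≤ (sdfDep n n (2 * H)).ncard := by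
    exact_mod_cast h1.trans h2
  calc _ = ((sdfJ n (fun _ => (H : ℤ)) K α).ncard : ℝ) := rfl
    _ ≤ C * (2 * (H : ℝ)) ^ (n ^ 2 - n) * Real.log (2 * H) := h5.trans h4
    _ ≤ C * (2 * (H : ℝ)) ^ (n ^ 2 - n) * (2 * Real.log H) := by gcongr
    _ = 2 * C * 2 ^ (n ^ 2 - n) * (H : ℝ) ^ (n ^ 2 - n) * Real.log H := by
        rw [mul_pow]; ring
    _ ≤ _ := by
        gcongr
        linarith
end
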